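/- Let A ≥ e^{11.2} be a real number. Then for all fundamental discriminants D < 0 with |D| ≥ A, with at most one exception (i.e., there exists at most one such D for which the inequality fails), the class number satisfies h(D) > (0.655/(π·log A)) · |D|^{1/2 − 1/log A}. -/

import Mathlib

open NumberField

/-- `D` is a fundamental discriminant: either `D ≡ 1 (mod 4)` and `D` is squarefree,
or `D = 4m` for a squarefree integer `m ≡ 2` or `3 (mod 4)`. (We exclude the degenerate
case `D = 1`, so that `D` is the discriminant of a quadratic number field.) -/
def IsFundamentalDiscriminant (D : ℤ) : Prop :=
  D ≠ 1 ∧ ((D % 4 = 1 ∧ Squarefree D) ∨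
    ∃ m : ℤ, D = 4 * m ∧ Squarefree m ∧ (m % 4 = 2 ∨ m % 4 = 3))

namespace SiegelTatuzawa

open MeasureTheory Filter Topology

/-- The two-sided Laplace transform on the real line. -/
noncomputable def lap (f : ℝ → ℝ) (s : ℝ) : ℝ := ∫ x, f x * Real.exp (s * x)

/-- Additive convolution on the real line. -/
noncomputable def conv (f g : ℝ → ℝ) (x : ℝ) : ℝ := ∫ y, f y * g (x - y)

/-- `f` is measurable and `O(exp (-a x))` uniformly on the line for every `a ∈ I`. -/
structure ExpBdd (I : Set ℝ) (f : ℝ → ℝ) : Prop where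
  meas : Measurable f
  bound : ∀ a ∈ I, ∃ C, ∀ x, |f x| ≤ C * Real.exp (-a * x)

lemma integrable_exp_neg_mul_abs {b : ℝ} (hb : 0 < b) :
    Integrable fun y : ℝ => Real.exp (-b * |y|) := by
  rw [← integrableOn_univ, ← Set.Iic_union_Ioi (a := (0 : ℝ))]
  refine IntegrableOn.union ?_ ?_
  · refine (integrableOn_exp_mul_Iic hb 0).congr_fun ?_ measurableSet_Iic
    intro x hx
    simp [abs_of_nonpos (Set.mem_Iic.1 hx)]
  · refine (integrableOn_exp_mul_Ioi (neg_lt_zero.2 hb) 0).congr_fun ?_ measurableSet_Ioi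
    intro x hx
    simp [abs_of_pos (Set.mem_Ioi.1 hx)]

lemma ExpBdd.mono {I J : Set ℝ} {f : ℝ → ℝ} (hf : ExpBdd I f) (h : J ⊆ I) : ExpBdd J f :=
  ⟨hf.meas, fun a ha => hf.bound a (h ha)⟩

lemma ExpBdd.abs {I : Set ℝ} {f : ℝ → ℝ} (hf : ExpBdd I f) : ExpBdd I fun x => |f x| :=
  ⟨hf.meas.abs, fun a ha => by simpa using hf.bound a ha⟩

lemma ExpBdd.exists_bound {I : Set ℝ} (hI : IsOpen I) {f : ℝ → ℝ} (hf : ExpBdd I f) {a : ℝ}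
    (ha : a ∈ I) : ∃ b > 0, ∃ C ≥ 0, ∀ x, |f x| * Real.exp (a * x) ≤ C * Real.exp (-b * |x|) := by
  obtain ⟨ε, hε, hball⟩ := Metric.isOpen_iff.1 hI a ha
  have h1 : a + ε / 2 ∈ I := hball (by simp [abs_of_pos hε, hε])
  have h2 : a - ε / 2 ∈ I := hball (by simp [abs_of_pos hε]; linarith)
  obtain ⟨C1, hC1⟩ := hf.bound _ h1
  obtain ⟨C2, hC2⟩ := hf.bound _ h2
  have hC10 : 0 ≤ C1 := by simpa using (abs_nonneg _).trans (hC1 0)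
  have hC20 : 0 ≤ C2 := by simpa using (abs_nonneg _).trans (hC2 0)
  refine ⟨ε / 2, by linarith, max C1 C2, le_max_of_le_left hC10, fun x => ?_⟩
  rcases le_total 0 x with hx | hx
  · calc _ ≤ C1 * Real.exp (-(a + ε / 2) * x) * Real.exp (a * x) := by gcongr; exact hC1 x
      _ = C1 * Real.exp (-(ε / 2) * |x|) := by
        rw [mul_assoc, ← Real.exp_add, abs_of_nonneg hx]; ring_nf
      _ ≤ _ := by gcongr; exact le_max_left _ _
  · calc _ ≤ C2 * Real.exp (-(a - ε / 2) * x) * Real.exp (a * x) := by gcongr; exact hC2 x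
      _ = C2 * Real.exp (-(ε / 2) * |x|) := by
        rw [mul_assoc, ← Real.exp_add, abs_of_nonpos hx]; ring_nf
      _ ≤ _ := by gcongr; exact le_max_right _ _

lemma ExpBdd.integrable {I : Set ℝ} (hI : IsOpen I) {f : ℝ → ℝ} (hf : ExpBdd I f) {s : ℝ}
    (hs : s ∈ I) : Integrable fun x => f x * Real.exp (s * x) := by
  obtain ⟨b, hb, C, hC, h⟩ := hf.exists_bound hI hs
  refine ((integrable_exp_neg_mul_abs hb).const_mul C).mono'
    (hf.meas.mul (by fun_prop)).aestronglyMeasurable (ae_of_all _ fun x => ?_)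
  simpa [abs_mul] using h x

lemma ExpBdd.comp_add_right {I : Set ℝ} {f : ℝ → ℝ} (hf : ExpBdd I f) (c : ℝ) :
    ExpBdd I fun x => f (x + c) := by
  refine ⟨hf.meas.comp (by fun_prop), fun a ha => ?_⟩
  obtain ⟨C, hC⟩ := hf.bound a ha
  refine ⟨C * Real.exp (-a * c), fun x => (hC _).trans_eq ?_⟩
  rw [mul_assoc, ← Real.exp_add]; ring_nf

lemma measurable_conv {f g : ℝ → ℝ} (hf : Measurable f) (hg : Measurable g) :
    Measurable (conv f g) := by
  have : StronglyMeasurable (Function.uncurry fun x y : ℝ => f y * g (x - y)) := by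
    apply Measurable.stronglyMeasurable
    unfold Function.uncurry
    exact (hf.comp measurable_snd).mul (hg.comp (measurable_fst.sub measurable_snd))
  exact this.integral_prod_right.measurable

lemma exists_conv_bound {I : Set ℝ} (hI : IsOpen I) {f g : ℝ → ℝ} (hf : ExpBdd I f)
    (hg : ExpBdd I g) {a : ℝ} (ha : a ∈ I) : ∃ b > 0, ∃ C ≥ 0, ∀ x y,
      |f y * g (x - y)| ≤ C * Real.exp (-a * x) * Real.exp (-b * |y|) := by
  obtain ⟨b, hb, C, hC, h⟩ := hf.exists_bound hI ha
  obtain ⟨D, hD⟩ := hg.bound a ha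
  have hD0 : 0 ≤ D := by simpa using (abs_nonneg _).trans (hD 0)
  refine ⟨b, hb, C * D, by positivity, fun x y => ?_⟩
  rw [abs_mul]
  calc |f y| * |g (x - y)| ≤ |f y| * (D * Real.exp (-a * (x - y))) := by gcongr; exact hD _
    _ = |f y| * Real.exp (a * y) * (D * Real.exp (-a * x)) := by
        rw [show -a * (x - y) = a * y + -a * x by ring, Real.exp_add]; ring
    _ ≤ C * Real.exp (-b * |y|) * (D * Real.exp (-a * x)) :=
        mul_le_mul_of_nonneg_right (h y) (by positivity)
    _ = _ := by ring

lemma conv_integrable {I : Set ℝ} (hI : IsOpen I) (hne : I.Nonempty) {f g : ℝ → ℝ}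
    (hf : ExpBdd I f) (hg : ExpBdd I g) (x : ℝ) : Integrable fun y => f y * g (x - y) := by
  obtain ⟨a, ha⟩ := hne
  obtain ⟨b, hb, C, hC, h⟩ := exists_conv_bound hI hf hg ha
  exact ((integrable_exp_neg_mul_abs hb).const_mul (C * Real.exp (-a * x))).mono'
    (hf.meas.mul (hg.meas.comp (by fun_prop))).aestronglyMeasurable (ae_of_all _ fun y => h x y)

lemma ExpBdd.conv {I : Set ℝ} (hI : IsOpen I) {f g : ℝ → ℝ} (hf : ExpBdd I f)
    (hg : ExpBdd I g) : ExpBdd I (conv f g) := by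
  refine ⟨measurable_conv hf.meas hg.meas, fun a ha => ?_⟩
  obtain ⟨b, hb, C, hC, h⟩ := exists_conv_bound hI hf hg ha
  refine ⟨C * ∫ y, Real.exp (-b * |y|), fun x => ?_⟩
  calc |SiegelTatuzawa.conv f g x| ≤ ∫ y, |f y * g (x - y)| := abs_integral_le_integral_abs
    _ ≤ ∫ y, C * Real.exp (-a * x) * Real.exp (-b * |y|) :=
        integral_mono (conv_integrable hI ⟨a, ha⟩ hf hg x).abs
          ((integrable_exp_neg_mul_abs hb).const_mul _) fun y => h x y
    _ = _ := by rw [integral_const_mul]; ring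

lemma lap_conv {I : Set ℝ} (hI : IsOpen I) {f g : ℝ → ℝ} (hf : ExpBdd I f)
    (hg : ExpBdd I g) {s : ℝ} (hs : s ∈ I) : lap (conv f g) s = lap f s * lap g s := by
  have := integral_convolution (L := ContinuousLinearMap.mul ℝ ℝ) (μ := volume) (ν := volume)
    (hf.integrable hI hs) (hg.integrable hI hs)
  simp only [convolution_def, ContinuousLinearMap.mul_apply'] at this
  rw [lap, lap, lap, ← this]
  congr 1
  ext x
  rw [conv, ← integral_mul_const]
  congr 1
  ext y
  rw [show s * x = s * y + s * (x - y) by ring, Real.exp_add]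
  ring

lemma lap_comp_add_right (f : ℝ → ℝ) (c s : ℝ) :
    lap (fun x => f (x + c)) s = Real.exp (-s * c) * lap f s := by
  rw [lap, lap, ← integral_const_mul,
    ← integral_add_right_eq_self (μ := volume) (fun x => Real.exp (-s * c) * (f x * Real.exp (s * x))) c]
  congr 1
  ext x
  rw [mul_left_comm, ← Real.exp_add]
  ring_nf

lemma conv_comp_add (f g : ℝ → ℝ) (c d x : ℝ) :
    ∫ y, f (y + c) * g (x - y + d) = conv f g (x + (c + d)) := by
  rw [conv, ← integral_add_right_eq_self (μ := volume) (fun y => f y * g (x + (c + d) - y)) c]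
  congr 1
  ext y
  ring_nf

lemma conv_nonneg {f g : ℝ → ℝ} (hf : ∀ x, 0 ≤ f x) (hg : ∀ x, 0 ≤ g x) (x : ℝ) :
    0 ≤ conv f g x := integral_nonneg fun _ => mul_nonneg (hf _) (hg _)

/-- Functional equation `f (-x) = W exp x f x`. -/
def FEq (W : ℝ) (f : ℝ → ℝ) : Prop := ∀ x, f (-x) = W * Real.exp x * f x

lemma FEq.conv {W V : ℝ} {f g : ℝ → ℝ} (hf : FEq W f) (hg : FEq V g) :
    FEq (W * V) (conv f g) := by
  intro x
  rw [SiegelTatuzawa.conv, SiegelTatuzawa.conv, ← integral_const_mul,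
    ← integral_neg_eq_self (μ := volume)]
  congr 1
  ext y
  rw [hf y, show -x - -y = -(x - y) by ring, hg (x - y),
    show Real.exp x = Real.exp y * Real.exp (x - y) by rw [← Real.exp_add]; ring_nf]
  ring

lemma FEq.lap {W : ℝ} {f : ℝ → ℝ} (hf : FEq W f) (s : ℝ) : lap f s = W * lap f (1 - s) := by
  rw [SiegelTatuzawa.lap, SiegelTatuzawa.lap, ← integral_const_mul,
    ← integral_neg_eq_self (μ := volume)]
  congr 1
  ext y
  rw [hf y, show (1 - s) * y = y + s * -y by ring, Real.exp_add]
  ring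

/-- The series `∑ |a n| n ^ (-s)` converges. -/
def AbsConvAt (a : ArithmeticFunction ℝ) (s : ℝ) : Prop :=
  Summable fun n : ℕ => |a n| * Real.exp (-s * Real.log n)

/-- `f x = ∑ a n k (x + log n - q)` for all `x`. -/
def Rep (f : ℝ → ℝ) (a : ArithmeticFunction ℝ) (k : ℝ → ℝ) (q : ℝ) : Prop :=
  ∀ x, HasSum (fun n : ℕ => a n * k (x + Real.log n - q)) (f x)

lemma hasSum_regroup (a b : ArithmeticFunction ℝ) (F : ℕ → ℝ) {v : ℝ}
    (h : HasSum (fun p : ℕ × ℕ => a p.1 * b p.2 * F (p.1 * p.2)) v) :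
    HasSum (fun n => (a * b) n * F n) v := by
  have h1 := h.tsum_fiberwise (fun p : ℕ × ℕ => p.1 * p.2)
  refine (congrArg (fun φ : ℕ → ℝ => HasSum φ v) ?_).mpr h1
  funext n
  rcases eq_or_ne n 0 with rfl | hn
  · rw [ArithmeticFunction.map_zero, zero_mul]
    symm
    convert tsum_zero with p
    obtain ⟨p, hp⟩ := p
    rcases mul_eq_zero.1 (show p.1 * p.2 = 0 from hp) with h0 | h0 <;> simp [h0]
  · have : (fun p : ℕ × ℕ => p.1 * p.2) ⁻¹' {n} = ↑n.divisorsAntidiagonal := by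
      ext p; simp [hn]
    rw [this, Finset.tsum_subtype' n.divisorsAntidiagonal
      fun p : ℕ × ℕ => a p.1 * b p.2 * F (p.1 * p.2), ArithmeticFunction.mul_apply, Finset.sum_mul]
    refine Finset.sum_congr rfl fun p hp => ?_
    rw [(Nat.mem_divisorsAntidiagonal.1 hp).1]

lemma exp_log_mul (s : ℝ) {m n : ℕ} (hm : m ≠ 0) (hn : n ≠ 0) :
    Real.exp (-s * Real.log (m * n : ℕ)) =
      Real.exp (-s * Real.log m) * Real.exp (-s * Real.log n) := by
  rw [Nat.cast_mul, Real.log_mul (by exact_mod_cast hm) (by exact_mod_cast hn), ← Real.exp_add]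
  ring_nf

lemma AbsConvAt.summable_prod {a b : ArithmeticFunction ℝ} {s : ℝ} (ha : AbsConvAt a s)
    (hb : AbsConvAt b s) : Summable fun p : ℕ × ℕ =>
      (|a p.1| * Real.exp (-s * Real.log p.1)) * (|b p.2| * Real.exp (-s * Real.log p.2)) := by
  have ha' : Summable fun n : ℕ => ‖|a n| * Real.exp (-s * Real.log n)‖ := Summable.norm ha
  have hb' : Summable fun n : ℕ => ‖|b n| * Real.exp (-s * Real.log n)‖ := Summable.norm hb
  exact summable_mul_of_summable_norm ha' hb'

lemma AbsConvAt.mul {a b : ArithmeticFunction ℝ} {s : ℝ} (ha : AbsConvAt a s)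
    (hb : AbsConvAt b s) : AbsConvAt (a * b) s := by
  let a' : ArithmeticFunction ℝ := ⟨fun n => |a n|, by simp⟩
  let b' : ArithmeticFunction ℝ := ⟨fun n => |b n|, by simp⟩
  have h := ha.summable_prod hb
  have h1 : (fun p : ℕ × ℕ => (|a p.1| * Real.exp (-s * Real.log p.1)) *
      (|b p.2| * Real.exp (-s * Real.log p.2))) =
      fun p => a' p.1 * b' p.2 * Real.exp (-s * Real.log (p.1 * p.2 : ℕ)) := by
    funext p
    obtain ⟨m, n⟩ := p
    rcases eq_or_ne m 0 with rfl | hm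
    · simp [a']
    rcases eq_or_ne n 0 with rfl | hn
    · simp [b']
    simp only [a', b', ArithmeticFunction.coe_mk, exp_log_mul s hm hn]
    ring
  rw [h1] at h
  have h2 := (hasSum_regroup a' b' (fun n => Real.exp (-s * Real.log n)) h.hasSum).summable
  refine Summable.of_nonneg_of_le (fun n => by positivity) (fun n => ?_) h2
  refine mul_le_mul_of_nonneg_right ?_ (Real.exp_nonneg _)
  rw [ArithmeticFunction.mul_apply, ArithmeticFunction.mul_apply]
  exact (Finset.abs_sum_le_sum_abs _ _).trans_eq (Finset.sum_congr rfl fun p _ => abs_mul _ _)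

lemma Rep.norm_bound {a : ArithmeticFunction ℝ} {k : ℝ → ℝ} {q s C : ℝ}
    (hC : ∀ x, |k x| ≤ C * Real.exp (-s * x)) (x : ℝ) (n : ℕ) :
    |a n * k (x + Real.log n - q)| ≤
      C * Real.exp (s * q) * Real.exp (-s * x) * (|a n| * Real.exp (-s * Real.log n)) := by
  rw [abs_mul]
  calc _ ≤ |a n| * (C * Real.exp (-s * (x + Real.log n - q))) := by gcongr; exact hC _
    _ = _ := by
      rw [show -s * (x + Real.log n - q) = s * q + -s * x + -s * Real.log n by ring,
        Real.exp_add, Real.exp_add]; ring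

lemma Rep.measurable {f : ℝ → ℝ} {a : ArithmeticFunction ℝ} {k : ℝ → ℝ} {q : ℝ}
    (h : Rep f a k q) (hk : Measurable k) : Measurable f := by
  refine measurable_of_tendsto_metrizable (f := fun N x => ∑ n ∈ Finset.range N,
    a n * k (x + Real.log n - q)) (fun N => ?_) (tendsto_pi_nhds.2 fun x => (h x).tendsto_sum_nat)
  exact Finset.measurable_sum _ fun n _ => (hk.comp (by fun_prop)).const_mul _

lemma Rep.expBdd {f : ℝ → ℝ} {a : ArithmeticFunction ℝ} {k : ℝ → ℝ} {q : ℝ}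
    (h : Rep f a k q) (hk : ExpBdd (Set.Ioi 0) k) (ha : ∀ s > 1, AbsConvAt a s) :
    ExpBdd (Set.Ioi 1) f := by
  refine ⟨h.measurable hk.meas, fun s hs => ?_⟩
  obtain ⟨C, hC⟩ := hk.bound s (zero_lt_one.trans (Set.mem_Ioi.1 hs) : (0:ℝ) < s)
  refine ⟨C * Real.exp (s * q) * ∑' n : ℕ, |a n| * Real.exp (-s * Real.log n), fun x => ?_⟩
  have hs1 := (ha s hs).hasSum.mul_left (C * Real.exp (s * q) * Real.exp (-s * x))
  rw [← (h x).tsum_eq]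
  refine (tsum_of_norm_bounded (f := fun n : ℕ => a n * k (x + Real.log n - q)) hs1
    fun n => Rep.norm_bound hC x n).trans_eq ?_
  ring

lemma rep_lap {f : ℝ → ℝ} {a : ArithmeticFunction ℝ} {k : ℝ → ℝ} {q s : ℝ}
    (h : Rep f a k q) (hk : ExpBdd (Set.Ioi 0) k) (hs : 0 < s) (ha : AbsConvAt a s) :
    HasSum (fun n : ℕ => a n * Real.exp (-s * Real.log n) * (Real.exp (s * q) * lap k s))
      (lap f s) := by
  have key (c : ℝ) (g : ℝ → ℝ) (n : ℕ) : ∫ x, c * g (x + Real.log n - q) * Real.exp (s * x) =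
      c * Real.exp (-s * Real.log n) * (Real.exp (s * q) * lap g s) := by
    have h1 := lap_comp_add_right g (Real.log n - q) s
    have h2 : (fun x => c * g (x + Real.log n - q) * Real.exp (s * x)) =
        fun x => c * (g (x + (Real.log n - q)) * Real.exp (s * x)) := by
      funext x; rw [mul_assoc, add_sub_assoc]
    rw [lap] at h1
    rw [h2, integral_const_mul, h1, show -s * (Real.log n - q) = -s * Real.log n + s * q by ring,
      Real.exp_add]
    ring
  have hIntg (n : ℕ) : Integrable fun x => a n * k (x + Real.log n - q) * Real.exp (s * x) := by
    have := ((hk.comp_add_right (Real.log n - q)).integrable isOpen_Ioi hs).const_mul (a n)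
    simpa [mul_assoc, add_sub_assoc] using this
  have := hasSum_integral_of_summable_integral_norm
    (F := fun (n : ℕ) x => a n * k (x + Real.log n - q) * Real.exp (s * x)) (μ := volume) hIntg ?_
  · simp_rw [fun n : ℕ => key (a n) k n] at this
    have h2 : lap f s = ∫ x, ∑' n : ℕ, a n * k (x + Real.log n - q) * Real.exp (s * x) := by
      refine integral_congr_ae (ae_of_all _ fun x => ?_)
      simp only
      rw [tsum_mul_right, (h x).tsum_eq]
    rwa [h2]
  · refine (congrArg (fun φ : ℕ → ℝ => Summable φ) ?_).mpr
      (ha.mul_right (Real.exp (s * q) * lap (fun x => |k x|) s))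
    funext n
    rw [← key |a n| (fun x => |k x|) n]
    simp only [Real.norm_eq_abs, abs_mul, Real.abs_exp]

lemma rep_conv {f g : ℝ → ℝ} {a b : ArithmeticFunction ℝ} {k l : ℝ → ℝ} {q r s : ℝ}
    (hf : Rep f a k q) (hg : Rep g b l r) (hk : ExpBdd (Set.Ioi 0) k)
    (hl : ExpBdd (Set.Ioi 0) l) (hs : 0 < s) (ha : AbsConvAt a s) (hb : AbsConvAt b s) :
    Rep (conv f g) (a * b) (conv k l) (q + r) := by
  intro x
  have key (c d : ℝ) (k l : ℝ → ℝ) (m n : ℕ) :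
      ∫ y, (c * k (y + Real.log m - q)) * (d * l (x - y + Real.log n - r)) =
      c * d * conv k l (x + (Real.log m - q + (Real.log n - r))) := by
    rw [← conv_comp_add, ← integral_const_mul]
    refine integral_congr_ae (ae_of_all _ fun y => ?_)
    simp only [add_sub_assoc]
    ring
  refine hasSum_regroup a b (fun n => conv k l (x + Real.log n - (q + r))) ?_
  have hIntg (p : ℕ × ℕ) : Integrable fun y =>
      (a p.1 * k (y + Real.log p.1 - q)) * (b p.2 * l (x - y + Real.log p.2 - r)) := by
    have := (conv_integrable isOpen_Ioi ⟨s, hs⟩ (hk.comp_add_right (Real.log p.1 - q))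
      (hl.comp_add_right (Real.log p.2 - r)) x).const_mul (a p.1 * b p.2)
    convert this using 2 with y
    rw [mul_mul_mul_comm, add_sub_assoc, add_sub_assoc]
  have := hasSum_integral_of_summable_integral_norm (F := fun (p : ℕ × ℕ) y =>
      (a p.1 * k (y + Real.log p.1 - q)) * (b p.2 * l (x - y + Real.log p.2 - r)))
      (μ := volume) hIntg ?_
  · have h1 (p : ℕ × ℕ) :
        a p.1 * b p.2 * conv k l (x + Real.log (p.1 * p.2 : ℕ) - (q + r)) =
        ∫ y, (a p.1 * k (y + Real.log p.1 - q)) * (b p.2 * l (x - y + Real.log p.2 - r)) := by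
      rw [key]
      obtain ⟨m, n⟩ := p
      rcases eq_or_ne m 0 with rfl | hm
      · simp
      rcases eq_or_ne n 0 with rfl | hn
      · simp
      rw [Nat.cast_mul, Real.log_mul (by exact_mod_cast hm) (by exact_mod_cast hn)]
      congr 2
      ring
    have h2 : conv f g x = ∫ y, ∑' p : ℕ × ℕ,
        (a p.1 * k (y + Real.log p.1 - q)) * (b p.2 * l (x - y + Real.log p.2 - r)) := by
      refine integral_congr_ae (ae_of_all _ fun y => ?_)
      refine (((hf y).mul (hg (x - y)) ?_).tsum_eq).symm
      exact summable_mul_of_summable_norm (hf y).summable.norm (hg (x - y)).summable.norm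
    simp_rw [h1]
    rwa [h2]
  · obtain ⟨C, hC⟩ := (hk.abs.conv isOpen_Ioi hl.abs).bound s hs
    have h := (ha.summable_prod hb).mul_left
      (C * Real.exp (-s * (x - (q + r))))
    refine Summable.of_nonneg_of_le (fun p => integral_nonneg fun y => norm_nonneg _)
      (fun p => ?_) h
    simp only [Real.norm_eq_abs, abs_mul]
    rw [key |a p.1| |b p.2| (fun x => |k x|) (fun x => |l x|)]
    have h1 := (le_abs_self _).trans (hC (x + (Real.log p.1 - q + (Real.log p.2 - r))))
    calc _ ≤ |a p.1| * |b p.2| *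
          (C * Real.exp (-s * (x + (Real.log p.1 - q + (Real.log p.2 - r))))) :=
          mul_le_mul_of_nonneg_left h1 (mul_nonneg (abs_nonneg _) (abs_nonneg _))
      _ = _ := by
        rw [show -s * (x + (Real.log p.1 - q + (Real.log p.2 - r))) =
          -s * (x - (q + r)) + -s * Real.log p.1 + -s * Real.log p.2 by ring, Real.exp_add,
          Real.exp_add]
        ring

lemma Rep.nonneg {f : ℝ → ℝ} {a : ArithmeticFunction ℝ} {k : ℝ → ℝ} {q : ℝ}
    (h : Rep f a k q) (ha : ∀ n, 0 ≤ a n) (hk : ∀ x, 0 ≤ k x) (x : ℝ) : 0 ≤ f x :=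
  (h x).nonneg fun n => mul_nonneg (ha n) (hk _)

lemma Rep.sum_le {f : ℝ → ℝ} {a : ArithmeticFunction ℝ} {k : ℝ → ℝ} {q : ℝ}
    (h : Rep f a k q) (ha : ∀ n, 0 ≤ a n) (hk : ∀ x, 0 ≤ k x) (S : Finset ℕ) (x : ℝ) :
    ∑ n ∈ S, a n * k (x + Real.log n - q) ≤ f x :=
  sum_le_hasSum S (fun n _ => mul_nonneg (ha n) (hk _)) (h x)

/-- The properties of the theta function of `ζ` (in additive coordinates) that we use. -/
structure ZetaLike (f : ℝ → ℝ) : Prop where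
  bdd : ExpBdd (Set.Ioi 1) f
  fe : ∀ x, f (-x) = Real.exp x * f x + Real.exp x - 1
  le : ∀ x, f x ≤ Real.exp (-x)

lemma ZetaLike.sub_exp {f : ℝ → ℝ} (hf : ZetaLike f) :
    ExpBdd (Set.Ioo 0 1) fun x => f x - Real.exp (-x) := by
  refine ⟨hf.bdd.meas.sub (by fun_prop), fun a ha => ?_⟩
  obtain ⟨C, hC⟩ := hf.bdd.bound 2 (by norm_num)
  have hC0 : 0 ≤ C := by simpa using (abs_nonneg _).trans (hC 0)
  refine ⟨C + 1, fun x => ?_⟩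
  rw [add_mul, one_mul]
  rcases le_total 0 x with hx | hx
  · refine (abs_sub _ _).trans (add_le_add ((hC x).trans ?_) ?_)
    · refine mul_le_mul_of_nonneg_left (Real.exp_le_exp.2 ?_) hC0
      nlinarith [ha.1, ha.2]
    · rw [Real.abs_exp]
      refine Real.exp_le_exp.2 ?_
      nlinarith [ha.1, ha.2]
  · have h1 : f x - Real.exp (-x) = Real.exp (-x) * f (-x) - 1 := by
      have := hf.fe (-x)
      rw [neg_neg] at this
      rw [this]; ring
    rw [h1]
    refine (abs_sub _ _).trans (add_le_add ?_ ?_)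
    · rw [abs_mul, Real.abs_exp]
      calc _ ≤ Real.exp (-x) * (C * Real.exp (-2 * -x)) := by gcongr; exact hC _
        _ = C * Real.exp x := by
          rw [mul_left_comm, ← Real.exp_add]; ring_nf
        _ ≤ _ := by
          refine mul_le_mul_of_nonneg_left (Real.exp_le_exp.2 ?_) hC0
          nlinarith [ha.1, ha.2]
    · rw [abs_one]
      refine Real.one_le_exp ?_
      nlinarith [ha.1, ha.2]

lemma ZetaLike.lap_sub_exp_nonpos {f : ℝ → ℝ} (hf : ZetaLike f) (s : ℝ) :
    lap (fun x => f x - Real.exp (-x)) s ≤ 0 :=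
  integral_nonpos fun x => mul_nonpos_of_nonpos_of_nonneg (sub_nonpos.2 (hf.le x)) (Real.exp_nonneg _)

lemma conv_exp_neg (g : ℝ → ℝ) (x : ℝ) :
    conv (fun y => Real.exp (-y)) g x = lap g 1 * Real.exp (-x) := by
  rw [conv, lap, ← integral_mul_const, ← integral_sub_left_eq_self (μ := volume) _ x]
  congr 1
  ext y
  rw [sub_sub_cancel, mul_assoc, ← Real.exp_add]
  ring_nf

lemma conv_const_one (g : ℝ → ℝ) (x : ℝ) : conv (fun _ => 1) g x = lap g 0 := by
  rw [conv, lap, ← integral_sub_left_eq_self (μ := volume) _ x]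
  congr 1
  ext y
  rw [sub_sub_cancel, zero_mul, Real.exp_zero]
  ring

lemma ExpBdd.integrable_comp_sub {g : ℝ → ℝ} (hg : ExpBdd Set.univ g) (c x : ℝ) :
    Integrable fun y => Real.exp (c * y) * g (x - y) := by
  have := ((hg.integrable isOpen_univ (Set.mem_univ (-c))).comp_sub_left x).const_mul
    (Real.exp (c * x))
  refine this.congr (ae_of_all _ fun y => ?_)
  simp only
  rw [mul_left_comm, ← Real.exp_add]
  ring_nf

lemma ZetaLike.conv_neg {f g : ℝ → ℝ} (hf : ZetaLike f) (hg : ExpBdd Set.univ g) {W : ℝ}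
    (hW : W * W = 1) (hfe : FEq W g) (x : ℝ) :
    conv f g (-x) = W * Real.exp x * conv f g x + lap g 1 * (Real.exp x - W) := by
  have h0 : lap g 0 = W * lap g 1 := by simpa using hfe.lap 0
  have hi := conv_integrable isOpen_Ioi ⟨2, by norm_num⟩ hf.bdd (hg.mono (Set.subset_univ _)) x
  have hi1 : Integrable fun y => 1 * g (x - y) := by
    simpa using hg.integrable_comp_sub 0 x
  have hi2 : Integrable fun y => Real.exp (-y) * g (x - y) := by
    simpa using hg.integrable_comp_sub (-1) x
  have h1 : conv f g (-x) = W * Real.exp x *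
      (conv f g x + (conv (fun _ => 1) g x - conv (fun y => Real.exp (-y)) g x)) := by
    simp only [conv]
    have hi3 : Integrable fun y => 1 * g (x - y) - Real.exp (-y) * g (x - y) := hi1.sub hi2
    rw [← integral_sub hi1 hi2, ← integral_add hi hi3, ← integral_const_mul,
      ← integral_neg_eq_self (μ := volume)]
    congr 1
    ext y
    rw [hf.fe y, show -x - -y = -(x - y) by ring, hfe (x - y),
      show Real.exp x = Real.exp y * Real.exp (x - y) by rw [← Real.exp_add]; ring_nf,
      Real.exp_neg]
    field_simp
    ring
  rw [h1, conv_const_one, conv_exp_neg, h0, Real.exp_neg]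
  field_simp
  linear_combination Real.exp x * lap g 1 * hW

/-- Half-line Laplace transform. -/
noncomputable def halfLap (Φ : ℝ → ℝ) (c : ℝ) : ℝ := ∫ x in Set.Ioi 0, Φ x * Real.exp (c * x)

lemma ExpBdd.integrableOn_Ioi {Φ : ℝ → ℝ} (h : ExpBdd (Set.Ioi 1) Φ) (c : ℝ) :
    IntegrableOn (fun x => Φ x * Real.exp (c * x)) (Set.Ioi 0) := by
  obtain ⟨C, hC⟩ := h.bound (max c 1 + 1) (by simp)
  have hi := (integrableOn_exp_mul_Ioi (a := -1) (by norm_num) 0).const_mul C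
  refine hi.mono' (h.meas.mul (by fun_prop)).aestronglyMeasurable.restrict ?_
  filter_upwards [ae_restrict_mem measurableSet_Ioi] with x hx
  have hC0 : 0 ≤ C := by simpa using (abs_nonneg _).trans (hC 0)
  rw [Real.norm_eq_abs, abs_mul, Real.abs_exp]
  calc _ ≤ C * Real.exp (-(max c 1 + 1) * x) * Real.exp (c * x) := by gcongr; exact hC x
    _ = C * Real.exp ((c - max c 1 - 1) * x) := by rw [mul_assoc, ← Real.exp_add]; ring_nf
    _ ≤ _ := by
      refine mul_le_mul_of_nonneg_left (Real.exp_le_exp.2 ?_) hC0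
      have := le_max_left c 1
      have := Set.mem_Ioi.1 hx
      nlinarith

lemma lap_eq_halfLap {f : ℝ → ℝ} {s : ℝ} (h : Integrable fun x => f x * Real.exp (s * x)) :
    lap f s = (∫ x in Set.Ioi 0, f x * Real.exp (s * x)) +
      ∫ x in Set.Ioi 0, f (-x) * Real.exp (-s * x) := by
  rw [lap, ← integral_add_compl measurableSet_Ioi h (s := Set.Ioi 0), Set.compl_Ioi]
  congr 1
  have := integral_comp_neg_Ioi (0 : ℝ) (fun x => f x * Real.exp (s * x))
  rw [neg_zero] at this
  rw [← this]
  simp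

lemma setIntegral_exp_neg_mul {c : ℝ} (hc : 0 < c) :
    ∫ x in Set.Ioi (0 : ℝ), Real.exp (-c * x) = 1 / c := by
  rw [integral_exp_mul_Ioi (by linarith)]
  simp

section
variable {f g : ℝ → ℝ} {W : ℝ}

lemma ZetaLike.expBdd_conv (hf : ZetaLike f) (hg : ExpBdd Set.univ g) :
    ExpBdd (Set.Ioi 1) (conv f g) :=
  hf.bdd.conv isOpen_Ioi (hg.mono (Set.subset_univ _))

lemma ZetaLike.rep_of_one_lt (hf : ZetaLike f) (hg : ExpBdd Set.univ g)
    (hW : W * W = 1) (hfe : FEq W g) {s : ℝ} (hs : 1 < s) :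
    lap (conv f g) s = halfLap (conv f g) s + W * halfLap (conv f g) (1 - s) +
      lap g 1 * (1 / (s - 1) - W / s) := by
  have hΦ := hf.expBdd_conv hg
  rw [lap_eq_halfLap (hΦ.integrable isOpen_Ioi hs), halfLap, halfLap, add_assoc]
  congr 1
  have h1 (x : ℝ) : conv f g (-x) * Real.exp (-s * x) =
      W * (conv f g x * Real.exp ((1 - s) * x)) +
        lap g 1 * (Real.exp (-(s - 1) * x) - W * Real.exp (-s * x)) := by
    rw [hf.conv_neg hg hW hfe, show (1 - s) * x = x + -s * x by ring,
      show -(s - 1) * x = x + -s * x by ring, Real.exp_add]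
    ring
  simp_rw [h1]
  have i1 := hΦ.integrableOn_Ioi (1 - s)
  have i2 := integrableOn_exp_mul_Ioi (a := -(s - 1)) (by linarith) 0
  have i3 := integrableOn_exp_mul_Ioi (a := -s) (by linarith) 0
  have i4 : IntegrableOn (fun x => lap g 1 * (Real.exp (-(s - 1) * x) - W * Real.exp (-s * x)))
      (Set.Ioi 0) := (i2.sub (i3.const_mul W)).const_mul (lap g 1)
  rw [integral_add (i1.const_mul _) i4, integral_const_mul,
    integral_const_mul, integral_sub i2 (i3.const_mul _), integral_const_mul,
    setIntegral_exp_neg_mul (by linarith), setIntegral_exp_neg_mul (by linarith)]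
  ring

lemma ZetaLike.rep_of_lt_one (hf : ZetaLike f) (hg : ExpBdd Set.univ g)
    (hW : W * W = 1) (hfe : FEq W g) {s : ℝ} (hs0 : 0 < s) (hs : s < 1) :
    lap (fun x => f x - Real.exp (-x)) s * lap g s =
      halfLap (conv f g) s + W * halfLap (conv f g) (1 - s) -
      lap g 1 * (1 / (1 - s) + W / s) := by
  have hΦ := hf.expBdd_conv hg
  have hg' : ExpBdd (Set.Ioo 0 1) g := hg.mono (Set.subset_univ _)
  have hc (x : ℝ) : conv (fun x => f x - Real.exp (-x)) g x =
      conv f g x - lap g 1 * Real.exp (-x) := by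
    rw [← conv_exp_neg, conv, conv, conv, ← integral_sub]
    · congr 1; ext y; ring
    · exact conv_integrable isOpen_Ioi ⟨2, by norm_num⟩ hf.bdd (hg.mono (Set.subset_univ _)) x
    · simpa using hg.integrable_comp_sub (-1) x
  rw [← lap_conv isOpen_Ioo hf.sub_exp hg' ⟨hs0, hs⟩,
    lap_eq_halfLap ((hf.sub_exp.conv isOpen_Ioo hg').integrable isOpen_Ioo ⟨hs0, hs⟩),
    halfLap, halfLap]
  have h0 (x : ℝ) : conv (fun x => f x - Real.exp (-x)) g x * Real.exp (s * x) =
      conv f g x * Real.exp (s * x) - lap g 1 * Real.exp (-(1 - s) * x) := by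
    rw [hc, show -(1 - s) * x = -x + s * x by ring, Real.exp_add]
    ring
  have h1 (x : ℝ) : conv (fun x => f x - Real.exp (-x)) g (-x) * Real.exp (-s * x) =
      W * (conv f g x * Real.exp ((1 - s) * x)) -
        lap g 1 * W * Real.exp (-s * x) := by
    rw [hc, hf.conv_neg hg hW hfe, show (1 - s) * x = x + -s * x by ring, Real.exp_add, neg_neg]
    ring
  simp_rw [h0, h1]
  have i0 := hΦ.integrableOn_Ioi s
  have i1 := hΦ.integrableOn_Ioi (1 - s)
  have i2 := integrableOn_exp_mul_Ioi (a := -(1 - s)) (by linarith) 0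
  have i3 := integrableOn_exp_mul_Ioi (a := -s) (by linarith) 0
  rw [integral_sub i0 (i2.const_mul _), integral_sub (i1.const_mul _) (i3.const_mul _),
    integral_const_mul, integral_const_mul, integral_const_mul,
    setIntegral_exp_neg_mul (by linarith), setIntegral_exp_neg_mul (by linarith)]
  ring

end

/-- Normalising factor: `1` for sign `+1`, and `2 v` for sign `-1`. -/
noncomputable def signFactor (W v : ℝ) : ℝ := if W = 1 then 1 else 2 * v

/-- `2 cosh (v x)` for sign `+1` and `sinh (v x) / v` for sign `-1`. -/
noncomputable def signKernel (W v x : ℝ) : ℝ :=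
  (Real.exp (v * x) + W * Real.exp (-v * x)) / signFactor W v

/-- The completed product, symmetrised about `1/2`, without its polar part. -/
noncomputable def symE (W : ℝ) (Φ : ℝ → ℝ) (v : ℝ) : ℝ :=
  ∫ x in Set.Ioi 0, Φ x * (Real.exp (x / 2) * signKernel W v x)

lemma signFactor_pos {W v : ℝ} (hv : 0 < v) : 0 < signFactor W v := by
  unfold signFactor; split_ifs <;> linarith

lemma exp_weighted (a b l σ : ℝ) (hl0 : 0 ≤ l) (hl1 : l ≤ 1) :
    Real.exp ((1 - l) * a + l * b) ≤
      (1 - l) * Real.exp (l * σ) * Real.exp a + l * Real.exp ((l - 1) * σ) * Real.exp b := by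
  have := convexOn_exp.2 (Set.mem_univ (a + l * σ)) (Set.mem_univ (b + (l - 1) * σ))
    (sub_nonneg.2 hl1) hl0 (by ring)
  simp only [smul_eq_mul] at this
  rw [show (1 - l) * (a + l * σ) + l * (b + (l - 1) * σ) = (1 - l) * a + l * b by ring,
    Real.exp_add a, Real.exp_add b] at this
  linarith

lemma signKernel_neg_one_eq {v x : ℝ} (hv : 0 < v) (hx : 0 < x) :
    signKernel (-1) v x = x / 2 * ∫ u in (-1 : ℝ)..1, Real.exp (v * x * u) := by
  have : v * x ≠ 0 := (mul_pos hv hx).ne'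
  rw [intervalIntegral.integral_comp_mul_left _ this, integral_exp, signKernel, signFactor,
    if_neg (by norm_num)]
  simp only [smul_eq_mul, mul_neg, mul_one, neg_mul, one_mul]
  field_simp
  ring

lemma signKernel_convex {W v w l σ x : ℝ} (hW : W = 1 ∨ W = -1) (hv : 0 < v) (hw : 0 < w)
    (hl0 : 0 ≤ l) (hl1 : l ≤ 1) (hx : 0 < x) :
    signKernel W ((1 - l) * v + l * w) x ≤ (1 - l) * Real.exp (l * σ) * signKernel W v x +
      l * Real.exp ((l - 1) * σ) * signKernel W w x := by
  rcases hW with rfl | rfl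
  · simp only [signKernel, signFactor, if_true, div_one, one_mul]
    have h1 := exp_weighted (v * x) (w * x) l σ hl0 hl1
    have h2 := exp_weighted (-v * x) (-w * x) l σ hl0 hl1
    rw [show ((1 - l) * v + l * w) * x = (1 - l) * (v * x) + l * (w * x) by ring,
      show -((1 - l) * v + l * w) * x = (1 - l) * (-v * x) + l * (-w * x) by ring]
    linarith
  · have hpos : 0 < (1 - l) * v + l * w := by
      rcases hl0.eq_or_lt with rfl | h
      · simpa
      · have := mul_pos h hw
        have := mul_nonneg (sub_nonneg.2 hl1) hv.le
        linarith
    rw [signKernel_neg_one_eq hpos hx, signKernel_neg_one_eq hv hx, signKernel_neg_one_eq hw hx]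
    have h : ∫ u in (-1 : ℝ)..1, Real.exp (((1 - l) * v + l * w) * x * u) ≤
        ∫ u in (-1 : ℝ)..1, ((1 - l) * Real.exp (l * σ) * Real.exp (v * x * u) +
          l * Real.exp ((l - 1) * σ) * Real.exp (w * x * u)) := by
      refine intervalIntegral.integral_mono (by norm_num) ?_ ?_ fun u => ?_
      · exact (by fun_prop : Continuous _).intervalIntegrable _ _
      · exact (by fun_prop : Continuous _).intervalIntegrable _ _
      · have := exp_weighted (v * x * u) (w * x * u) l σ hl0 hl1
        simp only
        rwa [show ((1 - l) * v + l * w) * x * u = (1 - l) * (v * x * u) + l * (w * x * u) by ring]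
    rw [intervalIntegral.integral_add, intervalIntegral.integral_const_mul,
      intervalIntegral.integral_const_mul] at h
    · have := mul_le_mul_of_nonneg_left h (half_pos hx).le
      linarith
    · exact (by fun_prop : Continuous _).intervalIntegrable _ _
    · exact (by fun_prop : Continuous _).intervalIntegrable _ _

lemma signKernel_nonneg {W v x : ℝ} (hW : W = 1 ∨ W = -1) (hv : 0 < v) (hx : 0 < x) :
    0 ≤ signKernel W v x := by
  refine div_nonneg ?_ (signFactor_pos hv).le
  rcases hW with rfl | rfl
  · positivity
  · have : Real.exp (-v * x) ≤ Real.exp (v * x) := by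
      refine Real.exp_le_exp.2 ?_
      nlinarith [mul_pos hv hx]
    linarith

lemma le_signKernel {W v x : ℝ} (hW : W = 1 ∨ W = -1) (hv : 0 < v) (hv2 : v ≤ 1 / 2)
    (hx : 0 < x) : Real.exp (v * x) - Real.exp (-v * x) ≤ signKernel W v x := by
  rcases hW with rfl | rfl
  · simp only [signKernel, signFactor, if_true, div_one, one_mul]
    linarith [Real.exp_pos (-v * x)]
  · rw [signKernel, signFactor, if_neg (by norm_num), le_div_iff₀ (by linarith)]
    have : Real.exp (-v * x) ≤ Real.exp (v * x) := by
      refine Real.exp_le_exp.2 ?_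
      nlinarith [mul_pos hv hx]
    nlinarith

section
variable {Φ : ℝ → ℝ} {W : ℝ}

lemma symE_integrable (h : ExpBdd (Set.Ioi 1) Φ) (v : ℝ) :
    IntegrableOn (fun x => Φ x * (Real.exp (x / 2) * signKernel W v x)) (Set.Ioi 0) := by
  have := ((h.integrableOn_Ioi (1 / 2 + v)).add
    ((h.integrableOn_Ioi (1 / 2 - v)).const_mul W)).div_const (signFactor W v)
  refine this.congr (ae_of_all _ fun x => ?_)
  simp only [signKernel, Pi.add_apply]
  rw [show (1 / 2 + v) * x = x / 2 + v * x by ring, show (1 / 2 - v) * x = x / 2 + -v * x by ring,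
    Real.exp_add, Real.exp_add]
  ring

lemma halfLap_eq_symE (h : ExpBdd (Set.Ioi 1) Φ) {v : ℝ} (hv : 0 < v) :
    halfLap Φ (1 / 2 + v) + W * halfLap Φ (1 / 2 - v) = signFactor W v * symE W Φ v := by
  have hc := (signFactor_pos (W := W) hv).ne'
  rw [halfLap, halfLap, symE, ← integral_const_mul, ← integral_const_mul,
    ← integral_add (h.integrableOn_Ioi _) ((h.integrableOn_Ioi _).const_mul W)]
  refine integral_congr_ae (ae_of_all _ fun x => ?_)
  simp only [signKernel]
  rw [show (1 / 2 + v) * x = x / 2 + v * x by ring, show (1 / 2 - v) * x = x / 2 + -v * x by ring,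
    Real.exp_add, Real.exp_add]
  field_simp

lemma symE_nonneg (hW : W = 1 ∨ W = -1) (hpos : ∀ x, 0 ≤ Φ x) {v : ℝ} (hv : 0 < v) :
    0 ≤ symE W Φ v :=
  setIntegral_nonneg measurableSet_Ioi fun x hx =>
    mul_nonneg (hpos x) (mul_nonneg (Real.exp_nonneg _) (signKernel_nonneg hW hv hx))

lemma symE_convex (hW : W = 1 ∨ W = -1) (h : ExpBdd (Set.Ioi 1) Φ) (hpos : ∀ x, 0 ≤ Φ x)
    {v w l σ : ℝ} (hv : 0 < v) (hw : 0 < w) (hl0 : 0 ≤ l) (hl1 : l ≤ 1) :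
    symE W Φ ((1 - l) * v + l * w) ≤ (1 - l) * Real.exp (l * σ) * symE W Φ v +
      l * Real.exp ((l - 1) * σ) * symE W Φ w := by
  rw [symE, symE, symE, ← integral_const_mul, ← integral_const_mul,
    ← integral_add ((symE_integrable h v).const_mul _) ((symE_integrable h w).const_mul _)]
  refine setIntegral_mono_on (symE_integrable h _) (((symE_integrable h v).const_mul _).add
    ((symE_integrable h w).const_mul _)) measurableSet_Ioi fun x hx => ?_
  have := mul_le_mul_of_nonneg_left (signKernel_convex (l := l) (σ := σ) hW hv hw hl0 hl1 hx)
    (mul_nonneg (hpos x) (Real.exp_nonneg (x / 2)))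
  linarith

/-- Lower bound to the left of `w`, from log-convexity and an upper bound `U` at `z`. -/
lemma symE_lower (hW : W = 1 ∨ W = -1) (h : ExpBdd (Set.Ioi 1) Φ) (hpos : ∀ x, 0 ≤ Φ x)
    {v w z U : ℝ} (hv : 0 < v) (hvw : v ≤ w) (hwz : w < z) (hE : 0 < symE W Φ w) (hU : 0 < U)
    (hzU : symE W Φ z ≤ U) :
    symE W Φ w * Real.exp (-(Real.log (U / symE W Φ w) / (z - w)) * (w - v)) ≤ symE W Φ v := by
  set B := symE W Φ w with hB
  set l := (w - v) / (z - v) with hl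
  have hzv : 0 < z - v := by linarith
  have hzw : 0 < z - w := by linarith
  have hl0 : 0 ≤ l := div_nonneg (by linarith) hzv.le
  have hl1 : 1 - l = (z - w) / (z - v) := by rw [hl]; field_simp; ring
  have hl1' : 0 < 1 - l := by rw [hl1]; positivity
  set σ := Real.log (U / B) / (1 - l) with hσ
  have hc := symE_convex (σ := σ) hW h hpos hv (by linarith : 0 < z) hl0 (by linarith)
  have hw' : (1 - l) * v + l * z = w := by rw [hl1, hl]; field_simp; ring
  have e1 : Real.exp ((l - 1) * σ) = B / U := by
    rw [show (l - 1) * σ = -Real.log (U / B) by rw [hσ]; field_simp; ring, Real.exp_neg,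
      Real.exp_log (by positivity), inv_div]
  have e2 : -(Real.log (U / B) / (z - w)) * (w - v) = -(l * σ) := by
    rw [hσ, hl1, hl]; field_simp
  rw [hw', e1, ← hB] at hc
  have h3 : l * (B / U) * symE W Φ z ≤ l * B := by
    calc _ ≤ l * (B / U) * U := by gcongr
      _ = l * B := by field_simp
  rw [e2, Real.exp_neg]
  have h4 : (1 - l) * B ≤ (1 - l) * (Real.exp (l * σ) * symE W Φ v) := by linarith
  have h5 := le_of_mul_le_mul_left h4 hl1'
  rw [← div_eq_mul_inv, div_le_iff₀ (Real.exp_pos _)]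
  linarith

/-- Lower bound for `symE` in terms of the Laplace transform of the base kernel. -/
lemma le_symE (hW : W = 1 ∨ W = -1) (h : ExpBdd (Set.Ioi 1) Φ)
    {K : ℝ → ℝ} (hK : ExpBdd (Set.Ioi 0) K) (hK0 : ∀ x, 0 ≤ K x) {ι : Type*} (S : Finset ι)
    (q : ι → ℝ) (hΦ : ∀ x, ∑ i ∈ S, K (x + -q i) ≤ Φ x) {v : ℝ} (hv : 0 < v) (hv2 : v ≤ 1 / 2) :
    ∑ i ∈ S, (Real.exp ((1 / 2 + v) * q i) * lap K (1 / 2 + v) -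
      Real.exp (1 / 2 * q i) * lap K (1 / 2)) ≤ symE W Φ v := by
  have hIntg (i : ι) (s : ℝ) (hs : 0 < s) :
      Integrable fun x => K (x + -q i) * Real.exp (s * x) :=
    (hK.comp_add_right _).integrable isOpen_Ioi hs
  have hIntg' (i : ι) : Integrable fun x =>
      K (x + -q i) * (Real.exp ((1 / 2 + v) * x) - Real.exp (1 / 2 * x)) := by
    have := (hIntg i (1 / 2 + v) (by linarith)).sub (hIntg i (1 / 2) (by norm_num))
    exact this.congr (ae_of_all _ fun x => (mul_sub _ _ _).symm)
  have h1 (i : ι) : Real.exp ((1 / 2 + v) * q i) * lap K (1 / 2 + v) -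
      Real.exp (1 / 2 * q i) * lap K (1 / 2) =
      ∫ x, K (x + -q i) * (Real.exp ((1 / 2 + v) * x) - Real.exp (1 / 2 * x)) := by
    simp only [mul_sub]
    rw [integral_sub (hIntg i (1 / 2 + v) (by linarith)) (hIntg i (1 / 2) (by norm_num))]
    have a1 := lap_comp_add_right K (-q i) (1 / 2 + v)
    have a2 := lap_comp_add_right K (-q i) (1 / 2)
    rw [neg_mul_neg] at a1 a2
    rw [← a1, ← a2, lap, lap]
  have h2 (i : ι) : ∫ x, K (x + -q i) * (Real.exp ((1 / 2 + v) * x) - Real.exp (1 / 2 * x)) ≤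
      ∫ x in Set.Ioi 0, K (x + -q i) * (Real.exp ((1 / 2 + v) * x) - Real.exp (1 / 2 * x)) := by
    rw [← integral_add_compl measurableSet_Ioi (hIntg' i) (s := Set.Ioi 0), Set.compl_Ioi]
    have : ∫ x in Set.Iic 0, K (x + -q i) *
        (Real.exp ((1 / 2 + v) * x) - Real.exp (1 / 2 * x)) ≤ 0 := by
      refine setIntegral_nonpos measurableSet_Iic fun x hx => ?_
      refine mul_nonpos_of_nonneg_of_nonpos (hK0 _) (sub_nonpos.2 (Real.exp_le_exp.2 ?_))
      nlinarith [Set.mem_Iic.1 hx]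
    linarith
  calc _ ≤ ∑ i ∈ S, ∫ x in Set.Ioi 0,
        K (x + -q i) * (Real.exp ((1 / 2 + v) * x) - Real.exp (1 / 2 * x)) :=
        Finset.sum_le_sum fun i _ => (h1 i).trans_le (h2 i)
    _ = ∫ x in Set.Ioi 0, ∑ i ∈ S,
        K (x + -q i) * (Real.exp ((1 / 2 + v) * x) - Real.exp (1 / 2 * x)) :=
        (integral_finsetSum _ fun i _ => (hIntg' i).integrableOn).symm
    _ ≤ _ := by
      refine setIntegral_mono_on (integrable_finsetSum _ fun i _ => (hIntg' i).integrableOn)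
        (symE_integrable h v) measurableSet_Ioi fun x hx => ?_
      have hx0 : 0 < x := hx
      rw [← Finset.sum_mul]
      have hd : 0 ≤ Real.exp ((1 / 2 + v) * x) - Real.exp (1 / 2 * x) :=
        sub_nonneg.2 (Real.exp_le_exp.2 (by nlinarith [mul_pos hv hx0]))
      refine (mul_le_mul_of_nonneg_right (hΦ x) hd).trans ?_
      have hΦ0 : 0 ≤ Φ x := (Finset.sum_nonneg fun i _ => hK0 _).trans (hΦ x)
      refine mul_le_mul_of_nonneg_left ?_ hΦ0
      have hk := mul_le_mul_of_nonneg_left (le_signKernel hW hv hv2 hx0) (Real.exp_nonneg (x / 2))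
      refine le_trans ?_ hk
      rw [mul_sub, ← Real.exp_add, ← Real.exp_add]
      refine sub_le_sub (Real.exp_le_exp.2 (by linarith)) (Real.exp_le_exp.2 ?_)
      nlinarith [mul_pos hv hx0]

end

section
variable {f g : ℝ → ℝ} {W : ℝ}

lemma ZetaLike.lap_conv_eq_symE (hf : ZetaLike f) (hg : ExpBdd Set.univ g)
    (hW : W = 1 ∨ W = -1) (hfe : FEq W g) {v : ℝ} (hv : 1 / 2 < v) :
    lap (conv f g) (1 / 2 + v) = signFactor W v *
      (symE W (conv f g) v + lap g 1 / ((v + 1 / 2) * (v - 1 / 2))) := by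
  have hW2 : W * W = 1 := by rcases hW with rfl | rfl <;> norm_num
  rw [hf.rep_of_one_lt hg hW2 hfe (by linarith), show 1 - (1 / 2 + v) = 1 / 2 - v by ring,
    halfLap_eq_symE (hf.expBdd_conv hg) (by linarith), mul_add]
  congr 1
  obtain ⟨a, rfl⟩ : ∃ a, v = a + 1 / 2 := ⟨v - 1 / 2, by ring⟩
  have ha : a ≠ 0 := by linarith
  have hb : a + 1 ≠ 0 := by linarith
  rw [show 1 / 2 + (a + 1 / 2) - 1 = a by ring, show 1 / 2 + (a + 1 / 2) = a + 1 by ring,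
    show a + 1 / 2 - 1 / 2 = a by ring, show a + 1 / 2 + 1 / 2 = a + 1 by ring, signFactor]
  rcases hW with rfl | rfl
  · rw [if_pos rfl]
    field_simp
    ring
  · rw [if_neg (by norm_num)]
    field_simp
    ring

lemma ZetaLike.lap_mul_eq_symE (hf : ZetaLike f) (hg : ExpBdd Set.univ g)
    (hW : W = 1 ∨ W = -1) (hfe : FEq W g) {v : ℝ} (hv0 : 0 < v) (hv : v < 1 / 2) :
    lap (fun x => f x - Real.exp (-x)) (1 / 2 + v) * lap g (1 / 2 + v) = signFactor W v *
      (symE W (conv f g) v - lap g 1 / ((1 / 2 + v) * (1 / 2 - v))) := by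
  have hW2 : W * W = 1 := by rcases hW with rfl | rfl <;> norm_num
  have h1 : 1 - 2 * v ≠ 0 := by linarith
  have h2 : 1 + 2 * v ≠ 0 := by linarith
  rw [hf.rep_of_lt_one hg hW2 hfe (by linarith) (by linarith),
    show 1 - (1 / 2 + v) = 1 / 2 - v by ring,
    halfLap_eq_symE (hf.expBdd_conv hg) (by linarith), mul_sub]
  congr 1
  rw [signFactor]
  rcases hW with rfl | rfl
  · rw [if_pos rfl]
    field_simp
    ring
  · rw [if_neg (by norm_num)]
    field_simp
    ring

lemma ZetaLike.symE_le (hf : ZetaLike f) (hg : ExpBdd Set.univ g)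
    (hW : W = 1 ∨ W = -1) (hfe : FEq W g) {v : ℝ} (hv0 : 0 < v) (hv : v < 1 / 2)
    (hnn : 0 ≤ lap g (1 / 2 + v)) :
    symE W (conv f g) v ≤ lap g 1 / ((1 / 2 + v) * (1 / 2 - v)) := by
  have h := hf.lap_mul_eq_symE hg hW hfe hv0 hv
  have h1 := mul_nonpos_of_nonpos_of_nonneg (hf.lap_sub_exp_nonpos (1 / 2 + v)) hnn
  have h2 := signFactor_pos (W := W) hv0
  rw [h] at h1
  have := nonpos_of_mul_nonpos_right h1 h2
  linarith

lemma ZetaLike.symE_eq (hf : ZetaLike f) (hg : ExpBdd Set.univ g)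
    (hW : W = 1 ∨ W = -1) (hfe : FEq W g) {v : ℝ} (hv0 : 0 < v) (hv : v < 1 / 2)
    (h0 : lap g (1 / 2 + v) = 0) :
    symE W (conv f g) v = lap g 1 / ((1 / 2 + v) * (1 / 2 - v)) := by
  have h := hf.lap_mul_eq_symE hg hW hfe hv0 hv
  rw [h0, mul_zero] at h
  have := (mul_eq_zero.1 h.symm).resolve_left (signFactor_pos hv0).ne'
  linarith

end

/-- The archimedean kernel `2 exp (j y) exp (-π exp (2 y))`. -/
noncomputable def thetaKernel (j : ℕ) (y : ℝ) : ℝ :=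
  2 * Real.exp (j * y) * Real.exp (-Real.pi * Real.exp (2 * y))

lemma thetaKernel_nonneg (j : ℕ) (y : ℝ) : 0 ≤ thetaKernel j y := by
  unfold thetaKernel; positivity

lemma thetaKernel_expBdd (j : ℕ) : ExpBdd (Set.Ioi 0) (thetaKernel j) := by
  refine ⟨by unfold thetaKernel; fun_prop, fun a ha => ?_⟩
  have hb : 0 < (j + a) / (2 * Real.pi) := by
    have : (0 : ℝ) < j + a := add_pos_of_nonneg_of_pos (by positivity) ha
    positivity
  set s := Real.log ((j + a) / (2 * Real.pi)) with hs
  refine ⟨2 * Real.exp (Real.pi * Real.exp s * (s - 1)), fun y => ?_⟩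
  rw [abs_of_nonneg (thetaKernel_nonneg j y), thetaKernel, mul_assoc, mul_assoc, ← Real.exp_add,
    ← Real.exp_add]
  refine mul_le_mul_of_nonneg_left (Real.exp_le_exp.2 ?_) zero_le_two
  have h1 := mul_le_mul_of_nonneg_left (Real.add_one_le_exp (2 * y - s))
    (mul_pos Real.pi_pos (Real.exp_pos s)).le
  rw [mul_assoc Real.pi (Real.exp s) (Real.exp _), ← Real.exp_add,
    show s + (2 * y - s) = 2 * y by ring] at h1
  have h2 : Real.pi * Real.exp s * 2 = j + a := by
    rw [hs, Real.exp_log hb]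
    field_simp
  have h3 : Real.pi * Real.exp s * (2 * y) = (j + a) * y := by rw [← h2]; ring
  linarith

lemma lap_thetaKernel (j : ℕ) {s : ℝ} (hs : 0 < s) : lap (thetaKernel j) s =
    Real.pi ^ (-((s + j) / 2)) * Real.Gamma ((s + j) / 2) := by
  have h := integral_image_eq_integral_abs_deriv_smul (s := Set.univ) (f := Real.exp)
    (f' := Real.exp) MeasurableSet.univ (fun x _ => (Real.hasDerivAt_exp x).hasDerivWithinAt)
    Real.exp_injective.injOn
    (fun x => x ^ (s + j - 1) * Real.exp (-Real.pi * x ^ (2 : ℝ)))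
  rw [Set.image_univ, Real.range_exp, setIntegral_univ, integral_rpow_mul_exp_neg_mul_rpow
    two_pos (by have : (0 : ℝ) ≤ j := by positivity
                linarith) Real.pi_pos] at h
  have h2 : lap (thetaKernel j) s =
      2 * ∫ x, |Real.exp x| • (Real.exp x ^ (s + j - 1) *
        Real.exp (-Real.pi * Real.exp x ^ (2 : ℝ))) := by
    rw [lap, ← integral_const_mul]
    congr 1
    ext x
    rw [abs_of_pos (Real.exp_pos x), smul_eq_mul, ← Real.exp_mul, ← Real.exp_mul, ← mul_assoc,
      ← mul_assoc, mul_assoc 2 (Real.exp x), ← Real.exp_add, thetaKernel]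
    rw [show x + x * (s + j - 1) = j * x + s * x by ring, Real.exp_add, mul_comm x 2]
    ring
  rw [h2, ← h, sub_add_cancel, neg_div]
  ring

lemma hasSum_residue {N : ℕ} [NeZero N] (f : ℤ → ℂ) (g : ZMod N → ℂ)
    (h : ∀ i : ZMod N, HasSum (fun q : ℤ => f (q * N + i.val)) (g i)) :
    HasSum f (∑ i, g i) := by
  have h1 (i : ZMod N) : HasSum (fun n : ℤ => if (n : ZMod N) = i then f n else 0) (g i) := by
    have hinj : Function.Injective fun q : ℤ => q * N + (i.val : ℤ) := by
      intro a b hab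
      have hN : (N : ℤ) ≠ 0 := by exact_mod_cast NeZero.ne N
      exact mul_right_cancel₀ hN (add_right_cancel hab)
    refine (hinj.hasSum_iff ?_).1 ?_
    · intro n hn
      rw [if_neg]
      rintro rfl
      refine hn ⟨n / N, ?_⟩
      simp only
      rw [ZMod.val_intCast]
      exact Int.ediv_mul_add_emod n N
    · refine (congrArg (fun φ => HasSum φ (g i)) ?_).mpr (h i)
      ext q
      simp
  have h2 := hasSum_sum (s := Finset.univ) fun i _ => h1 i
  refine (congrArg (fun φ => HasSum φ _) ?_).mpr h2
  ext n
  simp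

lemma poisson_twist {N : ℕ} [NeZero N] {χ : DirichletCharacter ℂ N} (hχ : χ.IsPrimitive)
    (F : ℝ → ℂ) (G : ℤ → ℂ) (A B : ℝ → ℂ) (c : ℂ)
    (hF : ∀ a : ℝ, HasSum (fun n : ℤ => F (n + a)) (A a))
    (hG : ∀ a : ℝ, HasSum (fun n : ℤ => Complex.exp (2 * Real.pi * Complex.I * a * n) * G n) (B a))
    (hAB : ∀ a, A a = c * B a) :
    ∃ V, HasSum (fun n : ℤ => χ n * F (n / N)) (c * V) ∧
      HasSum (fun n : ℤ => χ⁻¹ n * (gaussSum χ ZMod.stdAddChar * G n)) V := by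
  have hN : (N : ℝ) ≠ 0 := by exact_mod_cast NeZero.ne N
  refine ⟨∑ i : ZMod N, χ i * B (i.val / N), ?_, ?_⟩
  · have := hasSum_residue (fun n : ℤ => χ n * F (n / N)) (fun i => χ i * A (i.val / N)) fun i => by
      refine (congrArg (fun φ => HasSum φ _) ?_).mpr ((hF (i.val / N)).mul_left (χ i))
      ext q
      congr 2
      · simp
      · push_cast
        field_simp
    rw [Finset.mul_sum]
    refine (congrArg (fun v => HasSum _ v) ?_).mpr this
    refine Finset.sum_congr rfl fun i _ => ?_
    rw [hAB]
    ring
  · have := hasSum_sum (s := Finset.univ) fun (i : ZMod N) _ =>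
      (hG (i.val / N)).mul_left (χ i)
    refine (congrArg (fun φ => HasSum φ _) ?_).mpr this
    ext n
    rw [← mul_assoc, ← gaussSum_mulShift_of_isPrimitive _ hχ, gaussSum, Finset.sum_mul]
    refine Finset.sum_congr rfl fun i _ => ?_
    rw [← mul_assoc, AddChar.mulShift_apply]
    congr 2
    have : (n : ZMod N) * i = ((n * i.val : ℤ) : ZMod N) := by simp
    rw [this, ZMod.stdAddChar_coe]
    push_cast
    congr 1
    ring

/-- Coefficients of a (real valued) Dirichlet character as an arithmetic function. -/
noncomputable def coef {N : ℕ} (χ : DirichletCharacter ℂ N) : ArithmeticFunction ℝ :=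
  ⟨fun n => if n = 0 then 0 else (χ n).re, by simp⟩

lemma theta_transform {N : ℕ} [NeZero N] {χ : DirichletCharacter ℂ N} (hχ : χ.IsPrimitive)
    (hinv : χ⁻¹ = χ) {j : ℕ} (hj : j = 0 ∨ j = 1) :
    ∃ c : ℂ, ∃ U : ℝ → ℂ, ∀ x,
      HasSum (fun n : ℤ => χ n * (n ^ j * Real.exp (-Real.pi * n ^ 2 * (Real.exp (2 * x) / N) : ℝ) : ℂ))
        (U x) ∧ U x = c * Real.exp (-(1 + 2 * j) * x) * U (-x) := by
  have hN : (0 : ℝ) < N := by exact_mod_cast Nat.pos_of_ne_zero (NeZero.ne N)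
  have hs (x : ℝ) : 0 < N * Real.exp (2 * x) := by positivity
  have hinvs (x : ℝ) : 1 / (N * Real.exp (2 * x)) = Real.exp (2 * -x) / N := by
    rw [mul_neg, Real.exp_neg]
    field_simp
  set T : ℝ → ℤ → ℂ := fun x n =>
    χ n * (n ^ j * Real.exp (-Real.pi * n ^ 2 * (Real.exp (2 * x) / N) : ℝ) : ℂ) with hT
  suffices h : ∃ c : ℂ, ∀ x, ∃ V : ℂ, ∃ d : ℂ, ∃ e : ℂ, HasSum (T x) (d * V) ∧
      HasSum (fun n => e * T (-x) n) V ∧ d * e = c * Real.exp (-(1 + 2 * j) * x) by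
    obtain ⟨c, hc⟩ := h
    have hsum (x) : HasSum (T x) (∑' n, T x n) := by
      obtain ⟨V, d, e, h1, -⟩ := hc x
      exact h1.summable.hasSum
    refine ⟨c, fun x => ∑' n, T x n, fun x => ⟨hsum x, ?_⟩⟩
    obtain ⟨V, d, e, h1, h2, h3⟩ := hc x
    show ∑' n, T x n = _ * ∑' n, T (-x) n
    rw [← h3, h1.tsum_eq, h2.unique ((hsum (-x)).mul_left e)]
    ring
  set τ := gaussSum χ ZMod.stdAddChar with hτ
  rcases hj with rfl | rfl
  · refine ⟨τ * ((1 / (N : ℝ) ^ (1 / 2 : ℝ) : ℝ) : ℂ), fun x => ?_⟩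
    obtain ⟨V, h1, h2⟩ := poisson_twist hχ
      (fun y => (Real.exp (-Real.pi * y ^ 2 * (N * Real.exp (2 * x))) : ℝ))
      (fun n => (Real.exp (-Real.pi * n ^ 2 * (1 / (N * Real.exp (2 * x)))) : ℝ))
      (fun a => (HurwitzZeta.evenKernel a (N * Real.exp (2 * x)) : ℝ))
      (fun a => (HurwitzZeta.cosKernel a (1 / (N * Real.exp (2 * x))) : ℝ))
      ((1 / (N * Real.exp (2 * x)) ^ (1 / 2 : ℝ) : ℝ) : ℂ)
      (fun a => by exact_mod_cast HurwitzZeta.hasSum_int_evenKernel a (hs x))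
      (fun a => HurwitzZeta.hasSum_int_cosKernel a (one_div_pos.2 (hs x)))
      (fun a => by exact_mod_cast HurwitzZeta.evenKernel_functional_equation a _)
    refine ⟨V, _, τ, (congrArg (fun φ => HasSum φ _) ?_).mpr h1,
      (congrArg (fun φ => HasSum φ _) ?_).mpr h2, ?_⟩
    · ext n
      rw [hT]
      simp only [pow_zero, one_mul]
      rw [show -Real.pi * (n / N : ℝ) ^ 2 * (N * Real.exp (2 * x)) =
        -Real.pi * n ^ 2 * (Real.exp (2 * x) / N) by field_simp]
    · ext n
      rw [hT, hinv, hinvs]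
      simp only [pow_zero, one_mul]
      ring
    · have : (1 / (N * Real.exp (2 * x)) ^ (1 / 2 : ℝ) : ℝ) =
          (1 / (N : ℝ) ^ (1 / 2 : ℝ)) * Real.exp (-(1 + 2 * (0 : ℕ)) * x) := by
        rw [Real.mul_rpow hN.le (Real.exp_nonneg _), ← Real.exp_mul, ← one_div_mul_one_div,
          one_div (Real.exp _), ← Real.exp_neg]
        congr 2
        push_cast
        ring
      rw [this]
      push_cast
      ring
  · refine ⟨τ * (-Complex.I * N * ((1 / (N : ℝ) ^ (3 / 2 : ℝ) : ℝ) : ℂ)), fun x => ?_⟩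
    obtain ⟨V, h1, h2⟩ := poisson_twist hχ
      (fun y => (y * Real.exp (-Real.pi * y ^ 2 * (N * Real.exp (2 * x))) : ℝ))
      (fun n => -Complex.I * n *
        (Real.exp (-Real.pi * n ^ 2 * (1 / (N * Real.exp (2 * x)))) : ℝ))
      (fun a => (HurwitzZeta.oddKernel a (N * Real.exp (2 * x)) : ℝ))
      (fun a => (HurwitzZeta.sinKernel a (1 / (N * Real.exp (2 * x))) : ℝ))
      ((1 / (N * Real.exp (2 * x)) ^ (3 / 2 : ℝ) : ℝ) : ℂ)
      (fun a => by exact_mod_cast HurwitzZeta.hasSum_int_oddKernel a (hs x))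
      (fun a => by
        refine (congrArg (fun φ => HasSum φ _) ?_).mpr
          (HurwitzZeta.hasSum_int_sinKernel a (one_div_pos.2 (hs x)))
        ext n
        ring)
      (fun a => by exact_mod_cast HurwitzZeta.oddKernel_functional_equation a _)
    have h1' := h1.mul_left (N : ℂ)
    rw [← mul_assoc] at h1'
    refine ⟨V, _, τ * -Complex.I, (congrArg (fun φ => HasSum φ _) ?_).mpr h1',
      (congrArg (fun φ => HasSum φ _) ?_).mpr h2, ?_⟩
    · ext n
      have hNc : (N : ℂ) ≠ 0 := by exact_mod_cast hN.ne'
      rw [hT]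
      simp only [pow_one]
      rw [show -Real.pi * (n / N : ℝ) ^ 2 * (N * Real.exp (2 * x)) =
        -Real.pi * n ^ 2 * (Real.exp (2 * x) / N) by field_simp]
      push_cast
      field_simp
    · ext n
      rw [hT, hinv, hinvs]
      simp only [pow_one]
      ring
    · have : (1 / (N * Real.exp (2 * x)) ^ (3 / 2 : ℝ) : ℝ) =
          (1 / (N : ℝ) ^ (3 / 2 : ℝ)) * Real.exp (-(1 + 2 * (1 : ℕ)) * x) := by
        rw [Real.mul_rpow hN.le (Real.exp_nonneg _), ← Real.exp_mul, one_div, one_div, mul_inv,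
          ← Real.exp_neg]
        congr 2
        push_cast
        ring
      rw [this]
      push_cast
      ring

lemma exists_sign {f : ℝ → ℝ} {c : ℂ} (h : ∀ x, (f x : ℂ) = c * Real.exp (-x) * f (-x)) :
    ∃ W : ℝ, (W = 1 ∨ W = -1) ∧ FEq W f := by
  by_cases h0 : ∀ x, f x = 0
  · exact ⟨1, Or.inl rfl, fun x => by rw [h0, h0, mul_zero]⟩
  push Not at h0
  obtain ⟨x, hx⟩ := h0
  have hx' : f (-x) ≠ 0 := by
    intro hz
    have := h x
    rw [hz] at this
    simp [hx] at this
  obtain ⟨r, rfl⟩ : ∃ r : ℝ, c = r := by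
    refine ⟨f x * Real.exp x / f (-x), ?_⟩
    have hz : (f (-x) : ℂ) ≠ 0 := by exact_mod_cast hx'
    push_cast
    rw [h x, Real.exp_neg]
    have : (Real.exp x : ℂ) ≠ 0 := by exact_mod_cast (Real.exp_pos x).ne'
    push_cast at this ⊢
    field_simp
  have hr (x : ℝ) : f x = r * Real.exp (-x) * f (-x) := by exact_mod_cast h x
  refine ⟨r, ?_, fun x => by simpa using hr (-x)⟩
  have h1 := hr x
  have h2 := hr (-x)
  rw [neg_neg] at h2
  rw [h2] at h1
  have h3 : Real.exp (-x) * Real.exp x = 1 := by rw [← Real.exp_add]; simp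
  have h4 : r * r = 1 := by
    refine mul_right_cancel₀ hx ?_
    calc r * r * f x = r * r * (Real.exp (-x) * Real.exp x) * f x := by rw [h3, mul_one]
      _ = 1 * f x := by linarith
  exact mul_self_eq_one_iff.1 h4

lemma thetaKernel_shift {N n : ℕ} (hN : N ≠ 0) (hn : n ≠ 0) (j : ℕ) (x : ℝ) :
    thetaKernel j (x + Real.log n - Real.log N / 2) =
      Real.exp (j * x) * Real.exp (-(j * (Real.log N / 2))) *
        (2 * (n ^ j * Real.exp (-Real.pi * n ^ 2 * (Real.exp (2 * x) / N)))) := by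
  have hn' : (0 : ℝ) < n := by positivity
  have hN' : (0 : ℝ) < N := by positivity
  have h1 : Real.exp (j * Real.log n) = (n : ℝ) ^ j := by
    rw [Real.exp_nat_mul, Real.exp_log hn']
  have h2 : Real.exp (2 * (x + Real.log n - Real.log N / 2)) = n ^ 2 * (Real.exp (2 * x) / N) := by
    rw [show 2 * (x + Real.log n - Real.log N / 2) = (2 : ℕ) * Real.log n + (2 * x - Real.log N) by
      push_cast; ring, Real.exp_add, Real.exp_nat_mul, Real.exp_log hn', Real.exp_sub,
      Real.exp_log hN']
  rw [thetaKernel, h2, show (j : ℝ) * (x + Real.log n - Real.log N / 2) =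
    j * x + -(j * (Real.log N / 2)) + j * Real.log n by ring, Real.exp_add, Real.exp_add, h1]
  ring_nf

lemma exists_theta {N : ℕ} [NeZero N] (hN : 1 < N) {χ : DirichletCharacter ℂ N}
    (hχ : χ.IsPrimitive) (hq : χ.IsQuadratic) {j : ℕ}
    (hj : (j = 0 ∧ χ.Even) ∨ (j = 1 ∧ χ.Odd)) :
    ∃ (f : ℝ → ℝ) (W : ℝ), (W = 1 ∨ W = -1) ∧ FEq W f ∧
      Rep f (coef χ) (thetaKernel j) (Real.log N / 2) := by
  obtain ⟨c, U, hU⟩ := theta_transform (j := j) hχ hq.inv (hj.imp And.left And.left)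
  have hre (a : ZMod N) : χ a = ((χ a).re : ℂ) := by
    rcases hq a with h | h | h <;> simp [h]
  have hχ0 : χ 0 = 0 := by
    have : Nontrivial (ZMod N) := ZMod.nontrivial_iff.2 hN.ne'
    exact χ.map_zero
  have hsum (x : ℝ) : HasSum (fun n : ℕ => ((coef χ n * (2 * (n ^ j *
      Real.exp (-Real.pi * n ^ 2 * (Real.exp (2 * x) / N)))) : ℝ) : ℂ)) (U x) := by
    have := (hU x).1.nat_add_neg
    simp only [Int.cast_zero, hχ0, zero_mul, add_zero] at this
    refine (congrArg (fun φ => HasSum φ _) ?_).mpr this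
    ext n
    by_cases hn : n = 0
    · simp [hn, hχ0]
    simp only [coef, ArithmeticFunction.coe_mk, if_neg hn]
    push_cast
    rw [← hre]
    rcases hj with ⟨rfl, he⟩ | ⟨rfl, ho⟩
    · rw [he.eval_neg]
      simp
      ring
    · rw [ho.eval_neg]
      simp
      ring
  have hreal (x : ℝ) : HasSum (fun n : ℕ => coef χ n * (2 * (n ^ j *
      Real.exp (-Real.pi * n ^ 2 * (Real.exp (2 * x) / N))))) (U x).re := by
    have := Complex.hasSum_re (hsum x)
    simpa only [Complex.ofReal_re] using this
  have hUre (x : ℝ) : U x = ((U x).re : ℂ) :=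
    (hsum x).unique (Complex.hasSum_ofReal.2 (hreal x))
  set κ := Real.exp (-(j * (Real.log N / 2))) with hκ
  have hFE (x : ℝ) : ((Real.exp (j * x) * κ * (U x).re : ℝ) : ℂ) =
      c * Real.exp (-x) * ((Real.exp (j * (-x)) * κ * (U (-x)).re : ℝ) : ℂ) := by
    rw [Complex.ofReal_mul, ← hUre, Complex.ofReal_mul _ (U (-x)).re, ← hUre, (hU x).2]
    have : Real.exp (j * x) * Real.exp (-(1 + 2 * j) * x) =
        Real.exp (-x) * Real.exp (j * -x) := by
      rw [← Real.exp_add, ← Real.exp_add]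
      congr 1
      ring
    calc _ = c * ((Real.exp (j * x) * Real.exp (-(1 + 2 * j) * x) : ℝ) : ℂ) * κ * U (-x) := by
          push_cast; ring
      _ = _ := by rw [this]; push_cast; ring
  obtain ⟨W, hW, hfe⟩ := exists_sign (f := fun x => Real.exp (j * x) * κ * (U x).re) hFE
  refine ⟨_, W, hW, hfe, fun x => ?_⟩
  refine (congrArg (fun φ => HasSum φ _) ?_).mpr ((hreal x).mul_left (Real.exp (j * x) * κ))
  ext n
  by_cases hn : n = 0
  · simp [hn]
  rw [thetaKernel_shift (by omega) hn]
  ring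

/-- The constant function `1` as a real arithmetic function. -/
noncomputable def one' : ArithmeticFunction ℝ := ⟨fun n => if n = 0 then 0 else 1, by simp⟩

lemma absConvAt_of_bounded {a : ArithmeticFunction ℝ} (ha : ∀ n, |a n| ≤ 1) {s : ℝ} (hs : 1 < s) :
    AbsConvAt a s := by
  refine Summable.of_nonneg_of_le (fun n => by positivity) (fun n => ?_)
    (Real.summable_nat_rpow.2 (neg_lt_neg hs))
  by_cases hn : n = 0
  · simp only [hn, ArithmeticFunction.map_zero, abs_zero, zero_mul]
    positivity
  · rw [Real.rpow_def_of_pos (by positivity), mul_comm (Real.log n)]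
    exact mul_le_of_le_one_left (Real.exp_nonneg _) (ha n)

lemma absConvAt_one {s : ℝ} (hs : 1 < s) : AbsConvAt one' s :=
  absConvAt_of_bounded (fun n => by by_cases h : n = 0 <;> simp [one', h]) hs

lemma absConvAt_coef {N : ℕ} (χ : DirichletCharacter ℂ N) {s : ℝ} (hs : 1 < s) :
    AbsConvAt (coef χ) s :=
  absConvAt_of_bounded (fun n => by
    by_cases h : n = 0
    · simp [h]
    · simpa [coef, h] using (Complex.abs_re_le_norm _).trans (χ.norm_le_one n)) hs

lemma FEq.expBdd {f : ℝ → ℝ} {W : ℝ} (hW : W = 1 ∨ W = -1) (hfe : FEq W f)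
    (hf : ExpBdd (Set.Ioi 1) f) : ExpBdd Set.univ f := by
  refine ⟨hf.meas, fun a _ => ?_⟩
  obtain ⟨C, hC⟩ := hf.bound (max 2 a) (by simp)
  obtain ⟨D, hD⟩ := hf.bound (max 2 (1 - a)) (by simp)
  have hC0 : 0 ≤ C := by simpa using (abs_nonneg _).trans (hC 0)
  have hD0 : 0 ≤ D := by simpa using (abs_nonneg _).trans (hD 0)
  refine ⟨C + D, fun x => ?_⟩
  rcases le_total 0 x with hx | hx
  · refine (hC x).trans ?_
    refine mul_le_mul (by linarith) (Real.exp_le_exp.2 ?_) (Real.exp_nonneg _) (by linarith)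
    nlinarith [le_max_right 2 a]
  · have h1 : |f x| = Real.exp (-x) * |f (-x)| := by
      have := hfe (-x)
      rw [neg_neg] at this
      rw [this, abs_mul, abs_mul, abs_of_pos (Real.exp_pos _)]
      rcases hW with rfl | rfl <;> simp
    rw [h1]
    calc _ ≤ Real.exp (-x) * (D * Real.exp (-(max 2 (1 - a)) * -x)) :=
          mul_le_mul_of_nonneg_left (hD _) (Real.exp_nonneg _)
      _ = D * Real.exp (-x + -(max 2 (1 - a)) * -x) := by rw [Real.exp_add]; ring
      _ ≤ _ := by
        refine mul_le_mul (by linarith) (Real.exp_le_exp.2 ?_) (Real.exp_nonneg _) (by linarith)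
        nlinarith [le_max_right 2 (1 - a)]

lemma continuous_lap {f : ℝ → ℝ} (hf : ExpBdd Set.univ f) : Continuous (lap f) := by
  refine continuous_iff_continuousAt.2 fun s => ?_
  refine continuousAt_of_dominated (bound := fun x => |f x| * Real.exp ((s - 1) * x) +
    |f x| * Real.exp ((s + 1) * x)) ?_ ?_ ?_ ?_
  · exact Eventually.of_forall fun t => (hf.meas.mul (by fun_prop)).aestronglyMeasurable
  · filter_upwards [Metric.ball_mem_nhds s one_pos] with t ht
    refine ae_of_all _ fun x => ?_
    rw [Metric.mem_ball, Real.dist_eq, abs_lt] at ht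
    rw [Real.norm_eq_abs, abs_mul, abs_of_pos (Real.exp_pos _), ← mul_add]
    refine mul_le_mul_of_nonneg_left ?_ (abs_nonneg _)
    rcases le_total 0 x with hx | hx
    · refine (Real.exp_le_exp.2 ?_).trans (le_add_of_nonneg_left (Real.exp_nonneg _))
      nlinarith
    · refine (Real.exp_le_exp.2 ?_).trans (le_add_of_nonneg_right (Real.exp_nonneg _))
      nlinarith
  · exact (hf.abs.integrable isOpen_univ (Set.mem_univ _)).add
      (hf.abs.integrable isOpen_univ (Set.mem_univ _))
  · exact ae_of_all _ fun x => by fun_prop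

lemma exists_zetaLike : ∃ f, ZetaLike f ∧ Rep f one' (thetaKernel 0) 0 := by
  have ht (x : ℝ) : 0 < Real.exp (2 * x) := Real.exp_pos _
  set θ : ℝ → ℝ := fun x => HurwitzZeta.evenKernel (0 : ℝ) (Real.exp (2 * x)) with hθ
  have hfe (x : ℝ) : θ (-x) = Real.exp x * θ x := by
    have h1 := HurwitzZeta.evenKernel_functional_equation ((0 : ℝ) : UnitAddCircle)
      (Real.exp (2 * -x))
    have h2 := HurwitzZeta.hasSum_int_evenKernel 0 (ht x)
    have h3 := HurwitzZeta.hasSum_int_cosKernel 0 (ht x)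
    have h4 : HurwitzZeta.cosKernel (0 : ℝ) (Real.exp (2 * x)) = θ x := by
      have := (Complex.hasSum_ofReal.2 h2).unique
        ((congrArg (fun φ => HasSum φ _) (by ext n; simp)).mpr h3)
      exact_mod_cast this.symm
    rw [show θ (-x) = _ from h1, one_div (Real.exp _), ← Real.exp_neg,
      show -(2 * -x) = 2 * x by ring, h4, ← Real.exp_mul, one_div, ← Real.exp_neg]
    congr 2
    ring
  have hrep : Rep (fun x => θ x - 1) one' (thetaKernel 0) 0 := by
    intro x
    have h := (HurwitzZeta.hasSum_int_evenKernel 0 (ht x)).nat_add_neg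
    have h1 : HasSum (fun n : ℕ => if n = 0 then (2 : ℝ) else 0) 2 := by
      simpa using hasSum_ite_eq (0 : ℕ) (2 : ℝ)
    have h2 := h.sub h1
    refine (congrArg₂ HasSum ?_ ?_).mpr h2
    · ext n
      by_cases hn : n = 0
      · simp [hn, one']
        norm_num
      · have := thetaKernel_shift one_ne_zero hn 0 x
        simp only [Nat.cast_one, Real.log_one, zero_div] at this
        rw [this]
        simp [hn, one']
        ring
    · simp [hθ]
      ring
  refine ⟨fun x => θ x - 1, ⟨hrep.expBdd (thetaKernel_expBdd 0) fun s hs => absConvAt_one hs,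
    fun x => ?_, fun x => ?_⟩, hrep⟩
  · simp only [hfe]
    ring
  · have hlim := ((hrep x).tendsto_sum_nat).comp (tendsto_add_atTop_nat 1)
    refine le_of_tendsto' hlim fun n => ?_
    set b := Real.pi * Real.exp (2 * x) with hb
    have hb0 : 0 < b := mul_pos Real.pi_pos (ht x)
    have h1 : ∑ i ∈ Finset.range (n + 1), one' i * thetaKernel 0 (x + Real.log i - 0) =
        ∑ i ∈ Finset.range n, 2 * Real.exp (-b * ((0 : ℝ) + (i + 1 : ℕ)) ^ 2) := by
      rw [Finset.sum_range_succ', ArithmeticFunction.map_zero, zero_mul, add_zero]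
      refine Finset.sum_congr rfl fun i _ => ?_
      have := thetaKernel_shift one_ne_zero i.succ_ne_zero 0 x
      simp only [Nat.cast_one, Real.log_one, zero_div, Nat.succ_eq_add_one] at this
      rw [this]
      simp [one', hb]
      ring_nf
    have hanti : AntitoneOn (fun y : ℝ => 2 * Real.exp (-b * y ^ 2)) (Set.Icc 0 (0 + (n : ℝ))) := by
      intro u hu v hv huv
      refine mul_le_mul_of_nonneg_left (Real.exp_le_exp.2 ?_) zero_le_two
      have : u ^ 2 ≤ v ^ 2 := pow_le_pow_left₀ hu.1 huv 2
      nlinarith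
    have hIntg : IntegrableOn (fun y : ℝ => 2 * Real.exp (-b * y ^ 2)) (Set.Ioi 0) :=
      ((integrable_exp_neg_mul_sq hb0).const_mul 2).integrableOn
    simp only [Function.comp_apply]
    rw [h1]
    refine (hanti.sum_le_integral).trans ?_
    rw [zero_add, intervalIntegral.integral_of_le (by positivity)]
    refine (setIntegral_mono_set hIntg (ae_of_all _ fun y => by positivity)
      (ae_of_all _ fun y hy => hy.1)).trans ?_
    rw [integral_const_mul, integral_gaussian_Ioi, hb, ← div_div, div_self Real.pi_ne_zero,
      one_div, ← Real.exp_neg, ← Real.exp_half]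
    refine le_of_eq ?_
    ring_nf

lemma zeta_mul_coef_nonneg {N : ℕ} {χ : DirichletCharacter ℂ N} (hq : χ.IsQuadratic) (n : ℕ) :
    0 ≤ (one' * coef χ) n := by
  have h := DirichletCharacter.zetaMul_nonneg (MulChar.isQuadratic_iff_sq_eq_one.mp hq) n
  have h2 : (one' * coef χ) n = (χ.zetaMul n).re := by
    rw [DirichletCharacter.zetaMul, ArithmeticFunction.mul_apply, ArithmeticFunction.mul_apply,
      Complex.re_sum]
    refine Finset.sum_congr rfl fun p _ => ?_
    by_cases h1 : p.1 = 0 <;> by_cases h2 : p.2 = 0 <;>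
      simp [one', coef, toArithmeticFunction, h1, h2]
  rw [h2]
  exact (Complex.le_def.1 h).1

lemma lap_thetaKernel_pos (j : ℕ) {s : ℝ} (hs : 0 < s) : 0 < lap (thetaKernel j) s := by
  rw [lap_thetaKernel j hs]
  have : 0 < (s + j) / 2 := by positivity
  have := Real.Gamma_pos_of_pos this
  positivity

lemma lap_eq_LFunction {N : ℕ} [NeZero N] {χ : DirichletCharacter ℂ N} (hq : χ.IsQuadratic)
    {f : ℝ → ℝ} {j : ℕ} {q : ℝ} (hrep : Rep f (coef χ) (thetaKernel j) q) {s : ℝ} (hs : 1 < s) :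
    (lap f s : ℂ) = χ.LFunction s * (Real.exp (s * q) * lap (thetaKernel j) s : ℝ) := by
  have h := Complex.hasSum_ofReal.2
    (rep_lap hrep (thetaKernel_expBdd j) (by linarith) (absConvAt_coef χ hs))
  have hL : LSeriesSummable (χ ·) (s : ℂ) :=
    χ.LSeriesSummable_of_one_lt_re (by simpa using hs)
  have h2 := (hL.LSeriesHasSum).mul_right ((Real.exp (s * q) * lap (thetaKernel j) s : ℝ) : ℂ)
  rw [χ.LFunction_eq_LSeries (by simpa using hs)]
  refine h.unique ((congrArg (fun φ => HasSum φ _) ?_).mpr h2)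
  ext n
  by_cases hn : n = 0
  · simp [hn]
  rw [LSeries.term_of_ne_zero hn]
  have hre : χ n = ((χ n).re : ℂ) := by
    rcases hq n with h | h | h <;> simp [h]
  have hpow : ((n : ℂ) ^ (s : ℂ)) = ((Real.exp (s * Real.log n) : ℝ) : ℂ) := by
    rw [mul_comm, ← Real.rpow_def_of_pos (by positivity), Complex.ofReal_cpow (by positivity)]
    simp
  have hc : coef χ n = (χ n).re := by simp [coef, hn]
  rw [hpow, hc, neg_mul, Real.exp_neg, Complex.ofReal_mul, Complex.ofReal_mul, ← hre,
    Complex.ofReal_inv, div_eq_mul_inv]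

lemma lap_zetaLike_pos {f : ℝ → ℝ} (hrep : Rep f one' (thetaKernel 0) 0) {s : ℝ} (hs : 1 < s) :
    0 < lap f s := by
  have h := rep_lap hrep (thetaKernel_expBdd 0) (by linarith) (absConvAt_one hs)
  have h1 := lap_thetaKernel_pos 0 (s := s) (by linarith)
  refine (lt_of_lt_of_le ?_ (le_hasSum h 1 fun n _ => ?_))
  · simp [one', h1]
  · have : 0 ≤ one' n := by by_cases h : n = 0 <;> simp [one', h]
    positivity

lemma lap_one_pos {N : ℕ} [NeZero N] {χ : DirichletCharacter ℂ N} (hq : χ.IsQuadratic)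
    (hχ : χ ≠ 1) {f : ℝ → ℝ} {j : ℕ} {q : ℝ} (hrep : Rep f (coef χ) (thetaKernel j) q)
    (hf : ExpBdd Set.univ f) : 0 < lap f 1 := by
  obtain ⟨f₀, hz, hr₀⟩ := exists_zetaLike
  have hpos (s : ℝ) (hs : 1 < s) : 0 ≤ lap f s := by
    have h0 := lap_zetaLike_pos hr₀ hs
    have h1 := rep_conv hr₀ hrep (thetaKernel_expBdd 0) (thetaKernel_expBdd j)
      (s := 2) (by norm_num) (absConvAt_one (by norm_num)) (absConvAt_coef χ (by norm_num))
    have h2 := h1.nonneg (zeta_mul_coef_nonneg hq)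
      (conv_nonneg (thetaKernel_nonneg 0) (thetaKernel_nonneg j))
    have h3 : 0 ≤ lap (conv f₀ f) s :=
      integral_nonneg fun x => mul_nonneg (h2 x) (Real.exp_nonneg _)
    rw [lap_conv isOpen_Ioi hz.bdd (hf.mono (Set.subset_univ _)) (Set.mem_Ioi.2 hs)] at h3
    exact nonneg_of_mul_nonneg_right h3 h0
  have hlim : Tendsto (lap f) (𝓝[>] 1) (𝓝 (lap f 1)) :=
    (continuous_lap hf).continuousAt.tendsto.mono_left nhdsWithin_le_nhds
  have hge : 0 ≤ lap f 1 := by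
    refine ge_of_tendsto hlim ?_
    filter_upwards [self_mem_nhdsWithin] with s hs
    exact hpos s hs
  refine lt_of_le_of_ne hge fun h0 => ?_
  have hL : Tendsto (fun s : ℝ => (lap f s : ℂ) / (Real.exp (s * q) * lap (thetaKernel j) s : ℝ))
      (𝓝[>] 1) (𝓝 (χ.LFunction 1)) := by
    have h1 : Tendsto (fun s : ℝ => χ.LFunction s) (𝓝[>] 1) (𝓝 (χ.LFunction (1 : ℝ))) :=
      (((DirichletCharacter.differentiable_LFunction hχ).continuous.comp
        Complex.continuous_ofReal).tendsto 1).mono_left nhdsWithin_le_nhds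
    rw [Complex.ofReal_one] at h1
    refine h1.congr' ?_
    filter_upwards [self_mem_nhdsWithin] with s hs
    have hs : 1 < s := hs
    rw [lap_eq_LFunction hq hrep hs, mul_div_cancel_right₀]
    have := lap_thetaKernel_pos j (s := s) (by linarith)
    exact_mod_cast (by positivity : Real.exp (s * q) * lap (thetaKernel j) s ≠ 0)
  have hK : Tendsto (fun s : ℝ => Real.exp (s * q) * lap (thetaKernel j) s) (𝓝[>] 1)
      (𝓝 (Real.exp (1 * q) * lap (thetaKernel j) 1)) := by
    have hc : ContinuousAt (fun s : ℝ => Real.exp (s * q) *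
        (Real.pi ^ (-((s + j) / 2)) * Real.Gamma ((s + j) / 2))) 1 := by
      refine ContinuousAt.mul (by fun_prop) (ContinuousAt.mul ?_ ?_)
      · exact ContinuousAt.rpow continuousAt_const (by fun_prop) (Or.inl Real.pi_ne_zero)
      · refine ContinuousAt.comp (f := fun s : ℝ => (s + j) / 2)
          (Real.differentiableAt_Gamma fun m => ?_).continuousAt (by fun_prop)
        have : (0 : ℝ) < (1 + j) / 2 := by positivity
        have : (0 : ℝ) ≤ m := by positivity
        linarith
    rw [lap_thetaKernel j one_pos]
    refine (hc.tendsto.mono_left nhdsWithin_le_nhds).congr' ?_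
    filter_upwards [self_mem_nhdsWithin] with s hs
    have hs : 1 < s := hs
    rw [lap_thetaKernel j (by linarith)]
  have hK1 := lap_thetaKernel_pos j (s := 1) one_pos
  have h2 := ((Complex.continuous_ofReal.tendsto _).comp hlim).div
    ((Complex.continuous_ofReal.tendsto _).comp hK)
    (by exact_mod_cast (by positivity : Real.exp (1 * q) * lap (thetaKernel j) 1 ≠ 0))
  have h3 := tendsto_nhds_unique h2 hL
  rw [← h0] at h3
  exact DirichletCharacter.LFunction_apply_one_ne_zero hχ (by simpa using h3.symm)

/-- The kernel whose Laplace transform is `2 (2π)^(-s) Γ(s)`. -/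
noncomputable def quadKernel : ℝ → ℝ := conv (thetaKernel 0) (thetaKernel 1)

lemma quadKernel_expBdd : ExpBdd (Set.Ioi 0) quadKernel :=
  (thetaKernel_expBdd 0).conv isOpen_Ioi (thetaKernel_expBdd 1)

lemma quadKernel_nonneg (x : ℝ) : 0 ≤ quadKernel x :=
  conv_nonneg (thetaKernel_nonneg 0) (thetaKernel_nonneg 1) x

lemma lap_quadKernel {s : ℝ} (hs : 0 < s) :
    lap quadKernel s = 2 * (2 * Real.pi) ^ (-s) * Real.Gamma s := by
  rw [quadKernel, lap_conv isOpen_Ioi (thetaKernel_expBdd 0) (thetaKernel_expBdd 1)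
    (Set.mem_Ioi.2 hs), lap_thetaKernel 0 hs, lap_thetaKernel 1 hs]
  have h := Real.Gamma_mul_Gamma_add_half (s / 2)
  have hpi := Real.pi_pos
  rw [show 2 * (s / 2) = s by ring, show s / 2 + 1 / 2 = (s + 1) / 2 by ring] at h
  rw [show (s + ((0 : ℕ) : ℝ)) / 2 = s / 2 by simp, show (s + ((1 : ℕ) : ℝ)) / 2 = (s + 1) / 2 by simp]
  have e : Real.pi ^ (-(s / 2)) * Real.pi ^ (-((s + 1) / 2)) * √Real.pi = Real.pi ^ (-s) := by
    rw [Real.sqrt_eq_rpow, ← Real.rpow_add hpi, ← Real.rpow_add hpi]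
    congr 1
    ring
  have e2 : (2 : ℝ) ^ (1 - s) = 2 * 2 ^ (-s) := by
    rw [sub_eq_add_neg, Real.rpow_add two_pos, Real.rpow_one]
  calc _ = Real.pi ^ (-(s / 2)) * Real.pi ^ (-((s + 1) / 2)) *
      (Real.Gamma (s / 2) * Real.Gamma ((s + 1) / 2)) := by ring
    _ = (Real.pi ^ (-(s / 2)) * Real.pi ^ (-((s + 1) / 2)) * √Real.pi) *
      (Real.Gamma s * 2 ^ (1 - s)) := by rw [h]; ring
    _ = _ := by rw [e, e2, Real.mul_rpow two_pos.le hpi.le]; ring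

lemma one_le_Gamma {s : ℝ} (hs : 0 < s) (hs1 : s ≤ 1) : 1 ≤ Real.Gamma s := by
  have h2 : (0 : ℝ) < 2 - s := by linarith
  have h := Real.convexOn_Gamma.2 (Set.mem_Ioi.2 hs) (Set.mem_Ioi.2 two_pos)
    (show 0 ≤ 1 / (2 - s) by positivity)
    (show 0 ≤ (1 - s) / (2 - s) from div_nonneg (by linarith) h2.le) (by field_simp; ring)
  simp only [smul_eq_mul] at h
  rw [show 1 / (2 - s) * s + (1 - s) / (2 - s) * 2 = 1 by field_simp; ring, Real.Gamma_one,
    Real.Gamma_two] at h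
  have : 1 / (2 - s) * 1 ≤ 1 / (2 - s) * Real.Gamma s := by
    have : 1 / (2 - s) * 1 + (1 - s) / (2 - s) * 1 = 1 := by field_simp; ring
    linarith
  exact le_of_mul_le_mul_left this (by positivity)

lemma le_lap_quadKernel {s : ℝ} (hs : 0 < s) (hs1 : s ≤ 1) : 1 / Real.pi ≤ lap quadKernel s := by
  have hpi := Real.pi_pos
  have hpi3 := Real.pi_gt_three
  have h1 : (1 : ℝ) ≤ (2 * Real.pi) ^ (1 - s) :=
    Real.one_le_rpow (by linarith) (by linarith)
  have h2 := one_le_Gamma hs hs1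
  rw [lap_quadKernel hs, show -s = (1 - s) - 1 by ring, Real.rpow_sub_one (by positivity)]
  rw [show 2 * ((2 * Real.pi) ^ (1 - s) / (2 * Real.pi)) * Real.Gamma s =
    1 / Real.pi * ((2 * Real.pi) ^ (1 - s) * Real.Gamma s) by field_simp]
  refine le_mul_of_one_le_right (by positivity) ?_
  nlinarith

lemma lap_quadKernel_half : lap quadKernel (1 / 2) = √2 := by
  rw [lap_quadKernel (by norm_num), Real.Gamma_one_half_eq, Real.rpow_neg (by positivity),
    ← Real.sqrt_eq_rpow, Real.sqrt_mul two_pos.le]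
  have : 0 < √Real.pi := Real.sqrt_pos.2 Real.pi_pos
  have h2 : √2 * √2 = (2 : ℝ) := Real.mul_self_sqrt two_pos.le
  have : 0 < √(2 : ℝ) := by positivity
  field_simp
  linarith

lemma lap_quadKernel_two : lap quadKernel 2 = 1 / (2 * Real.pi ^ 2) := by
  rw [lap_quadKernel two_pos, Real.Gamma_two, Real.rpow_neg (by positivity)]
  norm_cast
  field_simp

/-- Data carried by the theta function of a real primitive character of conductor `exp (2 q)`. -/
structure QuadTheta (a : ArithmeticFunction ℝ) (q : ℝ) (j : ℕ) (f : ℝ → ℝ) (W : ℝ) : Prop where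
  sign : W = 1 ∨ W = -1
  fe : FEq W f
  bdd : ExpBdd Set.univ f
  rep : Rep f a (thetaKernel j) q
  abs_le : ∀ n, |a n| ≤ 1
  pos : 0 < lap f 1

section
variable {a : ArithmeticFunction ℝ} {q : ℝ} {f : ℝ → ℝ} {W : ℝ} {j : ℕ}

lemma QuadTheta.absConvAt (h : QuadTheta a q j f W) {s : ℝ} (hs : 1 < s) : AbsConvAt a s :=
  absConvAt_of_bounded h.abs_le hs

lemma exists_quadTheta {N : ℕ} [NeZero N] (hN : 1 < N) {χ : DirichletCharacter ℂ N}
    (hχ : χ.IsPrimitive) (hq : χ.IsQuadratic) (h1 : χ ≠ 1)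
    (hj : (j = 0 ∧ χ.Even) ∨ (j = 1 ∧ χ.Odd)) :
    ∃ f W, QuadTheta (coef χ) (Real.log N / 2) j f W := by
  obtain ⟨f, W, hW, hfe, hrep⟩ := exists_theta hN hχ hq hj
  have hb := hfe.expBdd hW (hrep.expBdd (thetaKernel_expBdd j) fun s hs => absConvAt_coef χ hs)
  refine ⟨f, W, hW, hfe, hb, hrep, fun n => ?_, lap_one_pos hq h1 hrep hb⟩
  by_cases hn : n = 0
  · simp [hn]
  · rcases hq n with h | h | h <;> simp [coef, hn, h]

/-- Lower bound for `L(1, χ)` when `L(β, χ) ≥ 0`. -/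
lemma QuadTheta.lower_bound (h : QuadTheta a q 1 f W) (hnn : ∀ n, 0 ≤ (one' * a) n)
    (h1 : 1 ≤ (one' * a) 1) (h4 : 1 ≤ (one' * a) 4) {β : ℝ} (hβ : 1 / 2 < β) (hβ1 : β < 1)
    (hf : 0 ≤ lap f β) :
    β * (1 - β) * (5 / 4 * Real.exp (β * q) / Real.pi - 3 / 2 * √2 * Real.exp (q / 2)) ≤
      lap f 1 := by
  obtain ⟨f₀, hz, hr₀⟩ := exists_zetaLike
  have hrep := rep_conv hr₀ h.rep (thetaKernel_expBdd 0) (thetaKernel_expBdd 1)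
      (s := 2) (by norm_num) (absConvAt_one (by norm_num)) (h.absConvAt (by norm_num))
  have hlow := le_symE h.sign (hz.expBdd_conv h.bdd) quadKernel_expBdd quadKernel_nonneg
    ({1, 4} : Finset ℕ) (fun n => q - Real.log n) (fun x => ?_) (v := β - 1 / 2) (by linarith)
    (by linarith)
  · have hup := hz.symE_le h.bdd h.sign h.fe (v := β - 1 / 2) (by linarith) (by linarith)
      (by simpa using hf)
    rw [Finset.sum_pair (by norm_num)] at hlow
    simp only [Nat.cast_one, Real.log_one, sub_zero, Nat.cast_ofNat] at hlow
    rw [lap_quadKernel_half] at hlow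
    simp only [show (1 : ℝ) / 2 + (β - 1 / 2) = β by ring,
      show (1 : ℝ) / 2 - (β - 1 / 2) = 1 - β by ring] at hlow hup
    have hG := le_lap_quadKernel (s := β) (by linarith) hβ1.le
    have hpos : 0 < β * (1 - β) := mul_pos (by linarith) (by linarith)
    have e1 : Real.exp (1 / 2 * (q - Real.log 4)) = Real.exp (q / 2) / 2 := by
      rw [show 1 / 2 * (q - Real.log 4) = q / 2 - Real.log 4 / 2 by ring, Real.exp_sub,
        show Real.log 4 / 2 = Real.log 2 by
          rw [show (4 : ℝ) = 2 ^ 2 by norm_num, Real.log_pow]; ring, Real.exp_log two_pos]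
    have e2 : Real.exp (β * q) / 4 ≤ Real.exp (β * (q - Real.log 4)) := by
      have : Real.exp (β * q) / 4 = Real.exp (β * q - Real.log 4) := by
        rw [Real.exp_sub, Real.exp_log (by norm_num)]
      rw [this]
      refine Real.exp_le_exp.2 ?_
      have := Real.log_pos (show (1 : ℝ) < 4 by norm_num)
      nlinarith
    rw [e1, show 1 / 2 * q = q / 2 by ring] at hlow
    have hpi := Real.pi_pos
    have h5 : 5 / 4 * Real.exp (β * q) / Real.pi ≤
        (Real.exp (β * q) + Real.exp (β * (q - Real.log 4))) * lap quadKernel β := by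
      rw [div_eq_mul_one_div]
      refine mul_le_mul ?_ hG (by positivity) (by positivity)
      linarith
    have h6 := hlow.trans hup
    rw [le_div_iff₀ hpos] at h6
    refine le_trans ?_ h6
    rw [mul_comm]
    refine mul_le_mul_of_nonneg_right ?_ hpos.le
    linarith
  · have := hrep.sum_le hnn quadKernel_nonneg {1, 4} x
    rw [Finset.sum_pair (by norm_num)] at this ⊢
    simp only [Nat.cast_one, Real.log_one, sub_zero, Nat.cast_ofNat, neg_sub] at this ⊢
    rw [show x + 0 - (0 + q) = x + -q by ring, show x + Real.log 4 - (0 + q) =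
      x + (Real.log 4 - q) by ring] at this
    refine le_trans ?_ this
    have a1 := quadKernel_nonneg (x + -q)
    have a2 := quadKernel_nonneg (x + (Real.log 4 - q))
    refine add_le_add (le_mul_of_one_le_left a1 h1) (le_mul_of_one_le_left a2 h4)

lemma exp_neg_one_lt' : Real.exp (-1) < 0.36788 := by
  rw [Real.exp_neg, inv_lt_comm₀ (Real.exp_pos _) (by norm_num)]
  exact lt_trans (by norm_num) Real.exp_one_gt_d9

lemma mul_exp_neg_le (t : ℝ) : t * Real.exp (-t) ≤ 0.36788 := by
  have := Real.add_one_le_exp (t - 1)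
  have h1 : t * Real.exp (-t) ≤ Real.exp (t - 1) * Real.exp (-t) :=
    mul_le_mul_of_nonneg_right (by linarith) (Real.exp_nonneg _)
  rw [← Real.exp_add, show t - 1 + -t = -1 by ring] at h1
  linarith [exp_neg_one_lt']

lemma exp_neg_le_num : Real.exp (-2.8) ≤ 0.0609 := by
  rw [Real.exp_neg, inv_le_comm₀ (Real.exp_pos _) (by norm_num)]
  have h : Real.exp 2.8 ^ 5 = Real.exp 1 ^ 14 := by
    rw [← Real.exp_nat_mul, ← Real.exp_nat_mul]; norm_num
  refine le_of_pow_le_pow_left₀ (n := 5) (by norm_num) (Real.exp_nonneg _) ?_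
  rw [h]
  calc (0.0609⁻¹ : ℝ) ^ 5 ≤ 2.7182818283 ^ 14 := by norm_num
    _ ≤ _ := pow_le_pow_left₀ (by norm_num) Real.exp_one_gt_d9.le 14

lemma num_le_exp_neg : (0.8127 : ℝ) ≤ Real.exp (-0.20602) := by
  have := Real.one_sub_div_pow_le_exp_neg (n := 16) (t := 0.20602) (by norm_num)
  refine le_trans ?_ this
  norm_num

/-- A small value `L(1, χ)` forces a real zero close to `1`. -/
lemma QuadTheta.exists_zero (h : QuadTheta a q 1 f W) (hnn : ∀ n, 0 ≤ (one' * a) n)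
    (h1 : 1 ≤ (one' * a) 1) (h4 : 1 ≤ (one' * a) 4) {ε : ℝ} (hε : 0 < ε) (hε1 : 11.2 * ε ≤ 1)
    (ht : 1 ≤ 2 * q * ε)
    (hH : lap f 1 ≤ 0.655 * ε / Real.pi * Real.exp (q - 2 * q * ε)) :
    ∃ β, 1 - β < 1.12 * ε * Real.exp (-(2 * q * ε)) ∧ β < 1 ∧ lap f β = 0 := by
  set t := 2 * q * ε with hte
  set u := 1.12 * Real.exp (-t) with hu
  have hpi := Real.pi_pos
  have hu0 : 0 < u := by positivity
  have hu1 : u ≤ 1.12 * 0.36788 := by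
    have : Real.exp (-t) ≤ Real.exp (-1) := Real.exp_le_exp.2 (by linarith)
    have := exp_neg_one_lt'
    rw [hu]; linarith
  have hut : u * t ≤ 0.41204 := by
    have := mul_exp_neg_le t
    rw [hu]; linarith
  have hue : u * ε ≤ 0.0368 := by nlinarith
  have hue0 : 0 < u * ε := by positivity
  by_cases hneg : lap f (1 - u * ε) < 0
  · obtain ⟨β, hβ, hβ0⟩ := intermediate_value_Icc (by linarith : 1 - u * ε ≤ 1)
      (continuous_lap h.bdd).continuousOn (show (0 : ℝ) ∈ _ from ⟨hneg.le, h.pos.le⟩)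
    refine ⟨β, ?_, lt_of_le_of_ne hβ.2 ?_, hβ0⟩
    · have : β ≠ 1 - u * ε := by rintro rfl; linarith
      have := lt_of_le_of_ne hβ.1 this.symm
      rw [hu] at this
      linarith
    · rintro rfl
      linarith [h.pos]
  · exfalso
    have hq : 5.6 ≤ q := by
      by_contra hq
      push Not at hq
      nlinarith
    have hl := h.lower_bound hnn h1 h4 (β := 1 - u * ε) (by linarith) (by linarith) (not_lt.1 hneg)
    have hl2 := hl.trans hH
    have e1 : Real.exp ((1 - u * ε) * q) = Real.exp q * Real.exp (-(u * t / 2)) := by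
      rw [← Real.exp_add, hte]; ring_nf
    have e2 : Real.exp (q / 2) = Real.exp q * Real.exp (-(q / 2)) := by
      rw [← Real.exp_add]; ring_nf
    have e3 : Real.exp (q - t) = Real.exp q * Real.exp (-t) := by
      rw [← Real.exp_add, sub_eq_add_neg]
    have b1 : 0.8127 ≤ Real.exp (-(u * t / 2)) :=
      num_le_exp_neg.trans (Real.exp_le_exp.2 (by linarith))
    have b2 : Real.exp (-(q / 2)) ≤ 0.0609 :=
      (Real.exp_le_exp.2 (by norm_num at hq ⊢; linarith)).trans exp_neg_le_num
    have b3 : √2 ≤ 1.41422 := Real.sqrt_le_iff.2 ⟨by norm_num, by norm_num⟩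
    have b4 : Real.pi * √2 ≤ 3.141593 * 1.41422 :=
      mul_le_mul Real.pi_lt_d6.le b3 (Real.sqrt_nonneg _) (by norm_num)
    have b5 : Real.pi * √2 * Real.exp (-(q / 2)) ≤ 3.141593 * 1.41422 * 0.0609 :=
      mul_le_mul b4 b2 (Real.exp_nonneg _) (by norm_num)
    rw [e1, e2, e3] at hl2
    have hc : 0 < ε * Real.exp q * Real.exp (-t) / Real.pi := by positivity
    have hl3 : ε * Real.exp q * Real.exp (-t) / Real.pi * ((1 - u * ε) * 1.12 *
        (5 / 4 * Real.exp (-(u * t / 2)) - 3 / 2 * (Real.pi * √2 * Real.exp (-(q / 2))))) ≤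
        ε * Real.exp q * Real.exp (-t) / Real.pi * 0.655 := by
      refine le_trans (le_of_eq ?_) (hl2.trans (le_of_eq ?_))
      · rw [hu]; field_simp; ring
      · field_simp
    have hl4 := le_of_mul_le_mul_left hl3 hc
    have hb : 0.6098 ≤ 5 / 4 * Real.exp (-(u * t / 2)) -
        3 / 2 * (Real.pi * √2 * Real.exp (-(q / 2))) := by
      norm_num at b1 b5 ⊢; linarith
    have : (1 - 0.0368) * 1.12 * 0.6098 ≤ (1 - u * ε) * 1.12 *
        (5 / 4 * Real.exp (-(u * t / 2)) - 3 / 2 * (Real.pi * √2 * Real.exp (-(q / 2)))) := by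
      refine mul_le_mul ?_ hb (by norm_num) ?_ <;> linarith
    norm_num at this hl4
    linarith

end

section
open Real

lemma mul_exp_neg_antitone {x y : ℝ} (hx : 1 ≤ x) (hxy : x ≤ y) :
    y * exp (-y) ≤ x * exp (-x) := by
  have h := add_one_le_exp (y - x)
  have h1 : y ≤ x * exp (y - x) := by nlinarith
  calc y * exp (-y) ≤ x * exp (y - x) * exp (-y) := by gcongr
    _ = x * exp (-x) := by rw [mul_assoc, ← exp_add]; ring_nf

lemma mul_exp_neg_le_exp (t : ℝ) : t * exp (-t) ≤ exp (-1) := by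
  have := add_one_le_exp (t - 1)
  have h1 : t * exp (-t) ≤ exp (t - 1) * exp (-t) :=
    mul_le_mul_of_nonneg_right (by linarith) (exp_nonneg _)
  rwa [← exp_add, show t - 1 + -t = -1 by ring] at h1

lemma add_lt_two_of_le {r : ℝ} (hr : r ≤ 3.4) :
    1.12 * ((1 + r) * (exp (-1) + exp (-r))) < 2 := by
  have hd (x : ℝ) : HasDerivAt (fun r : ℝ => (1 + r) * (exp (-1) + exp (-r)))
      (exp (-1) - x * exp (-x)) x := by
    have h1 : HasDerivAt (fun r : ℝ => 1 + r) 1 x := (hasDerivAt_id x).const_add 1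
    have h2 : HasDerivAt (fun r : ℝ => exp (-1) + exp (-r)) (exp (-x) * -1) x :=
      ((hasDerivAt_neg x).exp).const_add _
    refine (h1.mul h2).congr_deriv ?_
    ring
  have hmono : Monotone (fun r : ℝ => (1 + r) * (exp (-1) + exp (-r))) :=
    monotone_of_deriv_nonneg (fun x => (hd x).differentiableAt) fun x => by
      rw [(hd x).deriv]; linarith [mul_exp_neg_le_exp x]
  have h := hmono hr
  have e1 := exp_neg_one_lt'
  have e2 : exp (-3.4) ≤ 0.0338 := by
    rw [exp_neg, inv_le_comm₀ (exp_pos _) (by norm_num)]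
    have h : exp 3.4 ^ 5 = exp 1 ^ 17 := by
      rw [← exp_nat_mul, ← exp_nat_mul]; norm_num
    refine le_of_pow_le_pow_left₀ (n := 5) (by norm_num) (exp_nonneg _) ?_
    rw [h]
    calc (0.0338⁻¹ : ℝ) ^ 5 ≤ 2.7182818283 ^ 17 := by norm_num
      _ ≤ _ := pow_le_pow_left₀ (by norm_num) exp_one_gt_d9.le 17
  simp only at h
  norm_num at h e1 e2 ⊢
  linarith

lemma two_le_add {x y : ℝ} (hy : 0 < y) (hxy : y < x) (h : x * exp (-x) ≤ y * exp (-y)) :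
    2 ≤ x + y := by
  by_contra hlt
  push Not at hlt
  have h1 := le_log_one_add_of_nonneg (x := x / y - 1)
    (by rw [sub_nonneg, le_div_iff₀ hy]; linarith)
  rw [show 1 + (x / y - 1) = x / y by ring, log_div (by linarith) hy.ne',
    show 2 * (x / y - 1) / (x / y - 1 + 2) = 2 * (x - y) / (x + y) by
      field_simp; ring] at h1
  have h2 : log x - x ≤ log y - y := by
    have := log_le_log (by have := hy.trans hxy; positivity) h
    rwa [log_mul (hy.trans hxy).ne' (exp_pos _).ne', log_mul hy.ne' (exp_pos _).ne', log_exp,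
      log_exp] at this
  have h3 : x - y < 2 * (x - y) / (x + y) := by
    rw [lt_div_iff₀ (by linarith)]
    nlinarith
  linarith

lemma tail_lt {r : ℝ} (hr : 3.4 < r) :
    2.24 * r * exp (-r) < 1.12 * exp (-1) * (1 + r) * exp (-(1.12 * exp (-1) * (1 + r))) := by
  set y := r - 1 - 1.12 * exp (-1) * (1 + r) with hy
  have e1 := exp_neg_one_lt'
  have hr' : (3.4 : ℝ) < r := hr
  norm_num at e1 hr'
  have hy1 : 0.587 + 0.5879 * (r - 3.4) ≤ y := by
    have : exp (-1) * (1 + r) ≤ 9197 / 25000 * (1 + r) := by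
      refine mul_le_mul_of_nonneg_right ?_ (by linarith)
      linarith
    norm_num [hy] at this ⊢
    linarith
  have h5 : (1.64 : ℝ) ≤ exp 0.5 := by
    refine le_of_pow_le_pow_left₀ (n := 2) (by norm_num) (exp_nonneg _) ?_
    rw [← exp_nat_mul]
    have := exp_one_gt_d9
    norm_num at this ⊢
    linarith
  have h6 : 1.64 * (1 + (y - 0.5)) ≤ exp y := by
    have := add_one_le_exp (y - 0.5)
    calc 1.64 * (1 + (y - 0.5)) ≤ exp 0.5 * exp (y - 0.5) := by
          refine mul_le_mul h5 (by linarith) ?_ (exp_nonneg _)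
          norm_num at hy1 ⊢; linarith
      _ = exp y := by rw [← exp_add]; ring_nf
  have h7 : 2 * r < (1 + r) * exp y := by
    have h8 : 1.64 * (1.087 + 0.5879 * (r - 3.4)) ≤ exp y := by
      norm_num at hy1 h6 ⊢; linarith
    have : (1 + r) * (1.64 * (1.087 + 0.5879 * (r - 3.4))) ≤ (1 + r) * exp y :=
      mul_le_mul_of_nonneg_left h8 (by linarith)
    norm_num at this ⊢
    nlinarith
  have h9 : exp y * exp (-r) = exp (-1) * exp (-(1.12 * exp (-1) * (1 + r))) := by
    rw [← exp_add, ← exp_add, hy]; ring_nf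
  have h10 := mul_lt_mul_of_pos_right h7 (exp_pos (-r))
  rw [mul_assoc (1 + r), h9] at h10
  norm_num at h10 ⊢
  linarith

/-- Two distinct zeros cannot both be very close to `1`, after rescaling. -/
lemma false_of_mul_exp_neg_le {p r x y : ℝ} (hp : 1 ≤ p) (hpr : p ≤ r)
    (hy : 0 < y) (hxy : y < x) (h : x * exp (-x) ≤ y * exp (-y))
    (hb : (x ≤ 1.12 * (p + r) * exp (-p) ∧ y ≤ 1.12 * (p + r) * exp (-r)) ∨
      (x ≤ 1.12 * (p + r) * exp (-r) ∧ y ≤ 1.12 * (p + r) * exp (-p))) : False := by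
  have h2 := two_le_add hy hxy h
  have e1 := exp_neg_one_lt'
  have hsum : x + y ≤ 1.12 * ((p + r) * (exp (-p) + exp (-r))) := by
    rcases hb with hb | hb <;> linarith [hb.1, hb.2]
  have hpe := mul_exp_neg_le_exp p
  have hmain : (p + r) * (exp (-p) + exp (-r)) ≤ (1 + r) * (exp (-1) + exp (-r)) := by
    have hd : exp (-p) * p ≤ exp (-1) := by linarith
    have h3 : (p - 1) * exp (-1) ≤ r * (exp (-1) - exp (-p)) := by
      have h4 : (p - 1) * exp (-1) ≤ p * (exp (-1) - exp (-p)) := by linarith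
      have h5 : 0 ≤ exp (-1) - exp (-p) := sub_nonneg.2 (exp_le_exp.2 (by linarith))
      nlinarith
    have h6 : (p - 1) * exp (-r) ≤ (p - 1) * exp (-1) :=
      mul_le_mul_of_nonneg_left (exp_le_exp.2 (by linarith)) (by linarith)
    nlinarith
  have hr : 3.4 < r := by
    by_contra hr
    have := add_lt_two_of_le (not_lt.1 hr)
    norm_num at this hsum
    linarith
  have hre := mul_exp_neg_le_exp r
  have hrb : 1.12 * (p + r) * exp (-r) ≤ 2.24 * r * exp (-r) := by
    refine mul_le_mul_of_nonneg_right ?_ (exp_nonneg _)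
    norm_num; linarith
  have hr1 : 2.24 * r * exp (-r) < 1 := by
    norm_num at e1 ⊢; linarith
  rcases hb with ⟨hx', hy'⟩ | ⟨hx', hy'⟩
  · have hx1 : x ≤ 1.12 * exp (-1) * (1 + r) := by
      have : r * exp (-p) ≤ r * exp (-1) :=
        mul_le_mul_of_nonneg_left (exp_le_exp.2 (by linarith)) (by linarith)
      norm_num at hx' ⊢
      linarith
    have h7 := mul_exp_neg_antitone (by linarith) hx1
    have h8 : y * exp (-y) ≤ y := mul_le_of_le_one_right hy.le (exp_le_one_iff.2 (by linarith))
    have h9 := tail_lt hr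
    linarith
  · linarith

end

section
variable {f g : ℝ → ℝ} {I : Set ℝ}

lemma convexOn_lap (hI : IsOpen I) (hc : Convex ℝ I) (hf : ExpBdd I f) (h0 : ∀ x, 0 ≤ f x) :
    ConvexOn ℝ I (lap f) := by
  refine ⟨hc, fun s hs t ht a b ha hb hab => ?_⟩
  simp only [lap, smul_eq_mul]
  rw [← integral_const_mul, ← integral_const_mul, ← integral_add
    ((hf.integrable hI hs).const_mul a) ((hf.integrable hI ht).const_mul b)]
  refine integral_mono (hf.integrable hI (hc hs ht ha hb hab))
    (((hf.integrable hI hs).const_mul a).add ((hf.integrable hI ht).const_mul b)) fun x => ?_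
  have := convexOn_exp.2 (Set.mem_univ (s * x)) (Set.mem_univ (t * x)) ha hb hab
  simp only [smul_eq_mul] at this
  have h2 := mul_le_mul_of_nonneg_left this (h0 x)
  simp only
  rw [show (a * s + b * t) * x = a * (s * x) + b * (t * x) by ring]
  linarith

lemma locallyLipschitz_lap (hf : ExpBdd Set.univ f) : LocallyLipschitz (lap f) := by
  have hp : ExpBdd Set.univ fun x => max (f x) 0 :=
    ⟨hf.meas.max measurable_const, fun a ha => by
      obtain ⟨C, hC⟩ := hf.bound a ha
      refine ⟨C, fun x => le_trans ?_ (hC x)⟩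
      rw [abs_of_nonneg (le_max_right _ _)]
      exact max_le (le_abs_self _) (abs_nonneg _)⟩
  have hn : ExpBdd Set.univ fun x => max (-f x) 0 :=
    ⟨hf.meas.neg.max measurable_const, fun a ha => by
      obtain ⟨C, hC⟩ := hf.bound a ha
      refine ⟨C, fun x => le_trans ?_ (hC x)⟩
      rw [abs_of_nonneg (le_max_right _ _)]
      exact max_le (neg_le_abs _) (abs_nonneg _)⟩
  have e : lap f = lap (fun x => max (f x) 0) - lap (fun x => max (-f x) 0) := by
    funext s
    rw [Pi.sub_apply, lap, lap, lap, ← integral_sub (hp.integrable isOpen_univ (Set.mem_univ s))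
      (hn.integrable isOpen_univ (Set.mem_univ s))]
    congr 1
    funext x
    rw [← sub_mul]
    congr 1
    rcases le_total 0 (f x) with h | h
    · rw [max_eq_left h, max_eq_right (by linarith)]; ring
    · rw [max_eq_right h, max_eq_left (by linarith)]; ring
  rw [e]
  exact (convexOn_lap isOpen_univ convex_univ hp fun x => le_max_right _ _).locallyLipschitz.sub
    (convexOn_lap isOpen_univ convex_univ hn fun x => le_max_right _ _).locallyLipschitz

lemma ZetaLike.continuousOn_lap (hf : ZetaLike f) :
    ContinuousOn (lap fun x => f x - Real.exp (-x)) (Set.Ioo 0 1) := by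
  have h : ExpBdd (Set.Ioo 0 1) fun x => -(f x - Real.exp (-x)) :=
    ⟨hf.sub_exp.meas.neg, fun a ha => by simpa only [abs_neg] using hf.sub_exp.bound a ha⟩
  have hc := (convexOn_lap isOpen_Ioo (convex_Ioo 0 1) h
    fun x => by linarith [hf.le x]).continuousOn isOpen_Ioo
  refine hc.neg.congr fun s _ => ?_
  simp only [lap, Pi.neg_apply, neg_mul, integral_neg, neg_neg]

end

/-- The kernel whose Laplace transform is the square of that of `quadKernel`. -/
noncomputable def biquadKernel : ℝ → ℝ :=
  conv (thetaKernel 0) (conv (thetaKernel 1) (conv (thetaKernel 1) (thetaKernel 0)))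

lemma biquadKernel_expBdd : ExpBdd (Set.Ioi 0) biquadKernel :=
  (thetaKernel_expBdd 0).conv isOpen_Ioi ((thetaKernel_expBdd 1).conv isOpen_Ioi
    ((thetaKernel_expBdd 1).conv isOpen_Ioi (thetaKernel_expBdd 0)))

lemma biquadKernel_nonneg (x : ℝ) : 0 ≤ biquadKernel x :=
  conv_nonneg (thetaKernel_nonneg 0) (conv_nonneg (thetaKernel_nonneg 1)
    (conv_nonneg (thetaKernel_nonneg 1) (thetaKernel_nonneg 0))) x

lemma lap_biquadKernel {s : ℝ} (hs : 0 < s) : lap biquadKernel s = lap quadKernel s ^ 2 := by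
  have h0 := thetaKernel_expBdd 0
  have h1 := thetaKernel_expBdd 1
  have hs' : s ∈ Set.Ioi (0 : ℝ) := hs
  have h10 := h1.conv isOpen_Ioi h0
  rw [biquadKernel, lap_conv isOpen_Ioi h0 (h1.conv isOpen_Ioi h10) hs', lap_conv isOpen_Ioi h1 h10 hs',
    lap_conv isOpen_Ioi h1 h0 hs', quadKernel, lap_conv isOpen_Ioi h0 h1 hs']
  ring

/-- Data carried by the completed biquadratic zeta function, with `f₀` the zeta part. -/
structure BiquadTheta (b : ArithmeticFunction ℝ) (q : ℝ) (f₀ g : ℝ → ℝ) (W : ℝ) : Prop where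
  zeta : ZetaLike f₀
  sign : W = 1 ∨ W = -1
  fe : FEq W g
  bdd : ExpBdd Set.univ g
  rep : Rep (conv f₀ g) b biquadKernel q
  nonneg : ∀ n, 0 ≤ b n
  one_le : 1 ≤ b 1
  pos : 0 < lap g 1
  lap_two : lap (conv f₀ g) 2 ≤ Real.exp (2 * q) * (Real.pi ^ 4 / 5184)

section
variable {b : ArithmeticFunction ℝ} {q W : ℝ} {f₀ g : ℝ → ℝ}

lemma BiquadTheta.conv_nonneg (h : BiquadTheta b q f₀ g W) (x : ℝ) : 0 ≤ conv f₀ g x :=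
  h.rep.nonneg h.nonneg biquadKernel_nonneg x

lemma BiquadTheta.le_symE (h : BiquadTheta b q f₀ g W) {β : ℝ} (hβ : 1 / 2 < β) (hβ1 : β ≤ 1) :
    Real.exp (β * q) / Real.pi ^ 2 - 2 * Real.exp (q / 2) ≤ symE W (conv f₀ g) (β - 1 / 2) := by
  have hlow := SiegelTatuzawa.le_symE h.sign (h.zeta.expBdd_conv h.bdd) biquadKernel_expBdd
    biquadKernel_nonneg ({1} : Finset ℕ) (fun _ => q) (fun x => ?_) (v := β - 1 / 2) (by linarith)
    (by linarith)
  · rw [Finset.sum_singleton, show 1 / 2 + (β - 1 / 2) = β by ring, lap_biquadKernel (by linarith),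
      lap_biquadKernel (by norm_num), lap_quadKernel_half, Real.sq_sqrt two_pos.le,
      show 1 / 2 * q = q / 2 by ring] at hlow
    have hpi := Real.pi_pos
    have h1 : (1 / Real.pi) ^ 2 ≤ lap quadKernel β ^ 2 :=
      pow_le_pow_left₀ (by positivity) (le_lap_quadKernel (by linarith) hβ1) 2
    have h2 := mul_le_mul_of_nonneg_left h1 (Real.exp_nonneg (β * q))
    rw [div_pow, one_pow, mul_one_div] at h2
    linarith
  · have := h.rep.sum_le h.nonneg biquadKernel_nonneg {1} x
    rw [Finset.sum_singleton] at this ⊢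
    refine le_trans ?_ this
    rw [Nat.cast_one, Real.log_one, add_zero, sub_eq_add_neg]
    exact le_mul_of_one_le_left (biquadKernel_nonneg _) h.one_le

lemma BiquadTheta.symE_le (h : BiquadTheta b q f₀ g W) :
    symE W (conv f₀ g) (3 / 2) ≤ Real.exp (2 * q) * (Real.pi ^ 4 / 5184) := by
  refine le_trans ?_ h.lap_two
  have h1 := h.zeta.lap_conv_eq_symE h.bdd h.sign h.fe (v := 3 / 2) (by norm_num)
  rw [show (1 : ℝ) / 2 + 3 / 2 = 2 by norm_num] at h1
  rw [h1]
  have h2 : (1 : ℝ) ≤ signFactor W (3 / 2) := by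
    unfold signFactor; split_ifs <;> norm_num
  have h3 := symE_nonneg h.sign h.conv_nonneg (v := 3 / 2) (by norm_num)
  have h4 := h.pos
  have h5 : 0 ≤ lap g 1 / ((3 / 2 + 1 / 2) * (3 / 2 - 1 / 2)) := div_nonneg h4.le (by norm_num)
  nlinarith

lemma exp_neg_le_num' : Real.exp (-5.187) ≤ 0.00561 := by
  rw [Real.exp_neg, inv_le_comm₀ (Real.exp_pos _) (by norm_num)]
  have h : Real.exp 5.187 = Real.exp 1 ^ 5 * Real.exp 0.187 := by
    rw [← Real.exp_nat_mul, ← Real.exp_add]; norm_num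
  rw [h]
  have h1 : (1.203 : ℝ) ≤ Real.exp 0.187 := by
    have := Real.quadratic_le_exp_of_nonneg (x := 0.187) (by norm_num)
    norm_num at this ⊢; linarith
  calc (0.00561⁻¹ : ℝ) ≤ 2.7182818283 ^ 5 * 1.203 := by norm_num
    _ ≤ _ := mul_le_mul (pow_le_pow_left₀ (by norm_num) Real.exp_one_gt_d9.le 5) h1 (by norm_num)
      (by positivity)

lemma num_le_exp_neg' : (0.2094 : ℝ) ≤ Real.exp (-1.5552) := by
  have h := Real.one_sub_div_pow_le_exp_neg (n := 256) (t := 1.5552) (by norm_num)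
  refine le_trans ?_ h
  norm_num

lemma BiquadTheta.symE_main (h : BiquadTheta b q f₀ g W) (hq : 11.2 ≤ q) {β : ℝ}
    (hβ : 0.9632 ≤ β) (hβ1 : β < 1) :
    0.886 * (Real.exp (β * q) / Real.pi ^ 2) ≤ symE W (conv f₀ g) (β - 1 / 2) := by
  have hq' : (56 / 5 : ℝ) ≤ q := by norm_num at hq; exact hq
  have hβ' : (0.9632 : ℝ) ≤ β := hβ
  norm_num at hβ'
  have h1 := h.le_symE (β := β) (by linarith) hβ1.le
  have hpi := Real.pi_pos
  refine le_trans ?_ h1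
  have e : Real.exp (q / 2) = Real.exp (β * q) * Real.exp (-((β - 1 / 2) * q)) := by
    rw [← Real.exp_add]; ring_nf
  have h2 : Real.exp (-((β - 1 / 2) * q)) ≤ 0.00561 := by
    refine le_trans (Real.exp_le_exp.2 ?_) exp_neg_le_num'
    norm_num
    nlinarith
  have h3 : Real.pi ^ 2 ≤ 9.8697 := by
    calc Real.pi ^ 2 ≤ 3.141593 ^ 2 := pow_le_pow_left₀ hpi.le Real.pi_lt_d6.le 2
      _ ≤ _ := by norm_num
  have h4 : Real.pi ^ 2 * Real.exp (-((β - 1 / 2) * q)) ≤ 9.8697 * 0.00561 :=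
    mul_le_mul h3 h2 (Real.exp_nonneg _) (by norm_num)
  rw [e]
  have h5 : Real.exp (β * q) / Real.pi ^ 2 -
      2 * (Real.exp (β * q) * Real.exp (-((β - 1 / 2) * q))) = (Real.exp (β * q) / Real.pi ^ 2) *
      (1 - 2 * (Real.pi ^ 2 * Real.exp (-((β - 1 / 2) * q)))) := by field_simp
  rw [h5, mul_comm]
  refine mul_le_mul_of_nonneg_left ?_ (by positivity)
  norm_num at h4 ⊢
  linarith

lemma BiquadTheta.symE_lower (h : BiquadTheta b q f₀ g W) (hq : 11.2 ≤ q) {β s : ℝ}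
    (hβ : 0.9632 ≤ β) (hβ1 : β < 1) (hs : 1 / 2 < s) (hsβ : s ≤ β) :
    symE W (conv f₀ g) (β - 1 / 2) * Real.exp (-((q - 1.5) * (β - s))) ≤
      symE W (conv f₀ g) (s - 1 / 2) := by
  have hmain := h.symE_main hq hβ hβ1
  have hpi := Real.pi_pos
  have hE : 0 < symE W (conv f₀ g) (β - 1 / 2) := lt_of_lt_of_le (by positivity) hmain
  have hU : 0 < Real.exp (2 * q) * (Real.pi ^ 4 / 5184) := by positivity
  have := SiegelTatuzawa.symE_lower h.sign (h.zeta.expBdd_conv h.bdd) h.conv_nonneg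
    (v := s - 1 / 2) (w := β - 1 / 2) (z := 3 / 2) (by linarith) (by linarith) (by linarith)
    hE hU h.symE_le
  refine le_trans ?_ this
  refine mul_le_mul_of_nonneg_left (Real.exp_le_exp.2 ?_) hE.le
  rw [show β - 1 / 2 - (s - 1 / 2) = β - s by ring, show 3 / 2 - (β - 1 / 2) = 2 - β by ring,
    neg_mul]
  refine neg_le_neg (mul_le_mul_of_nonneg_right ?_ (by linarith))
  have h2β : 0 < 2 - β := by linarith
  rw [div_le_iff₀ h2β, Real.log_le_iff_le_exp (by positivity), div_le_iff₀ hE]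
  refine le_trans ?_ (mul_le_mul_of_nonneg_left hmain (Real.exp_nonneg _))
  have e : Real.exp ((q - 1.5) * (2 - β)) * (0.886 * (Real.exp (β * q) / Real.pi ^ 2)) =
      Real.exp (2 * q) * (0.886 / Real.pi ^ 2 * Real.exp (-(1.5 * (2 - β)))) := by
    rw [show (q - 1.5) * (2 - β) = 2 * q - β * q + -(1.5 * (2 - β)) by ring, Real.exp_add,
      Real.exp_sub]
    field_simp
  rw [e]
  refine mul_le_mul_of_nonneg_left ?_ (Real.exp_nonneg _)
  have h1 : 0.2094 ≤ Real.exp (-(1.5 * (2 - β))) := by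
    refine num_le_exp_neg'.trans (Real.exp_le_exp.2 ?_)
    norm_num at hβ ⊢
    linarith
  have h2 : Real.pi ^ 6 ≤ 961.391 := by
    calc Real.pi ^ 6 ≤ 3.141593 ^ 6 := pow_le_pow_left₀ hpi.le Real.pi_lt_d6.le 6
      _ ≤ _ := by norm_num
  rw [div_mul_eq_mul_div, le_div_iff₀ (by positivity)]
  calc Real.pi ^ 4 / 5184 * Real.pi ^ 2 = Real.pi ^ 6 / 5184 := by ring
    _ ≤ 0.886 * 0.2094 := by norm_num at h2 ⊢; linarith
    _ ≤ _ := mul_le_mul_of_nonneg_left h1 (by norm_num)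

/-- Repulsion between two distinct zeros. -/
lemma BiquadTheta.repel (h : BiquadTheta b q f₀ g W) (hq : 11.2 ≤ q) {β β' : ℝ}
    (hβ' : 0.9632 ≤ β') (hββ : β' < β) (hβ1 : β < 1) (h0 : lap g β = 0) (h0' : lap g β' = 0) :
    (1 - β') * Real.exp (-(q * (β - β'))) ≤ 1 - β := by
  have hb : (602 / 625 : ℝ) ≤ β' := by norm_num at hβ'; exact hβ'
  have h1 := h.symE_lower hq (hβ'.trans hββ.le) hβ1 (by linarith) hββ.le
  have e1 := h.zeta.symE_eq h.bdd h.sign h.fe (v := β - 1 / 2) (by linarith) (by linarith)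
    (by simpa using h0)
  have e2 := h.zeta.symE_eq h.bdd h.sign h.fe (v := β' - 1 / 2) (by linarith) (by linarith)
    (by simpa using h0')
  rw [show 1 / 2 + (β - 1 / 2) = β by ring, show 1 / 2 - (β - 1 / 2) = 1 - β by ring] at e1
  rw [show 1 / 2 + (β' - 1 / 2) = β' by ring, show 1 / 2 - (β' - 1 / 2) = 1 - β' by ring] at e2
  rw [e1, e2] at h1
  have hp := h.pos
  have d1 : 0 < 1 - β := by linarith
  have d2 : 0 < 1 - β' := by linarith
  have b1 : 0 < β := by linarith
  have b2 : 0 < β' := by linarith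
  have h2 : β' * (1 - β') * Real.exp (-((q - 1.5) * (β - β'))) ≤ β * (1 - β) := by
    rw [div_mul_eq_mul_div, div_le_div_iff₀ (by positivity) (by positivity)] at h1
    have h3 : lap g 1 * (β' * (1 - β') * Real.exp (-((q - 1.5) * (β - β')))) ≤
      lap g 1 * (β * (1 - β)) := by linarith
    exact le_of_mul_le_mul_left h3 hp
  have h4 : β ≤ β' * Real.exp (1.5 * (β - β')) := by
    have := Real.add_one_le_exp (1.5 * (β - β'))
    have h5 : β' * (1.5 * (β - β') + 1) ≤ β' * Real.exp (1.5 * (β - β')) :=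
      mul_le_mul_of_nonneg_left this b2.le
    refine le_trans ?_ h5
    norm_num
    nlinarith
  have h6 := h2.trans (mul_le_mul_of_nonneg_right h4 d1.le)
  have h7 : (1 - β') * Real.exp (-((q - 1.5) * (β - β'))) ≤
      Real.exp (1.5 * (β - β')) * (1 - β) := by
    refine le_of_mul_le_mul_left ?_ b2
    linarith
  have h8 : Real.exp (-((q - 1.5) * (β - β'))) =
      Real.exp (1.5 * (β - β')) * Real.exp (-(q * (β - β'))) := by
    rw [← Real.exp_add]; ring_nf
  rw [h8] at h7
  refine le_of_mul_le_mul_left ?_ (Real.exp_pos (1.5 * (β - β')))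
  linarith

/-- A double zero is far from `1`. -/
lemma BiquadTheta.double_zero (h : BiquadTheta b q f₀ g W) (hq : 11.2 ≤ q) {β : ℝ}
    (hβ : 0.9632 ≤ β) (hβ1 : β < 1) {F G : ℝ → ℝ} (hFG : ∀ s, lap g s = F s * G s)
    (hF : LocallyLipschitz F) (hG : Continuous G) (hF0 : F β = 0) (hG0 : G β = 0) :
    1 / (1 - β) ≤ 1 / β + (q - 1.5) := by
  have hb : (602 / 625 : ℝ) ≤ β := by norm_num at hβ; exact hβ
  obtain ⟨C, t, ht, hC⟩ := hF β
  have hp := h.pos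
  set κ := lap g 1 with hκ
  set lam := q - 1.5 with hlam
  set H := lap (fun x => f₀ x - Real.exp (-x)) with hH
  have hd : 0 < 1 - β := by linarith
  have hb0 : 0 < β := by linarith
  set A := 1 / (1 - β) - 1 / β with hA
  set B := -(1 / (β * (1 - β))) with hB
  set P : ℝ → ℝ := fun η => A - lam + (B - lam * A) * η - lam * B * η ^ 2 with hP
  have hs : Tendsto (fun η : ℝ => β - η) (𝓝[>] 0) (𝓝 β) := by
    have : Tendsto (fun η : ℝ => β - η) (𝓝 0) (𝓝 (β - 0)) :=
      (by fun_prop : Continuous fun η : ℝ => β - η).tendsto 0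
    rw [sub_zero] at this
    exact this.mono_left nhdsWithin_le_nhds
  have hPlim : Tendsto (fun η => κ * P η) (𝓝[>] 0) (𝓝 (κ * (A - lam))) := by
    have : Tendsto (fun η => κ * P η) (𝓝 0) (𝓝 (κ * P 0)) :=
      (by fun_prop : Continuous fun η => κ * P η).tendsto 0
    have h2 := this.mono_left (nhdsWithin_le_nhds (s := Set.Ioi 0))
    simpa [hP] using h2
  have hSF : Continuous fun s => signFactor W (s - 1 / 2) := by
    unfold signFactor; split_ifs <;> fun_prop
  have hSF0 : signFactor W (β - 1 / 2) ≠ 0 := (signFactor_pos (by linarith)).ne'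
  have hR : ContinuousAt (fun s => C * |s * (1 - s) / signFactor W (s - 1 / 2) * H s * G s|) β := by
    have h1 : ContinuousAt H β :=
      h.zeta.continuousOn_lap.continuousAt (Ioo_mem_nhds hb0 hβ1)
    have h2 : ContinuousAt (fun s : ℝ => s * (1 - s) / signFactor W (s - 1 / 2)) β :=
      ContinuousAt.div (by fun_prop) hSF.continuousAt hSF0
    exact continuousAt_const.mul ((h2.mul h1).mul hG.continuousAt).abs
  have hRlim : Tendsto (fun η => C * |(β - η) * (1 - (β - η)) / signFactor W (β - η - 1 / 2) *
      H (β - η) * G (β - η)|) (𝓝[>] 0) (𝓝 0) := by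
    have := hR.tendsto.comp hs
    simp only [hG0, mul_zero, abs_zero] at this
    exact this
  have hle : κ * (A - lam) ≤ 0 := by
    refine le_of_tendsto_of_tendsto hPlim hRlim ?_
    have ev1 : ∀ᶠ η in 𝓝[>] (0 : ℝ), β - η ∈ t := hs ht
    have ev2 : ∀ᶠ η in 𝓝[>] (0 : ℝ), 1 / 2 < β - η := hs (Ioi_mem_nhds (by linarith))
    filter_upwards [ev1, ev2, self_mem_nhdsWithin] with η hη1 hη2 hη
    have hη : 0 < η := hη
    set s := β - η with hsdef
    have hs1 : 0 < 1 - s := by linarith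
    have hs0 : 0 < s := by linarith
    have h1 := h.symE_lower hq hβ hβ1 hη2 (by linarith)
    have e1 := h.zeta.symE_eq h.bdd h.sign h.fe (v := β - 1 / 2) (by linarith) (by linarith)
      (by simp [hFG, hF0])
    have e2 := h.zeta.lap_mul_eq_symE h.bdd h.sign h.fe (v := s - 1 / 2) (by linarith)
      (by linarith)
    rw [show 1 / 2 + (β - 1 / 2) = β by ring, show 1 / 2 - (β - 1 / 2) = 1 - β by ring] at e1
    rw [show 1 / 2 + (s - 1 / 2) = s by ring, show 1 / 2 - (s - 1 / 2) = 1 - s by ring] at e2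
    have hsf := signFactor_pos (W := W) (v := s - 1 / 2) (by linarith)
    have e3 : s * (1 - s) * symE W (conv f₀ g) (s - 1 / 2) - κ =
        F s * (s * (1 - s) / signFactor W (s - 1 / 2) * H s * G s) := by
      have : symE W (conv f₀ g) (s - 1 / 2) =
          H s * lap g s / signFactor W (s - 1 / 2) + κ / (s * (1 - s)) := by
        rw [hH, e2, mul_div_cancel_left₀ _ hsf.ne', sub_add_cancel]
      rw [this, hFG]
      field_simp
      ring
    have h2 : κ * (η * P η) ≤ s * (1 - s) * symE W (conv f₀ g) (s - 1 / 2) - κ := by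
      rw [e1] at h1
      have h3 := Real.add_one_le_exp (-(lam * (β - s)))
      have h4 : κ / (β * (1 - β)) * (1 - lam * η) ≤ symE W (conv f₀ g) (s - 1 / 2) := by
        refine le_trans (mul_le_mul_of_nonneg_left ?_ (by positivity)) h1
        rw [hsdef] at h3
        rw [hsdef]
        refine le_trans (le_of_eq ?_) h3
        ring
      have h5 := mul_le_mul_of_nonneg_left h4 (mul_pos hs0 hs1).le
      refine le_trans (le_of_eq ?_) (sub_le_sub_right h5 κ)
      rw [hP, hA, hB, hsdef]
      field_simp
      ring
    have h6 : |F s| ≤ C * η := by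
      have := hC.dist_le_mul s hη1 β (mem_of_mem_nhds ht)
      rw [Real.dist_eq, Real.dist_eq, hF0, sub_zero] at this
      rwa [hsdef, show β - η - β = -η by ring, abs_neg, abs_of_pos hη, ← hsdef] at this
    rw [e3] at h2
    have h7 := (h2.trans (le_abs_self _))
    rw [abs_mul] at h7
    have h8 := h7.trans (mul_le_mul_of_nonneg_right h6 (abs_nonneg _))
    refine le_of_mul_le_mul_left ?_ hη
    linarith
  have := nonpos_of_mul_nonpos_right hle hp
  rw [hA] at this
  linarith

end

lemma abs_lap_two_le {a : ArithmeticFunction ℝ} {f k : ℝ → ℝ} {q : ℝ} (h : Rep f a k q)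
    (hk : ExpBdd (Set.Ioi 0) k) (ha : ∀ n, |a n| ≤ 1) (hk2 : 0 ≤ lap k 2) :
    |lap f 2| ≤ Real.exp (2 * q) * lap k 2 * (Real.pi ^ 2 / 6) := by
  have h1 := rep_lap h hk two_pos (absConvAt_of_bounded ha (by norm_num))
  have h2 := hasSum_zeta_two.mul_right (Real.exp (2 * q) * lap k 2)
  have h3 (n : ℕ) : |a n * Real.exp (-2 * Real.log n) * (Real.exp (2 * q) * lap k 2)| ≤
      1 / (n : ℝ) ^ 2 * (Real.exp (2 * q) * lap k 2) := by
    have hnn : 0 ≤ Real.exp (2 * q) * lap k 2 := by positivity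
    rw [abs_mul, abs_of_nonneg hnn]
    refine mul_le_mul_of_nonneg_right ?_ hnn
    rcases eq_or_ne n 0 with rfl | hn
    · simp
    have e : Real.exp (-2 * Real.log n) = 1 / (n : ℝ) ^ 2 := by
      rw [neg_mul, Real.exp_neg, one_div, show 2 * Real.log n = Real.log ((n : ℝ) ^ 2) by
        rw [Real.log_pow]; norm_num, Real.exp_log (by positivity)]
    rw [abs_mul, e, abs_of_nonneg (by positivity : (0 : ℝ) ≤ 1 / (n : ℝ) ^ 2)]
    exact mul_le_of_le_one_left (by positivity) (ha n)
  rw [mul_comm, abs_le]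
  refine ⟨?_, hasSum_le (fun n => (le_abs_self _).trans (h3 n)) h1 h2⟩
  have := hasSum_le (fun n => (neg_le_abs _).trans (h3 n)) h1.neg h2
  linarith

lemma abs_one'_le (n : ℕ) : |one' n| ≤ 1 := by
  by_cases h : n = 0 <;> simp [one', h]

section
variable {a₁ a₂ a₃ : ArithmeticFunction ℝ} {q₁ q₂ q₃ W₁ W₂ W₃ : ℝ} {f₁ f₂ f₃ : ℝ → ℝ}

lemma exists_biquadTheta (h₁ : QuadTheta a₁ q₁ 1 f₁ W₁) (h₂ : QuadTheta a₂ q₂ 1 f₂ W₂)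
    (h₃ : QuadTheta a₃ q₃ 0 f₃ W₃) (hnn : ∀ n, 0 ≤ (one' * (a₁ * (a₂ * a₃))) n)
    (h1 : 1 ≤ (one' * (a₁ * (a₂ * a₃))) 1) :
    ∃ f₀, BiquadTheta (one' * (a₁ * (a₂ * a₃))) (q₁ + (q₂ + q₃)) f₀ (conv f₁ (conv f₂ f₃))
      (W₁ * (W₂ * W₃)) := by
  obtain ⟨f₀, hz, hr₀⟩ := exists_zetaLike
  have hb23 := h₂.bdd.conv isOpen_univ h₃.bdd
  have hb := h₁.bdd.conv isOpen_univ hb23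
  have hlap (s : ℝ) : lap (conv f₁ (conv f₂ f₃)) s = lap f₁ s * (lap f₂ s * lap f₃ s) := by
    rw [lap_conv isOpen_univ h₁.bdd hb23 (Set.mem_univ s),
      lap_conv isOpen_univ h₂.bdd h₃.bdd (Set.mem_univ s)]
  have k0 := thetaKernel_expBdd 0
  have k1 := thetaKernel_expBdd 1
  have k10 := k1.conv isOpen_Ioi k0
  have c2 {a q j f W} (h : QuadTheta a q j f W) : AbsConvAt a 2 := h.absConvAt (by norm_num)
  have hr := rep_conv hr₀ (rep_conv h₁.rep (rep_conv h₂.rep h₃.rep k1 k0 two_pos (c2 h₂) (c2 h₃))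
    k1 k10 two_pos (c2 h₁) ((c2 h₂).mul (c2 h₃))) k0 (k1.conv isOpen_Ioi k10) two_pos
    (absConvAt_one (by norm_num)) ((c2 h₁).mul ((c2 h₂).mul (c2 h₃)))
  rw [zero_add] at hr
  refine ⟨f₀, hz, ?_, h₁.fe.conv (h₂.fe.conv h₃.fe), hb, hr, hnn, h1, ?_, ?_⟩
  · rcases h₁.sign with rfl | rfl <;> rcases h₂.sign with rfl | rfl <;>
      rcases h₃.sign with rfl | rfl <;> norm_num
  · rw [hlap]
    exact mul_pos h₁.pos (mul_pos h₂.pos h₃.pos)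
  · rw [lap_conv isOpen_Ioi hz.bdd (hb.mono (Set.subset_univ _)) (by norm_num), hlap]
    have hl0 := (lap_thetaKernel_pos 0 two_pos).le
    have hl1 := (lap_thetaKernel_pos 1 two_pos).le
    have b0 := abs_lap_two_le hr₀ k0 abs_one'_le hl0
    have b1 := abs_lap_two_le h₁.rep k1 h₁.abs_le hl1
    have b2 := abs_lap_two_le h₂.rep k1 h₂.abs_le hl1
    have b3 := abs_lap_two_le h₃.rep k0 h₃.abs_le hl0
    refine (le_abs_self _).trans ?_
    rw [abs_mul, abs_mul, abs_mul]
    refine (mul_le_mul b0 (mul_le_mul b1 (mul_le_mul b2 b3 (abs_nonneg _) (by positivity))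
      (by positivity) (by positivity)) (by positivity) (by positivity)).trans (le_of_eq ?_)
    have hq : lap (thetaKernel 0) 2 * lap (thetaKernel 1) 2 = 1 / (2 * Real.pi ^ 2) := by
      rw [← lap_quadKernel_two, quadKernel, lap_conv isOpen_Ioi k0 k1 (by norm_num)]
    have hpi := Real.pi_pos
    calc _ = Real.exp (2 * 0) * Real.exp (2 * q₁) * Real.exp (2 * q₂) * Real.exp (2 * q₃) *
        (lap (thetaKernel 0) 2 * lap (thetaKernel 1) 2) ^ 2 * (Real.pi ^ 2 / 6) ^ 4 := by ring
      _ = Real.exp (2 * (q₁ + (q₂ + q₃))) * (1 / (2 * Real.pi ^ 2)) ^ 2 *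
          (Real.pi ^ 2 / 6) ^ 4 := by
        rw [hq, ← Real.exp_add, ← Real.exp_add, ← Real.exp_add]; ring_nf
      _ = _ := by field_simp; norm_num

lemma BiquadTheta.false_of_distinct {b : ArithmeticFunction ℝ} {q W : ℝ} {f₀ g : ℝ → ℝ}
    (h : BiquadTheta b q f₀ g W) (hq : 11.2 ≤ q) {t t' L ε β β' : ℝ} (ht : 1 ≤ t) (ht' : 1 ≤ t')
    (hL : L * ε = t + t') (hqL : q ≤ L)
    (hβ : 1 - β < 1.12 * ε * Real.exp (-t)) (hβ' : 1 - β' < 1.12 * ε * Real.exp (-t'))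
    (hlow : 0.9632 ≤ β') (hββ : β' < β) (hβ1 : β < 1) (h0 : lap g β = 0) (h0' : lap g β' = 0) :
    False := by
  have hrep := h.repel hq hlow hββ hβ1 h0 h0'
  have hL0 : 0 < L := by norm_num at hq; linarith
  have hx : L * (1 - β') ≤ 1.12 * (t + t') * Real.exp (-t') := by
    have := mul_le_mul_of_nonneg_left hβ'.le hL0.le
    refine this.trans (le_of_eq ?_)
    rw [← hL]; ring
  have hy : L * (1 - β) ≤ 1.12 * (t + t') * Real.exp (-t) := by
    have := mul_le_mul_of_nonneg_left hβ.le hL0.le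
    refine this.trans (le_of_eq ?_)
    rw [← hL]; ring
  have hxy : L * (1 - β) < L * (1 - β') := mul_lt_mul_of_pos_left (by linarith) hL0
  have hy0 : 0 < L * (1 - β) := mul_pos hL0 (by linarith)
  have hmain : L * (1 - β') * Real.exp (-(L * (1 - β'))) ≤
      L * (1 - β) * Real.exp (-(L * (1 - β))) := by
    have h1 : (1 - β') * Real.exp (-(L * (β - β'))) ≤ 1 - β := by
      refine le_trans (mul_le_mul_of_nonneg_left (Real.exp_le_exp.2 ?_) (by linarith)) hrep
      exact neg_le_neg (mul_le_mul_of_nonneg_right hqL (by linarith))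
    have e : Real.exp (-(L * (1 - β'))) =
        Real.exp (-(L * (β - β'))) * Real.exp (-(L * (1 - β))) := by
      rw [← Real.exp_add]; ring_nf
    rw [e]
    calc _ = L * ((1 - β') * Real.exp (-(L * (β - β')))) * Real.exp (-(L * (1 - β))) := by ring
      _ ≤ _ := by gcongr
  rcases le_total t t' with hle | hle
  · exact false_of_mul_exp_neg_le ht hle hy0 hxy hmain (Or.inr ⟨hx, hy⟩)
  · refine false_of_mul_exp_neg_le ht' hle hy0 hxy hmain (Or.inl ⟨?_, ?_⟩)
    · rwa [add_comm t']
    · rwa [add_comm t']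

/-- Two different real primitive odd characters cannot both have small values at `1`. -/
theorem false_of_two_small (h₁ : QuadTheta a₁ q₁ 1 f₁ W₁) (h₂ : QuadTheta a₂ q₂ 1 f₂ W₂)
    (h₃ : QuadTheta a₃ q₃ 0 f₃ W₃) (hq₃ : 0 ≤ q₃) (hq₃' : q₃ ≤ q₁ + q₂)
    (hnn₁ : ∀ n, 0 ≤ (one' * a₁) n) (h₁1 : 1 ≤ (one' * a₁) 1) (h₁4 : 1 ≤ (one' * a₁) 4)
    (hnn₂ : ∀ n, 0 ≤ (one' * a₂) n) (h₂1 : 1 ≤ (one' * a₂) 1) (h₂4 : 1 ≤ (one' * a₂) 4)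
    (hnn : ∀ n, 0 ≤ (one' * (a₁ * (a₂ * a₃))) n) (h1 : 1 ≤ (one' * (a₁ * (a₂ * a₃))) 1)
    {ε : ℝ} (hε : 0 < ε) (hε1 : 11.2 * ε ≤ 1) (ht₁ : 1 ≤ 2 * q₁ * ε) (ht₂ : 1 ≤ 2 * q₂ * ε)
    (hH₁ : lap f₁ 1 ≤ 0.655 * ε / Real.pi * Real.exp (q₁ - 2 * q₁ * ε))
    (hH₂ : lap f₂ 1 ≤ 0.655 * ε / Real.pi * Real.exp (q₂ - 2 * q₂ * ε)) : False := by
  obtain ⟨β₁, hβ₁, hβ₁1, hz₁⟩ := h₁.exists_zero hnn₁ h₁1 h₁4 hε hε1 ht₁ hH₁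
  obtain ⟨β₂, hβ₂, hβ₂1, hz₂⟩ := h₂.exists_zero hnn₂ h₂1 h₂4 hε hε1 ht₂ hH₂
  obtain ⟨f₀, h⟩ := exists_biquadTheta h₁ h₂ h₃ hnn h1
  have hlap (s : ℝ) : lap (conv f₁ (conv f₂ f₃)) s = lap f₁ s * (lap f₂ s * lap f₃ s) := by
    rw [lap_conv isOpen_univ h₁.bdd (h₂.bdd.conv isOpen_univ h₃.bdd) (Set.mem_univ s),
      lap_conv isOpen_univ h₂.bdd h₃.bdd (Set.mem_univ s)]
  have hqb {q : ℝ} (ht : 1 ≤ 2 * q * ε) : 5.6 ≤ q := by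
    by_contra hq
    push Not at hq
    nlinarith
  have hq1 := hqb ht₁
  have hq2 := hqb ht₂
  have hq : 11.2 ≤ q₁ + (q₂ + q₃) := by norm_num at hq1 hq2 ⊢; linarith
  have hβb {t β : ℝ} (ht : 1 ≤ t) (hβ : 1 - β < 1.12 * ε * Real.exp (-t)) : 0.9632 ≤ β := by
    have e1 := exp_neg_one_lt'
    have e2 : Real.exp (-t) ≤ Real.exp (-1) := Real.exp_le_exp.2 (by linarith)
    have e3 : ε * Real.exp (-t) ≤ ε * 0.36788 := mul_le_mul_of_nonneg_left (by linarith) hε.le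
    norm_num at hβ hε1 e3 ⊢
    linarith
  have hl1 := hβb ht₁ hβ₁
  have hl2 := hβb ht₂ hβ₂
  have hz1' : lap (conv f₁ (conv f₂ f₃)) β₁ = 0 := by rw [hlap, hz₁, zero_mul]
  have hz2' : lap (conv f₁ (conv f₂ f₃)) β₂ = 0 := by rw [hlap, hz₂, zero_mul, mul_zero]
  rcases lt_trichotomy β₁ β₂ with hlt | rfl | hlt
  · exact h.false_of_distinct hq ht₂ ht₁ (L := 2 * q₁ + 2 * q₂) (by ring) (by linarith) hβ₂ hβ₁
      hl1 hlt hβ₂1 hz2' hz1'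
  · have hd := h.double_zero hq hl1 hβ₁1 hlap (locallyLipschitz_lap h₁.bdd)
      ((continuous_lap h₂.bdd).mul (continuous_lap h₃.bdd)) hz₁ (by simp [hz₂])
    have hd0 : 0 < 1 - β₁ := by linarith
    have b0 : 1 / β₁ ≤ 1.5 := by
      norm_num at hl1
      rw [div_le_iff₀ (by linarith)]
      norm_num
      linarith
    have hL : (2 * q₁ + 2 * q₂) * (1 - β₁) < 1 := by
      have m1 := mul_exp_neg_le (2 * q₁ * ε)
      have m2 := mul_exp_neg_le (2 * q₂ * ε)
      norm_num at hq1 hq2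
      have n1 := mul_le_mul_of_nonneg_left hβ₁.le (by linarith : 0 ≤ 2 * q₁)
      have n2 := mul_le_mul_of_nonneg_left hβ₂.le (by linarith : 0 ≤ 2 * q₂)
      norm_num at m1 m2 n1 n2 ⊢
      linarith
    have : 1 / (1 - β₁) ≤ 2 * q₁ + 2 * q₂ := by linarith
    rw [div_le_iff₀ hd0] at this
    linarith
  · exact h.false_of_distinct hq ht₁ ht₂ (L := 2 * q₁ + 2 * q₂) (by ring) (by linarith) hβ₁ hβ₂
      hl2 hlt hβ₁1 hz1' hz2'

end

section
variable {a : ArithmeticFunction ℝ} {q : ℝ} {f : ℝ → ℝ} {W : ℝ}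

lemma tendsto_lap_quadKernel : Tendsto (lap quadKernel) (𝓝[>] 1) (𝓝 (1 / Real.pi)) := by
  have h : Tendsto (fun s : ℝ => 2 * (2 * Real.pi) ^ (-s) * Real.Gamma s) (𝓝[>] 1)
      (𝓝 (2 * (2 * Real.pi) ^ (-1 : ℝ) * Real.Gamma 1)) := by
    have hc : ContinuousAt (fun s : ℝ => 2 * (2 * Real.pi) ^ (-s) * Real.Gamma s) 1 := by
      refine ContinuousAt.mul (continuousAt_const.mul ?_) ?_
      · exact ContinuousAt.rpow continuousAt_const (by fun_prop)
          (Or.inl (by have := Real.pi_pos; positivity))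
      · exact (Real.differentiableAt_Gamma fun m => by
          have : (0 : ℝ) ≤ m := m.cast_nonneg
          linarith).continuousAt
    exact hc.tendsto.mono_left nhdsWithin_le_nhds
  rw [Real.Gamma_one, Real.rpow_neg_one] at h
  rw [show 1 / Real.pi = 2 * (2 * Real.pi)⁻¹ * 1 by have := Real.pi_pos; field_simp]
  refine h.congr' ?_
  filter_upwards [self_mem_nhdsWithin] with s hs
  exact (lap_quadKernel (zero_lt_one.trans hs)).symm

lemma tendsto_signFactor (W : ℝ) :
    Tendsto (fun s : ℝ => signFactor W (s - 1 / 2) / s) (𝓝[>] 1) (𝓝 1) := by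
  have hc : ContinuousAt (fun s : ℝ => signFactor W (s - 1 / 2) / s) 1 := by
    refine ContinuousAt.div ?_ continuousAt_id one_ne_zero
    unfold signFactor
    split_ifs <;> fun_prop
  have := hc.tendsto.mono_left (nhdsWithin_le_nhds (s := Set.Ioi 1))
  simp only [signFactor] at this
  norm_num at this
  simpa [signFactor] using this

/-- If the coefficients of `ζ(s) L(s, χ)` are bounded by those of the Dedekind zeta function
of `K`, then the value at `1` is bounded by the residue. -/
lemma QuadTheta.lap_one_le_residue (K : Type*) [Field K] [NumberField K]
    (h : QuadTheta a q 1 f W) (hnn : ∀ n, 0 ≤ (one' * a) n)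
    (hle : ∀ n, (one' * a) n ≤ Nat.card {I : Ideal (𝓞 K) // Ideal.absNorm I = n}) :
    lap f 1 ≤ Real.exp q * (1 / Real.pi) * dedekindZeta_residue K := by
  obtain ⟨f₀, hz, hr₀⟩ := exists_zetaLike
  have hrep := rep_conv hr₀ h.rep (thetaKernel_expBdd 0) (thetaKernel_expBdd 1)
      (s := 2) (by norm_num) (absConvAt_one (by norm_num)) (h.absConvAt (by norm_num))
  set c : ℕ → ℂ := fun n => (Nat.card {I : Ideal (𝓞 K) // Ideal.absNorm I = n} : ℂ) with hc
  have hlim := tendsto_sub_one_mul_dedekindZeta_nhdsGT K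
  have hne : ∀ᶠ s : ℝ in 𝓝[>] 1, ((s - 1 : ℂ) * dedekindZeta K s) ≠ 0 :=
    hlim.eventually_ne (by exact_mod_cast dedekindZeta_residue_ne_zero K)
  have hzeta : ∀ᶠ s : ℝ in 𝓝[>] 1, HasSum (fun n : ℕ => (LSeries.term c s n).re)
      (dedekindZeta K s).re := by
    filter_upwards [hne] with s hs
    have hsum : LSeriesSummable c (s : ℂ) := by
      by_contra hcon
      exact hs (by rw [dedekindZeta, LSeries, tsum_eq_zero_of_not_summable hcon, mul_zero])
    exact Complex.hasSum_re hsum.hasSum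
  have hterm (s : ℝ) (n : ℕ) :
      (one' * a) n * Real.exp (-s * Real.log n) ≤ (LSeries.term c s n).re := by
    by_cases hn : n = 0
    · simp [hn]
    have hn' : (0 : ℝ) < n := by exact_mod_cast Nat.pos_of_ne_zero hn
    rw [LSeries.term_of_ne_zero hn]
    have e : c n / (n : ℂ) ^ (s : ℂ) =
        ((Nat.card {I : Ideal (𝓞 K) // Ideal.absNorm I = n} *
          Real.exp (-s * Real.log n) : ℝ) : ℂ) := by
      rw [← Complex.ofReal_natCast n, ← Complex.ofReal_cpow hn'.le, neg_mul, Real.exp_neg,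
        mul_comm s, Real.rpow_def_of_pos hn', ← div_eq_mul_inv]
      simp [hc]
    rw [e, Complex.ofReal_re]
    exact mul_le_mul_of_nonneg_right (hle n) (Real.exp_nonneg _)
  have key : ∀ᶠ s : ℝ in 𝓝[>] 1, signFactor W (s - 1 / 2) / s * lap f 1 ≤
      Real.exp (s * q) * lap quadKernel s * ((s - 1 : ℂ) * dedekindZeta K s).re := by
    filter_upwards [hzeta, self_mem_nhdsWithin] with s hs h1
    have h1 : 1 < s := h1
    have e1 := hz.lap_conv_eq_symE h.bdd h.sign h.fe (v := s - 1 / 2) (by linarith)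
    have hE := symE_nonneg h.sign (hrep.nonneg hnn quadKernel_nonneg) (v := s - 1 / 2)
      (by linarith)
    have hS := signFactor_pos (W := W) (v := s - 1 / 2) (by linarith)
    have hsum := rep_lap hrep quadKernel_expBdd (s := s) (by linarith)
      ((absConvAt_one h1).mul (h.absConvAt h1))
    simp only [zero_add] at hsum
    rw [show 1 / 2 + (s - 1 / 2) = s by ring, show s - 1 / 2 + 1 / 2 = s by ring,
      show s - 1 / 2 - 1 / 2 = s - 1 by ring] at e1
    have hk : 0 < lap quadKernel s := by
      rw [lap_quadKernel (by linarith)]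
      have := Real.Gamma_pos_of_pos (show 0 < s by linarith)
      have := Real.pi_pos
      positivity
    have hm := hasSum_le (fun n => mul_le_mul_of_nonneg_right (hterm s n)
      (show 0 ≤ Real.exp (s * q) * lap quadKernel s by positivity)) hsum (hs.mul_right _)
    change lap (conv f₀ f) s ≤ _ at hm
    rw [e1] at hm
    have hs1 : 0 < s - 1 := by linarith
    have e2 : ((s - 1 : ℂ) * dedekindZeta K s).re = (s - 1) * (dedekindZeta K s).re := by
      rw [← Complex.ofReal_one, ← Complex.ofReal_sub, Complex.re_ofReal_mul]
    rw [e2]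
    calc signFactor W (s - 1 / 2) / s * lap f 1
        = (s - 1) * (signFactor W (s - 1 / 2) * (lap f 1 / (s * (s - 1)))) := by
          field_simp
      _ ≤ (s - 1) * ((dedekindZeta K s).re * (Real.exp (s * q) * lap quadKernel s)) := by
          refine mul_le_mul_of_nonneg_left (le_trans ?_ hm) hs1.le
          exact mul_le_mul_of_nonneg_left (by linarith) hS.le
      _ = _ := by ring
  have hl := (tendsto_signFactor W).mul_const (lap f 1)
  have hexp : Tendsto (fun s : ℝ => Real.exp (s * q)) (𝓝[>] 1) (𝓝 (Real.exp (1 * q))) :=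
    (show Continuous fun s : ℝ => Real.exp (s * q) by fun_prop).continuousAt.tendsto.mono_left
      nhdsWithin_le_nhds
  have hre := (Complex.continuous_re.tendsto _).comp hlim
  have hfin := le_of_tendsto_of_tendsto hl ((hexp.mul tendsto_lap_quadKernel).mul hre) key
  simpa using hfin

end

/-- Class number formula bound for an imaginary quadratic field. -/
lemma residue_le_classNumber (K : Type*) [Field K] [NumberField K]
    (h2 : Module.finrank ℚ K = 2) (hD : discr K < 0) :
    √|discr K| * (1 / Real.pi) * dedekindZeta_residue K ≤ classNumber K := by
  have hs := sign_discr K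
  rw [Int.sign_eq_neg_one_of_neg hD] at hs
  have hc := InfinitePlace.card_add_two_mul_card_eq_rank K
  rw [h2] at hc
  have hc1 : InfinitePlace.nrComplexPlaces K = 1 := by
    have : InfinitePlace.nrComplexPlaces K ≠ 0 := by
      intro h; rw [h] at hs; norm_num at hs
    omega
  have hc0 : InfinitePlace.nrRealPlaces K = 0 := by omega
  have hrank : Units.rank K = 0 := by
    rw [Units.rank, InfinitePlace.card_eq_nrRealPlaces_add_nrComplexPlaces, hc0, hc1]
  have hreg : Units.regulator K = 1 := by
    classical
    have : IsEmpty {w : InfinitePlace K // w ≠ Units.dirichletUnitTheorem.w₀} :=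
      (Units.equivFinRank K).symm.isEmpty_congr.2 (by rw [hrank]; infer_instance)
    rw [Units.regulator_eq_det', Matrix.det_isEmpty, abs_one]
  have hw : 2 ≤ Units.torsionOrder K := by
    have := Units.even_torsionOrder K
    have := Units.torsionOrder_pos K
    grind
  rw [dedekindZeta_residue_def, hc0, hc1, hreg]
  have hd : 0 < √(|discr K| : ℝ) := Real.sqrt_pos.2 (by
    have : discr K ≠ 0 := hD.ne
    positivity)
  have hpi := Real.pi_pos
  have hw' : (2 : ℝ) ≤ Units.torsionOrder K := by exact_mod_cast hw
  have e : √(|discr K| : ℝ) * (1 / Real.pi) * ((2 ^ 0 * (2 * Real.pi) ^ 1 * 1 * classNumber K) /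
      (Units.torsionOrder K * √(|discr K| : ℝ))) = 2 / Units.torsionOrder K * classNumber K := by
    field_simp
  rw [e]
  refine mul_le_of_le_one_left (Nat.cast_nonneg _) ?_
  rw [div_le_one (by linarith)]
  exact hw'

section
variable (K : Type*) [Field K] [NumberField K]

/-- The ring of integers of a quadratic field has a basis `1, ω`. -/
lemma exists_basis_one (h2 : Module.finrank ℚ K = 2) :
    ∃ b : Module.Basis (Fin 2) ℤ (𝓞 K), b 0 = 1 := by
  have hr : Module.finrank ℤ (𝓞 K) = 2 := by rw [RingOfIntegers.rank, h2]
  let e := Module.finBasisOfFinrankEq ℤ (𝓞 K) hr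
  set x := e.repr 1 0 with hx
  set y := e.repr 1 1 with hy
  have h1 : (1 : 𝓞 K) = x • e 0 + y • e 1 := by
    conv_lhs => rw [← e.sum_repr 1]
    rw [Fin.sum_univ_two]
  have hco : IsCoprime x y := by
    rw [Int.isCoprime_iff_gcd_eq_one]
    set g : ℤ := (Int.gcd x y : ℤ) with hg
    obtain ⟨x', hx'⟩ : g ∣ x := Int.gcd_dvd_left ..
    obtain ⟨y', hy'⟩ : g ∣ y := Int.gcd_dvd_right ..
    have hu : IsUnit ((algebraMap ℤ (𝓞 K)) g) := by
      refine IsUnit.of_mul_eq_one (x' • e 0 + y' • e 1) ?_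
      rw [h1, hx', hy', ← Algebra.smul_def, smul_add, smul_smul, smul_smul]
    have hn : IsUnit (Algebra.norm ℤ ((algebraMap ℤ (𝓞 K)) g)) := hu.map _
    rw [Algebra.norm_algebraMap, hr, isUnit_pow_iff two_ne_zero, Int.isUnit_iff] at hn
    have : 0 ≤ g := Int.natCast_nonneg _
    have : g = 1 := by omega
    omega
  obtain ⟨u, v, huv⟩ := hco
  let w : Fin 2 → 𝓞 K := ![1, -v • e 0 + u • e 1]
  have hw0 : w 0 = 1 := rfl
  have hw1 : w 1 = -v • e 0 + u • e 1 := rfl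
  have hM : e.toMatrix w = !![x, -v; y, u] := by
    ext i j
    fin_cases i <;> fin_cases j <;> simp [Module.Basis.toMatrix_apply, hw0, hw1, hx, hy, -zsmul_eq_mul]
  have hdet : IsUnit (e.det w) := by
    rw [Module.Basis.det_apply, hM, Matrix.det_fin_two_of]
    refine Int.isUnit_iff.2 (Or.inl ?_)
    linarith
  obtain ⟨hli, hsp⟩ := (Module.Basis.is_basis_iff_det (e := e)).2 hdet
  exact ⟨Module.Basis.mk hli hsp.ge, by simp [hw0]⟩

/-- A quadratic ring of integers is `ℤ[ω]` with `ω ^ 2 - t ω + n = 0` and `t ^ 2 - 4 n` the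
discriminant; homomorphisms to `ZMod p` are given by roots. -/
lemma exists_generator (h2 : Module.finrank ℚ K = 2) :
    ∃ (ω : 𝓞 K) (t n : ℤ), discr K = t ^ 2 - 4 * n ∧
      ∀ (p : ℕ) (r : ZMod p), r ^ 2 - t * r + n = 0 → ∃ φ : 𝓞 K →+* ZMod p, φ ω = r := by
  obtain ⟨b, hb⟩ := exists_basis_one K h2
  set ω := b 1 with hω
  set t := b.repr (ω * ω) 1 with ht
  set m := b.repr (ω * ω) 0 with hm
  have hrep (z : 𝓞 K) : z = algebraMap ℤ (𝓞 K) (b.repr z 0) + algebraMap ℤ (𝓞 K) (b.repr z 1) * ω := by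
    conv_lhs => rw [← b.sum_repr z]
    rw [Fin.sum_univ_two, hb, Algebra.smul_def, Algebra.smul_def, mul_one]
  have hrepr (x y : ℤ) (i : Fin 2) :
      b.repr (algebraMap ℤ (𝓞 K) x + algebraMap ℤ (𝓞 K) y * ω) i = if i = 0 then x else y := by
    have : algebraMap ℤ (𝓞 K) x + algebraMap ℤ (𝓞 K) y * ω = x • b 0 + y • b 1 := by
      rw [hb, Algebra.smul_def, Algebra.smul_def, mul_one]
    rw [this, map_add, map_smul, map_smul, b.repr_self, b.repr_self]
    fin_cases i <;> simp
  have hsq : ω * ω = algebraMap ℤ (𝓞 K) m + algebraMap ℤ (𝓞 K) t * ω := hrep _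
  have hmul (x y x' y' : ℤ) : (algebraMap ℤ (𝓞 K) x + algebraMap ℤ (𝓞 K) y * ω) *
      (algebraMap ℤ (𝓞 K) x' + algebraMap ℤ (𝓞 K) y' * ω) =
      algebraMap ℤ (𝓞 K) (x * x' + m * (y * y')) +
        algebraMap ℤ (𝓞 K) (x * y' + y * x' + t * (y * y')) * ω := by
    simp only [map_add, map_mul]
    linear_combination (algebraMap ℤ (𝓞 K) y * algebraMap ℤ (𝓞 K) y') * hsq
  have htr (z : 𝓞 K) (x y : ℤ) (hz : z = algebraMap ℤ (𝓞 K) x + algebraMap ℤ (𝓞 K) y * ω) :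
      Algebra.trace ℤ (𝓞 K) z = 2 * x + t * y := by
    rw [Algebra.trace_eq_matrix_trace b, Matrix.trace_fin_two, Algebra.leftMulMatrix_eq_repr_mul,
      Algebra.leftMulMatrix_eq_repr_mul, hb, mul_one, hz, hrepr, ← hω]
    have := hmul x y 0 1
    simp only [map_zero, map_one, zero_add, one_mul, mul_zero, mul_one, add_zero] at this
    rw [this, hrepr]
    simp
    ring
  refine ⟨ω, t, -m, ?_, fun p r hr => ?_⟩
  · rw [← discr_eq_discr K b, Algebra.discr_def, Matrix.det_fin_two]
    simp only [Algebra.traceMatrix_apply, Algebra.traceForm_apply, hb, ← hω, mul_one, one_mul]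
    rw [htr 1 1 0 (by simp), htr ω 0 1 (by simp), htr (ω * ω) m t hsq]
    ring
  · have hr' : r * r = m + t * r := by
      push_cast at hr
      linear_combination hr
    refine ⟨{ toFun := fun z => (b.repr z 0 : ZMod p) + (b.repr z 1 : ZMod p) * r
              map_one' := ?_
              map_mul' := fun z w => ?_
              map_zero' := by simp
              map_add' := fun z w => ?_ }, ?_⟩
    · have := hrepr 1 0
      simp only [map_zero, map_one, zero_mul, add_zero] at this
      simp [this]
    · have e := hmul (b.repr z 0) (b.repr z 1) (b.repr w 0) (b.repr w 1)
      rw [← hrep z, ← hrep w] at e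
      rw [e, hrepr, hrepr]
      simp only [if_true, Fin.one_eq_zero_iff, OfNat.ofNat_ne_one, if_false]
      push_cast
      linear_combination -((b.repr z 1 : ZMod p) * (b.repr w 1 : ZMod p)) * hr'
    · simp only [map_add, Finsupp.coe_add, Pi.add_apply]
      push_cast
      ring
    · simp [hω]

end

section
variable (K : Type*) [Field K] [NumberField K]

/-- The number of integral ideals of norm `n`. -/
noncomputable def idealCount (n : ℕ) : ℕ := Nat.card {I : Ideal (𝓞 K) // Ideal.absNorm I = n}

variable {K}

lemma finite_ideals {n : ℕ} : Finite {I : Ideal (𝓞 K) // Ideal.absNorm I = n} :=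
  Ideal.finite_setOfPred_absNorm_eq n

lemma absNorm_ker {p : ℕ} (φ : 𝓞 K →+* ZMod p) : Ideal.absNorm (RingHom.ker φ) = p := by
  have e := RingHom.quotientKerEquivOfSurjective (ZMod.ringHom_surjective φ)
  rw [Ideal.absNorm_apply, Submodule.cardQuot_apply]
  exact (Nat.card_congr e.toEquiv).trans (Nat.card_zmod p)

lemma idealCount_pos {n : ℕ} (I : Ideal (𝓞 K)) (hI : Ideal.absNorm I = n) : 1 ≤ idealCount K n := by
  have := finite_ideals (K := K) (n := n)
  exact Nat.card_pos_iff.2 ⟨⟨I, hI⟩, this⟩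

lemma isCoprime_of_absNorm {I J : Ideal (𝓞 K)}
    (h : (Ideal.absNorm I).Coprime (Ideal.absNorm J)) : IsCoprime I J := by
  rw [Ideal.isCoprime_iff_exists]
  obtain ⟨u, v, huv⟩ := Nat.isCoprime_iff_coprime.2 h
  refine ⟨_, I.mul_mem_left (u : 𝓞 K) (Ideal.absNorm_mem I), _,
    J.mul_mem_left (v : 𝓞 K) (Ideal.absNorm_mem J), ?_⟩
  exact_mod_cast congrArg (Int.cast : ℤ → 𝓞 K) huv

lemma idealCount_mul_le {m n : ℕ} (h : m.Coprime n) :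
    idealCount K m * idealCount K n ≤ idealCount K (m * n) := by
  have := finite_ideals (K := K) (n := m * n)
  rw [idealCount, idealCount, ← Nat.card_prod]
  refine Nat.card_le_card_of_injective
    (fun x => ⟨x.1.1 * x.2.1, by rw [map_mul, x.1.2, x.2.2]⟩) ?_
  rintro ⟨⟨I, hI⟩, ⟨J, hJ⟩⟩ ⟨⟨I', hI'⟩, ⟨J', hJ'⟩⟩ hx
  have hx : I * J = I' * J' := congrArg Subtype.val hx
  have c1 : IsCoprime I J' := isCoprime_of_absNorm (by rwa [hI, hJ'])
  have c2 : IsCoprime I' J := isCoprime_of_absNorm (by rwa [hI', hJ])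
  have e1 : I = I' := dvd_antisymm' (c2.dvd_of_dvd_mul_right (hx ▸ dvd_mul_right I' J'))
    (c1.dvd_of_dvd_mul_right (hx ▸ dvd_mul_right I J))
  have e2 : J = J' := dvd_antisymm' (c1.symm.dvd_of_dvd_mul_left (hx ▸ dvd_mul_left J' I'))
    (c2.symm.dvd_of_dvd_mul_left (hx ▸ dvd_mul_left J I))
  subst e1 e2
  rfl

lemma succ_le_idealCount {p : ℕ} [Fact p.Prime] (φ ψ : 𝓞 K →+* ZMod p)
    (h : RingHom.ker φ ≠ RingHom.ker ψ) (k : ℕ) : k + 1 ≤ idealCount K (p ^ k) := by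
  have := finite_ideals (K := K) (n := p ^ k)
  set P := RingHom.ker φ
  set Q := RingHom.ker ψ
  have hP : P.IsMaximal := RingHom.ker_isMaximal_of_surjective φ (ZMod.ringHom_surjective φ)
  have hQ : Q.IsMaximal := RingHom.ker_isMaximal_of_surjective ψ (ZMod.ringHom_surjective ψ)
  have hp : p ≠ 0 := (Fact.out : p.Prime).ne_zero
  have hP0 : P ≠ 0 := fun h0 => hp (by rw [← absNorm_ker φ]; exact Ideal.absNorm_eq_zero_iff.2 h0)
  have hQ0 : Q ≠ 0 := fun h0 => hp (by rw [← absNorm_ker ψ]; exact Ideal.absNorm_eq_zero_iff.2 h0)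
  have key (i j : ℕ) (hij : i < j) (hj : j ≤ k) : P ^ i * Q ^ (k - i) ≠ P ^ j * Q ^ (k - j) := by
    intro he
    have e1 : P ^ j = P ^ i * P ^ (j - i) := by rw [← pow_add]; congr 1; omega
    have e2 : Q ^ (k - i) = Q ^ (k - j) * Q ^ (j - i) := by rw [← pow_add]; congr 1; omega
    have he' : (P ^ i * Q ^ (k - j)) * Q ^ (j - i) = (P ^ i * Q ^ (k - j)) * P ^ (j - i) := by
      rw [mul_assoc, ← e2, he, e1, mul_right_comm]
    have he2 := mul_left_cancel₀ (mul_ne_zero (pow_ne_zero _ hP0) (pow_ne_zero _ hQ0)) he'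
    have hPQ : P ≤ Q := by
      refine hQ.isPrime.le_of_pow_le (n := j - i) ?_
      rw [← he2]
      exact Ideal.pow_le_self (by omega)
    exact h (hP.eq_of_le hQ.ne_top hPQ)
  let F : Fin (k + 1) → {I : Ideal (𝓞 K) // Ideal.absNorm I = p ^ k} := fun i =>
    ⟨P ^ (i : ℕ) * Q ^ (k - i), by
      rw [map_mul, map_pow, map_pow, absNorm_ker, absNorm_ker, ← pow_add]
      congr 1
      have := i.2
      omega⟩
  have hF : Function.Injective F := by
    intro i j hij
    have hij : P ^ (i : ℕ) * Q ^ (k - i) = P ^ (j : ℕ) * Q ^ (k - j) := congrArg Subtype.val hij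
    rcases lt_trichotomy (i : ℕ) j with hlt | heq | hgt
    · exact absurd hij (key i j hlt (by omega))
    · exact Fin.ext heq
    · exact absurd hij.symm (key j i hgt (by omega))
  have := Nat.card_le_card_of_injective F hF
  rwa [Nat.card_fin] at this

/-- The condition on a character that its values are governed by splitting in the quadratic order
of discriminant `D`. -/
def IsKronecker {N : ℕ} (χ : DirichletCharacter ℂ N) (D : ℤ) : Prop :=
  ∀ p : ℕ, p.Prime → χ p ≠ -1 →
    (∃ b : ℤ, (4 * p : ℤ) ∣ b ^ 2 - D) ∧ (χ p = 1 → ¬ (p : ℤ) ∣ D)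

/-- Completely multiplicative arithmetic functions. -/
def CompMul (u : ArithmeticFunction ℝ) : Prop := u 1 = 1 ∧ ∀ m n, u (m * n) = u m * u n

lemma CompMul.isMultiplicative {u : ArithmeticFunction ℝ} (hu : CompMul u) : u.IsMultiplicative :=
  ⟨hu.1, fun {_ _} _ => hu.2 _ _⟩

lemma CompMul.pow {u : ArithmeticFunction ℝ} (hu : CompMul u) (p k : ℕ) : u (p ^ k) = u p ^ k := by
  induction k with
  | zero => simp [hu.1]
  | succ k ih => rw [pow_succ, hu.2, ih, pow_succ]

lemma compMul_one' : CompMul one' := by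
  refine ⟨by simp [one'], fun m n => ?_⟩
  by_cases hm : m = 0 <;> by_cases hn : n = 0 <;> simp [one', hm, hn]

lemma compMul_coef {N : ℕ} {χ : DirichletCharacter ℂ N} (hq : χ.IsQuadratic) :
    CompMul (coef χ) := by
  refine ⟨by simp [coef], fun m n => ?_⟩
  by_cases hm : m = 0
  · simp [hm]
  by_cases hn : n = 0
  · simp [hn]
  have h : ∀ a, (χ a).im = 0 := fun a => by rcases hq a with h | h | h <;> simp [h]
  simp [coef, hm, hn, Complex.mul_re, h]

lemma coef_prime {N : ℕ} (χ : DirichletCharacter ℂ N) {p : ℕ} (hp : p.Prime) :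
    coef χ p = (χ p).re := by
  simp [coef, hp.ne_zero]

/-- The Euler factor of an arithmetic function as a formal power series. -/
noncomputable def localSeries (p : ℕ) (u : ArithmeticFunction ℝ) : PowerSeries ℝ :=
  PowerSeries.mk fun k => u (p ^ k)

lemma localSeries_mul {p : ℕ} (hp : p.Prime) (u v : ArithmeticFunction ℝ) :
    localSeries p (u * v) = localSeries p u * localSeries p v := by
  ext k
  rw [PowerSeries.coeff_mul, localSeries, PowerSeries.coeff_mk, ArithmeticFunction.mul_apply,
    Nat.sum_divisorsAntidiagonal (fun x y => u x * v y), Nat.sum_divisors_prime_pow hp,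
    Finset.Nat.sum_antidiagonal_eq_sum_range_succ_mk]
  refine Finset.sum_congr rfl fun i hi => ?_
  simp only [localSeries, PowerSeries.coeff_mk]
  rw [Nat.pow_div (Nat.lt_succ_iff.1 (Finset.mem_range.1 hi)) hp.pos]

/-- The geometric series with ratio `x`. -/
noncomputable def geomSeries (x : ℝ) : PowerSeries ℝ := PowerSeries.mk fun k => x ^ k

lemma CompMul.localSeries {u : ArithmeticFunction ℝ} (hu : CompMul u) (p : ℕ) :
    localSeries p u = geomSeries (u p) := by
  ext k
  simp [SiegelTatuzawa.localSeries, geomSeries, hu.pow]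

lemma geomSeries_zero : geomSeries 0 = 1 := by
  ext k
  by_cases hk : k = 0 <;> simp [geomSeries, PowerSeries.coeff_one, hk]

lemma localSeries_one' {p : ℕ} (hp : p.Prime) : localSeries p one' = geomSeries 1 := by
  rw [compMul_one'.localSeries]
  simp [one', hp.ne_zero]

lemma coeff_geomSeries_mul (x : ℝ) (k : ℕ) :
    PowerSeries.coeff k (geomSeries 1 * geomSeries x) = ∑ i ∈ Finset.range (k + 1), x ^ i := by
  rw [mul_comm, PowerSeries.coeff_mul, Finset.Nat.sum_antidiagonal_eq_sum_range_succ_mk]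
  simp [geomSeries]

lemma coeff_geomSeries_mul_nonneg {x : ℝ} (hx : x = 0 ∨ x = 1 ∨ x = -1) (k : ℕ) :
    0 ≤ PowerSeries.coeff k (geomSeries 1 * geomSeries x) := by
  rw [coeff_geomSeries_mul]
  rcases hx with rfl | rfl | rfl
  · exact Finset.sum_nonneg fun i _ => by positivity
  · exact Finset.sum_nonneg fun i _ => by positivity
  · rw [neg_one_geom_sum]
    split_ifs <;> norm_num

lemma coeff_mul_nonneg {A B : PowerSeries ℝ} (hA : ∀ k, 0 ≤ PowerSeries.coeff k A)
    (hB : ∀ k, 0 ≤ PowerSeries.coeff k B) (k : ℕ) : 0 ≤ PowerSeries.coeff k (A * B) := by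
  rw [PowerSeries.coeff_mul]
  exact Finset.sum_nonneg fun i _ => mul_nonneg (hA _) (hB _)

lemma nonneg_of_prime_pow {f : ArithmeticFunction ℝ} (hf : f.IsMultiplicative)
    (h : ∀ p : ℕ, p.Prime → ∀ k, 0 ≤ PowerSeries.coeff k (localSeries p f)) (n : ℕ) : 0 ≤ f n := by
  induction n using Nat.recOnPosPrimePosCoprime with
  | prime_pow p k hp hk => simpa [localSeries] using h p hp k
  | zero => simp
  | one => rw [hf.1]; exact zero_le_one
  | coprime m n hm hn hmn ihm ihn => rw [hf.2 hmn]; exact mul_nonneg ihm ihn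

lemma isMultiplicative_zeta_mul_coef {N : ℕ} (χ : DirichletCharacter ℂ N) (hq : χ.IsQuadratic) :
    (one' * coef χ).IsMultiplicative :=
  compMul_one'.isMultiplicative.mul (compMul_coef hq).isMultiplicative

lemma zeta_mul_coef_prime_pow {N : ℕ} (χ : DirichletCharacter ℂ N) (hq : χ.IsQuadratic) {p : ℕ}
    (hp : p.Prime) (k : ℕ) :
    (one' * coef χ) (p ^ k) = ∑ i ∈ Finset.range (k + 1), (coef χ p) ^ i := by
  rw [← coeff_geomSeries_mul, ← (compMul_coef hq).localSeries, ← localSeries_one' hp,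
    ← localSeries_mul hp, localSeries, PowerSeries.coeff_mk]

lemma one_le_zeta_mul_coef_four {N : ℕ} (χ : DirichletCharacter ℂ N) (hq : χ.IsQuadratic) :
    1 ≤ (one' * coef χ) 4 := by
  have := zeta_mul_coef_prime_pow χ hq Nat.prime_two 2
  rw [show (2 : ℕ) ^ 2 = 4 by norm_num] at this
  rw [this, Finset.sum_range_succ, Finset.sum_range_succ, Finset.sum_range_one, coef_prime χ
    Nat.prime_two]
  rcases hq (2 : ℕ) with h | h | h <;> simp only [Nat.cast_ofNat] at h <;> simp [h]

lemma biquad_coeff_nonneg {u v w : ArithmeticFunction ℝ} (hu : CompMul u) (hv : CompMul v)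
    (hw : CompMul w) (hu' : ∀ n, u n = 0 ∨ u n = 1 ∨ u n = -1)
    (hv' : ∀ n, v n = 0 ∨ v n = 1 ∨ v n = -1) (hw' : ∀ n, w n = 0 ∨ w n = 1 ∨ w n = -1)
    (h : ∀ p : ℕ, p.Prime → w p = u p * v p ∨ (u p = 0 ∧ v p = 0)) (n : ℕ) :
    0 ≤ (one' * (u * (v * w))) n := by
  refine nonneg_of_prime_pow (compMul_one'.isMultiplicative.mul (hu.isMultiplicative.mul
    (hv.isMultiplicative.mul hw.isMultiplicative))) (fun p hp k => ?_) n
  rw [localSeries_mul hp, localSeries_mul hp, localSeries_mul hp, hu.localSeries, hv.localSeries,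
    hw.localSeries, localSeries_one' hp]
  have n1 := fun k => coeff_geomSeries_mul_nonneg (x := 1) (by norm_num) k
  have n2 := fun k => coeff_geomSeries_mul_nonneg (x := -1) (by norm_num) k
  rcases h p hp with h | ⟨h1, h2⟩
  · rw [h]
    rcases hu' p with h1 | h1 | h1 <;> rcases hv' p with h2 | h2 | h2 <;> rw [h1, h2] <;>
      simp only [mul_zero, mul_one, one_mul, mul_neg, neg_neg, neg_zero, geomSeries_zero]
    · simp [geomSeries]
    · exact n1 k
    · exact n2 k
    · exact n1 k
    · rw [← mul_assoc]
      exact coeff_mul_nonneg n1 n1 k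
    · rw [show geomSeries 1 * (geomSeries 1 * (geomSeries (-1) * geomSeries (-1))) =
        (geomSeries 1 * geomSeries (-1)) * (geomSeries 1 * geomSeries (-1)) by ring]
      exact coeff_mul_nonneg n2 n2 k
    · exact n2 k
    · rw [show geomSeries 1 * (geomSeries (-1) * (geomSeries 1 * geomSeries (-1))) =
        (geomSeries 1 * geomSeries (-1)) * (geomSeries 1 * geomSeries (-1)) by ring]
      exact coeff_mul_nonneg n2 n2 k
    · rw [show geomSeries 1 * (geomSeries (-1) * (geomSeries (-1) * geomSeries 1)) =
        (geomSeries 1 * geomSeries (-1)) * (geomSeries 1 * geomSeries (-1)) by ring]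
      exact coeff_mul_nonneg n2 n2 k
  · rw [h1, h2, geomSeries_zero, one_mul, one_mul]
    exact coeff_geomSeries_mul_nonneg (hw' p) k

lemma zeta_mul_coef_le_idealCount (h2 : Module.finrank ℚ K = 2) {N : ℕ}
    (χ : DirichletCharacter ℂ N) (hq : χ.IsQuadratic) (hχ : IsKronecker χ (discr K)) (n : ℕ) :
    (one' * coef χ) n ≤ idealCount K n := by
  obtain ⟨ω, t, c, hD, hφ⟩ := exists_generator K h2
  induction n using Nat.recOnPosPrimePosCoprime with
  | prime_pow p k hp hk =>
    have : Fact p.Prime := ⟨hp⟩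
    rw [zeta_mul_coef_prime_pow χ hq hp]
    have hhom (b : ℤ) (hb : (4 * p : ℤ) ∣ b ^ 2 - discr K) :
        ∃ r : ℤ, 2 * r = b + t ∧ ∃ φ : 𝓞 K →+* ZMod p, φ ω = r := by
      obtain ⟨e, he⟩ := hb
      have hpar : Even (b + t) := by
        have : Even ((b + t) * (b - t)) := ⟨2 * (p * e - c), by rw [hD] at he; linarith⟩
        rcases Int.even_mul.1 this with h | h
        · exact h
        · have := h.add (even_two_mul t); rwa [show b - t + 2 * t = b + t by ring] at this
      obtain ⟨r, hr⟩ := hpar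
      refine ⟨r, by omega, hφ p r ?_⟩
      have h4 : 4 * (r ^ 2 - t * r + c) = 4 * (p * e) := by
        have hb : b = 2 * r - t := by omega
        rw [hD, hb] at he
        linarith
      have h5 : r ^ 2 - t * r + c = p * e := by linarith
      have := congrArg (Int.cast : ℤ → ZMod p) h5
      push_cast at this
      simpa using this
    have hcp : coef χ p = (χ p).re := by simp [coef, hp.ne_zero]
    rcases hq p with h | h | h
    · obtain ⟨⟨b, hb⟩, -⟩ := hχ p hp (by rw [h]; norm_num)
      obtain ⟨r, -, φ, -⟩ := hhom b hb
      have : coef χ p = 0 := by simp [hcp, h]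
      rw [this, Finset.sum_range_succ']
      simpa using idealCount_pos (n := p ^ k) (RingHom.ker φ ^ k) (by rw [map_pow, absNorm_ker])
    · obtain ⟨⟨b, hb⟩, hpD⟩ := hχ p hp (by rw [h]; norm_num)
      obtain ⟨r, hr, φ, hφr⟩ := hhom b hb
      obtain ⟨s, hs, ψ, hψs⟩ := hhom (-b) (by simpa using hb)
      have : coef χ p = 1 := by simp [hcp, h]
      rw [this]
      have hne : RingHom.ker φ ≠ RingHom.ker ψ := by
        intro hker
        have h1 : ω - r ∈ RingHom.ker φ := by simp [RingHom.mem_ker, hφr]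
        rw [hker, RingHom.mem_ker, map_sub, hψs, map_intCast, ← Int.cast_sub,
          ZMod.intCast_zmod_eq_zero_iff_dvd] at h1
        have h2 : s - r = -b := by linarith
        rw [h2, dvd_neg] at h1
        have h3 : (p : ℤ) ∣ discr K := by
          have := (h1.mul_left b).sub ((Dvd.intro_left _ rfl).trans hb)
          simpa [sq] using this
        exact hpD h h3
      have := succ_le_idealCount φ ψ hne k
      simp only [one_pow, Finset.sum_const, Finset.card_range, nsmul_eq_mul, mul_one]
      exact_mod_cast this
    · have : coef χ p = -1 := by simp [hcp, h]
      rw [this, neg_one_geom_sum]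
      split_ifs with hk
      · positivity
      · have hk : Even k := by simpa [Nat.even_add_one] using hk
        obtain ⟨j, rfl⟩ := hk
        have := idealCount_pos (n := p ^ (j + j)) (Ideal.span {(p ^ j : 𝓞 K)}) (by
          rw [Ideal.absNorm_span_singleton]
          have : (p ^ j : 𝓞 K) = algebraMap ℤ (𝓞 K) (p ^ j) := by simp
          rw [this, Algebra.norm_algebraMap, RingOfIntegers.rank, h2]
          simp [Int.natAbs_pow, ← pow_mul, mul_two])
        exact_mod_cast this
  | zero => simp
  | one =>
    have h1 := (isMultiplicative_zeta_mul_coef χ hq).1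
    rw [h1]
    exact_mod_cast idealCount_pos (n := 1) (⊤ : Ideal (𝓞 K)) (by simp)
  | coprime m n hm hn hmn ihm ihn =>
    rw [(isMultiplicative_zeta_mul_coef χ hq).2 hmn]
    refine (mul_le_mul ihm ihn (zeta_mul_coef_nonneg hq n) (by positivity)).trans ?_
    exact_mod_cast idealCount_mul_le hmn

end

section

open ZMod NumberTheorySymbols

lemma exists_dirichletCharacter {N : ℕ} (F : ℤ → ℤ)
    (hper : ∀ a b : ℤ, (a : ZMod N) = b → F a = F b) (hmul : ∀ a b, F (a * b) = F a * F b)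
    (h1 : F 1 = 1) (h0 : ∀ a : ℤ, ¬ IsCoprime a N → F a = 0) :
    ∃ χ : DirichletCharacter ℂ N, ∀ a : ℤ, χ a = F a := by
  let χ : DirichletCharacter ℂ N :=
    { toFun := fun x => (F (ZMod.cast x) : ℂ)
      map_one' := by
        rw [hper _ 1 (by simp), h1, Int.cast_one]
      map_mul' := fun x y => by
        rw [← Int.cast_mul, ← hmul]
        exact congrArg _ (hper _ _ (by simp))
      map_nonunit' := fun x hx => by
        rw [h0 _ fun h => hx ?_, Int.cast_zero]
        have := (ZMod.coe_int_isUnit_iff_isCoprime (ZMod.cast x) N).2 h.symm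
        simpa using this }
  refine ⟨χ, fun a => ?_⟩
  change (F (ZMod.cast (a : ZMod N)) : ℂ) = F a
  rw [hper _ a (by simp)]

lemma exists_int_modEq_modEq {m n : ℕ} (h : m.Coprime n) (a b : ℤ) :
    ∃ z : ℤ, z ≡ a [ZMOD m] ∧ z ≡ b [ZMOD n] := by
  obtain ⟨u, v, huv⟩ := Nat.isCoprime_iff_coprime.2 h
  refine ⟨u * m * b + v * n * a, ?_, ?_⟩
  · rw [Int.modEq_iff_dvd]
    exact ⟨u * a - u * b, by linear_combination (-a) * huv⟩
  · rw [Int.modEq_iff_dvd]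
    exact ⟨v * b - v * a, by linear_combination (-b) * huv⟩

lemma exists_jacobiSym_eq_neg_one {q e : ℕ} (hodd : Odd q) (hsq : Squarefree q) (he : e ∣ q)
    (hne : e ≠ q) : ∃ a : ℤ, a ≡ 1 [ZMOD e] ∧ J(a | q) = -1 := by
  obtain ⟨e', rfl⟩ := he
  have he' : e' ≠ 1 := by rintro rfl; simp at hne
  obtain ⟨p, hp, r, rfl⟩ := Nat.exists_prime_and_dvd he'
  have : Fact p.Prime := ⟨hp⟩
  have hcop : p.Coprime (e * r) := by
    rw [show e * (p * r) = p * (e * r) by ring] at hsq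
    exact (Nat.squarefree_mul_iff.1 hsq).1
  have hp2 : p ≠ 2 := by
    rintro rfl
    rw [← Nat.not_even_iff_odd] at hodd
    exact hodd ⟨e * r, by ring⟩
  obtain ⟨x, hx⟩ := FiniteField.exists_nonsquare (F := ZMod p) (by rwa [ZMod.ringChar_zmod_n])
  obtain ⟨z, hz1, hz2⟩ := exists_int_modEq_modEq hcop (ZMod.cast x) 1
  refine ⟨z, Int.ModEq.of_mul_right r (by exact_mod_cast hz2), ?_⟩
  · have h0 : e * r ≠ 0 := by
      intro h
      rw [show e * (p * r) = p * (e * r) by ring, h] at hsq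
      simp at hsq
    rw [show e * (p * r) = p * (e * r) by ring, jacobiSym.mul_right' _ hp.ne_zero h0,
      jacobiSym.mod_left' (b := e * r) hz2, jacobiSym.one_left, mul_one,
      ZMod.nonsquare_iff_jacobiSym_eq_neg_one, (ZMod.intCast_eq_intCast_iff _ _ _).2 hz1]
    simpa using hx

lemma exists_quadratic_char {N c q : ℕ} [NeZero N] (hN : N = c * q) (ψ : MulChar (ZMod c) ℤ)
    (hψ : ψ.IsQuadratic)
    (hc : ∀ d, d ∣ c → d ≠ c → ∃ a : ℤ, a ≡ 1 [ZMOD d] ∧ ψ a = -1)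
    (hcop : c.Coprime q) (hodd : Odd q) (hsq : Squarefree q) (hneg : ψ (-1) * χ₄ q = -1) :
    ∃ χ : DirichletCharacter ℂ N, (∀ a : ℤ, χ a = ((ψ a * J(a | q) : ℤ) : ℂ)) ∧
      χ.IsQuadratic ∧ χ.Odd ∧ χ.IsPrimitive := by
  subst hN
  have hq0 : q ≠ 0 := hsq.ne_zero
  have : NeZero q := ⟨hq0⟩
  obtain ⟨χ, hχ⟩ := exists_dirichletCharacter (N := c * q) (fun a => ψ a * J(a | q))
    (fun a b h => by
      rw [ZMod.intCast_eq_intCast_iff] at h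
      push_cast at h
      rw [jacobiSym.mod_left' (Int.ModEq.of_mul_left _ h),
        (ZMod.intCast_eq_intCast_iff a b c).2 (Int.ModEq.of_mul_right _ h)])
    (fun a b => by rw [Int.cast_mul, map_mul, jacobiSym.mul_left]; ring)
    (by simp)
    (fun a ha => by
      push_cast at ha
      rw [IsCoprime.mul_right_iff, not_and_or] at ha
      rcases ha with h | h
      · rw [ψ.map_nonunit, zero_mul]
        rwa [ZMod.coe_int_isUnit_iff_isCoprime, isCoprime_comm]
      · rw [jacobiSym.eq_zero_iff_not_coprime.2, mul_zero]
        rwa [Int.isCoprime_iff_gcd_eq_one] at h)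
  refine ⟨χ, hχ, fun x => ?_, ?_, ?_⟩
  · obtain ⟨a, rfl⟩ := ZMod.intCast_surjective x
    rw [hχ]
    rcases hψ a with h | h | h <;> rcases jacobiSym.trichotomy a q with h' | h' | h' <;>
      simp [h, h']
  · have := hχ (-1)
    rw [jacobiSym.at_neg_one hodd] at this
    push_cast at this
    rw [DirichletCharacter.Odd, this]
    exact_mod_cast congrArg (Int.cast : ℤ → ℂ) hneg
  · by_contra hprim
    rw [DirichletCharacter.IsPrimitive] at hprim
    have hdvd := χ.conductor_dvd_level
    have key (a : ℤ) (ha : a ≡ 1 [ZMOD χ.conductor]) : ψ a * J(a | q) ≠ -1 := by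
      intro h
      have h1 : χ a = -1 := by rw [hχ, h]; simp
      have hcopr : IsCoprime a (c * q : ℕ) := by
        rw [← χ.apply_ne_zero_iff, h1]; norm_num
      have h2 := χ.changeLevel_primitiveCharacter
      rw [← h2, DirichletCharacter.changeLevel_eq_cast_of_dvd' _ _ hcopr,
        (ZMod.intCast_eq_intCast_iff _ _ _).2 ha] at h1
      norm_num at h1
    generalize χ.conductor = f at *
    obtain ⟨d, e, hd, he, rfl⟩ := exists_dvd_and_dvd_of_dvd_mul hdvd
    have hde : (d : ℕ).Coprime e := hcop.of_dvd hd he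
    have hcomb (a : ℤ) (h1 : a ≡ 1 [ZMOD d]) (h2 : a ≡ 1 [ZMOD e]) : a ≡ 1 [ZMOD (d * e : ℕ)] := by
      push_cast
      exact (Int.modEq_and_modEq_iff_modEq_mul (by simpa using hde)).1 ⟨h1, h2⟩
    by_cases hdc : d = c
    · have heq : e ≠ q := by rintro rfl; exact hprim (by rw [hdc])
      obtain ⟨a, ha1, ha2⟩ := exists_jacobiSym_eq_neg_one hodd hsq he heq
      obtain ⟨z, hz1, hz2⟩ := exists_int_modEq_modEq hcop 1 a
      refine key z (hcomb z (hz1.of_dvd (by exact_mod_cast hd))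
        ((hz2.of_dvd (by exact_mod_cast he)).trans ha1)) ?_
      rw [(ZMod.intCast_eq_intCast_iff _ _ _).2 hz1, jacobiSym.mod_left' hz2, ha2]
      simp
    · obtain ⟨a, ha1, ha2⟩ := hc d hd hdc
      obtain ⟨z, hz1, hz2⟩ := exists_int_modEq_modEq hcop a 1
      refine key z (hcomb z ((hz1.of_dvd (by exact_mod_cast hd)).trans ha1)
        (hz2.of_dvd (by exact_mod_cast he))) ?_
      rw [(ZMod.intCast_eq_intCast_iff _ _ _).2 hz1, jacobiSym.mod_left' hz2, ha2]
      simp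

lemma isKronecker_of_jacobiSym {N : ℕ} {D : ℤ} {F : ℤ → ℤ} (χ : DirichletCharacter ℂ N)
    (hq : χ.IsQuadratic) (hN : N = D.natAbs) (hχ : ∀ a : ℤ, χ a = F a)
    (hD : D % 4 = 1 ∨ D % 8 = 0 ∨ D % 16 = 12) (h2 : D % 2 = 1 → F 2 = 1 → D % 8 = 1)
    (hodd : ∀ p : ℕ, p.Prime → Odd p → J(D | p) = F p) : IsKronecker χ D := by
  intro p hp hne
  have : Fact p.Prime := ⟨hp⟩
  have hF : χ p = F p := by exact_mod_cast hχ p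
  have hzero : χ p = 0 ↔ (p : ℤ) ∣ D := by
    have := χ.apply_eq_zero_iff (p : ℤ)
    rw [Int.cast_natCast] at this
    rw [this, hN, Int.natCast_natAbs, IsCoprime.abs_right_iff,
      (Nat.prime_iff_prime_int.1 hp).coprime_iff_not_dvd, not_not]
  refine ⟨?_, fun h h' => by rw [hzero.2 h'] at h; norm_num at h⟩
  rcases hp.eq_two_or_odd' with rfl | hpo
  · rcases hq (2 : ℕ) with h | h | h
    · have h2D : (2 : ℤ) ∣ D := by exact_mod_cast hzero.1 h
      rcases hD with h | h | h
      · omega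
      · exact ⟨0, by norm_num; omega⟩
      · exact ⟨2, by norm_num; omega⟩
    · have h2D : ¬ (2 : ℤ) ∣ D := fun h' => by
        rw [hzero.2 (by exact_mod_cast h')] at h; norm_num at h
      rw [hF] at h
      have := h2 (by omega) (by exact_mod_cast h)
      exact ⟨1, by norm_num; omega⟩
    · exact absurd h hne
  · have hb : ∃ b : ℤ, (p : ℤ) ∣ b ^ 2 - D := by
      rcases hq p with h | h | h
      · exact ⟨0, by simpa using hzero.1 h⟩
      · rw [hF] at h
        obtain ⟨x, hx⟩ := ZMod.isSquare_of_jacobiSym_eq_one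
          ((hodd p hp hpo).trans (by exact_mod_cast h))
        refine ⟨ZMod.cast x, (ZMod.intCast_zmod_eq_zero_iff_dvd _ _).1 ?_⟩
        push_cast
        rw [hx]; simp [sq]
      · exact absurd h hne
    obtain ⟨b, hb⟩ := hb
    have : ∃ b : ℤ, (p : ℤ) ∣ b ^ 2 - D ∧ Even (b - D) := by
      rcases Int.even_or_odd (b - D) with h | h
      · exact ⟨b, hb, h⟩
      · refine ⟨b + p, ?_, ?_⟩
        · rw [show (b + p : ℤ) ^ 2 - D = b ^ 2 - D + p * (2 * b + p) by ring]
          exact dvd_add hb (dvd_mul_right _ _)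
        · rw [show (b + p : ℤ) - D = b - D + p by ring]
          exact h.add_odd (by exact_mod_cast hpo)
    obtain ⟨b, hb, k, hk⟩ := this
    refine ⟨b, IsCoprime.mul_dvd ?_ ?_ hb⟩
    · rw [show (4 : ℤ) = 2 ^ 2 by norm_num]
      exact (Nat.isCoprime_iff_coprime.2 (Nat.coprime_two_left.2 hpo)).pow_left
    · obtain rfl : b = D + 2 * k := by omega
      rw [show (D + 2 * k) ^ 2 - D = D * (D - 1) + 4 * (D * k + k ^ 2) by ring]
      refine dvd_add ?_ (dvd_mul_right _ _)
      rcases hD with h | h | h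
      · exact Dvd.dvd.mul_left (by omega) _
      · exact Dvd.dvd.mul_right (by omega) _
      · exact Dvd.dvd.mul_right (by omega) _

lemma jacobiSym_of_mod_four_eq_one {q p : ℕ} (hq : q % 4 = 1) (hp : Odd p) :
    J(q | p) = J(p | q) :=
  jacobiSym.quadratic_reciprocity_one_mod_four hq hp

lemma jacobiSym_neg_of_mod_four_eq_three {q p : ℕ} (hq : q % 4 = 3) (hp : Odd p) :
    J(-q | p) = J(p | q) := by
  rw [jacobiSym.neg _ hp]
  rcases Nat.odd_mod_four_iff.1 (Nat.odd_iff.1 hp) with h | h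
  · rw [ZMod.χ₄_nat_one_mod_four h, one_mul,
      jacobiSym.quadratic_reciprocity_one_mod_four' (Nat.odd_iff.2 (by omega)) h]
  · rw [ZMod.χ₄_nat_three_mod_four h, jacobiSym.quadratic_reciprocity_three_mod_four hq h]
    ring

lemma exists_kronecker_char {D : ℤ} (hD : IsFundamentalDiscriminant D) (hneg : D < 0) :
    ∃ χ : DirichletCharacter ℂ D.natAbs, χ.IsQuadratic ∧ χ.Odd ∧ χ.IsPrimitive ∧
      IsKronecker χ D := by
  have : NeZero D.natAbs := ⟨by omega⟩
  obtain ⟨-, ⟨h1, hsq⟩ | ⟨m, rfl, hsq, hm⟩⟩ := hD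
  · obtain ⟨q, hq⟩ : ∃ q : ℕ, D = -q := ⟨D.natAbs, by omega⟩
    have hq4 : q % 4 = 3 := by omega
    have hqo : Odd q := Nat.odd_iff.2 (by omega)
    have hqs : Squarefree q := by
      simpa [hq, ← Int.squarefree_natAbs] using hsq
    obtain ⟨χ, hχ, hquad, hodd, hprim⟩ := exists_quadratic_char (N := D.natAbs) (c := 1) (q := q)
      (by omega) 1 (fun x => by simp [Subsingleton.elim x 1])
      (fun d hd hd' => absurd (Nat.dvd_one.1 hd) hd') (Nat.coprime_one_left q) hqo hqs
      (by rw [ZMod.χ₄_nat_three_mod_four hq4]; simp [Subsingleton.elim (-1 : ZMod 1) 1])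
    refine ⟨χ, hquad, hodd, hprim, isKronecker_of_jacobiSym χ hquad rfl hχ (.inl h1) ?_ ?_⟩
    · intro _ h2
      rw [Subsingleton.elim ((2 : ℤ) : ZMod 1) 1, map_one, one_mul, jacobiSym.at_two hqo] at h2
      rw [ZMod.χ₈_nat_eq_if_mod_eight] at h2
      split_ifs at h2 <;> omega
    · intro p hp hpo
      rw [Subsingleton.elim (((p : ℕ) : ℤ) : ZMod 1) 1, map_one, one_mul, hq,
        jacobiSym_neg_of_mod_four_eq_three hq4 hpo]
  · rcases hm with hm | hm
    · obtain ⟨q, rfl⟩ : ∃ q : ℕ, m = -(2 * q : ℕ) := ⟨m.natAbs / 2, by omega⟩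
      have hqo : Odd q := Nat.odd_iff.2 (by omega)
      have hqs : Squarefree q := by
        rw [← Int.squarefree_natAbs, Int.natAbs_neg, Int.natAbs_natCast] at hsq
        exact hsq.squarefree_of_dvd (dvd_mul_left _ _)
      have hcop : Nat.Coprime 8 q := (Nat.coprime_two_left.2 hqo).pow_left 3
      have hdvd : ∀ d : ℕ, d ∣ 8 → d ≠ 8 → (d : ℤ) ∣ 4 := by
        intro d hd hd'
        have : d ≤ 8 := Nat.le_of_dvd (by norm_num) hd
        interval_cases d <;> revert hd hd' <;> decide
      have h48 (p : ℕ) (hpo : Odd p) : J(4 * (-(2 * q : ℕ) : ℤ) | p) = χ₈' p * J(q | p) := by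
        rw [jacobiSym.mul_left, jacobiSym.at_four hpo, one_mul, ← jacobiSym.at_neg_two hpo,
          ← jacobiSym.mul_left]
        congr 1
      rcases Nat.odd_mod_four_iff.1 (Nat.odd_iff.1 hqo) with hq4 | hq4
      · obtain ⟨χ, hχ, hquad, hodd, hprim⟩ := exists_quadratic_char
          (N := (4 * (-(2 * q : ℕ) : ℤ)).natAbs) (c := 8) (q := q)
          (by omega) χ₈' ZMod.isQuadratic_χ₈'
          (fun d hd hd' => ⟨5, (Int.modEq_iff_dvd.2 (by simpa using hdvd d hd hd')).symm,
          by decide⟩)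
          hcop hqo hqs (by rw [ZMod.χ₄_nat_one_mod_four hq4]; decide)
        refine ⟨χ, hquad, hodd, hprim, isKronecker_of_jacobiSym χ hquad rfl hχ
          (by omega) (by omega) fun p hp hpo => ?_⟩
        rw [h48 p hpo, jacobiSym_of_mod_four_eq_one hq4 hpo, Int.cast_natCast]
      · obtain ⟨χ, hχ, hquad, hodd, hprim⟩ := exists_quadratic_char
          (N := (4 * (-(2 * q : ℕ) : ℤ)).natAbs) (c := 8) (q := q)
          (by omega) χ₈ ZMod.isQuadratic_χ₈
          (fun d hd hd' => ⟨5, (Int.modEq_iff_dvd.2 (by simpa using hdvd d hd hd')).symm,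
          by decide⟩)
          hcop hqo hqs (by rw [ZMod.χ₄_nat_three_mod_four hq4]; decide)
        refine ⟨χ, hquad, hodd, hprim, isKronecker_of_jacobiSym χ hquad rfl hχ
          (by omega) (by omega) fun p hp hpo => ?_⟩
        rw [← jacobiSym_neg_of_mod_four_eq_three hq4 hpo, Int.cast_natCast, ← jacobiSym.at_two hpo,
          ← jacobiSym.mul_left, jacobiSym.mul_left, jacobiSym.at_four hpo, one_mul]
        congr 1
        push_cast; ring
    · obtain ⟨q, rfl⟩ : ∃ q : ℕ, m = -(q : ℕ) := ⟨m.natAbs, by omega⟩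
      have hq4 : q % 4 = 1 := by omega
      have hqo : Odd q := Nat.odd_iff.2 (by omega)
      have hqs : Squarefree q := by
        simpa [← Int.squarefree_natAbs] using hsq
      have hdvd : ∀ d : ℕ, d ∣ 4 → d ≠ 4 → (d : ℤ) ∣ 2 := by
        intro d hd hd'
        have : d ≤ 4 := Nat.le_of_dvd (by norm_num) hd
        interval_cases d <;> revert hd hd' <;> decide
      obtain ⟨χ, hχ, hquad, hodd, hprim⟩ := exists_quadratic_char
        (N := (4 * (-(q : ℤ))).natAbs) (c := 4) (q := q)
        (by omega) χ₄ ZMod.isQuadratic_χ₄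
        (fun d hd hd' => ⟨3, (Int.modEq_iff_dvd.2 (by simpa using hdvd d hd hd')).symm,
          by decide⟩)
        ((Nat.coprime_two_left.2 hqo).pow_left 2) hqo hqs
        (by rw [ZMod.χ₄_nat_one_mod_four hq4]; decide)
      refine ⟨χ, hquad, hodd, hprim, isKronecker_of_jacobiSym χ hquad rfl hχ
        (by omega) (by omega) fun p hp hpo => ?_⟩
      rw [jacobiSym.mul_left, jacobiSym.at_four hpo, one_mul, jacobiSym.neg _ hpo,
        jacobiSym_of_mod_four_eq_one hq4 hpo, Int.cast_natCast]

end

open DirichletCharacter in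
lemma exists_product_char {N₁ N₂ : ℕ} [NeZero N₁] [NeZero N₂] {χ₁ : DirichletCharacter ℂ N₁}
    {χ₂ : DirichletCharacter ℂ N₂} (hq₁ : χ₁.IsQuadratic) (hq₂ : χ₂.IsQuadratic) (ho₁ : χ₁.Odd)
    (ho₂ : χ₂.Odd) (hp₁ : χ₁.IsPrimitive) (hp₂ : χ₂.IsPrimitive) (hne : N₁ ≠ N₂) :
    ∃ (M : ℕ) (χ₃ : DirichletCharacter ℂ M), 1 < M ∧ M ≤ N₁ * N₂ ∧ χ₃.IsQuadratic ∧ χ₃.Even ∧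
      χ₃.IsPrimitive ∧ χ₃ ≠ 1 ∧ ∀ p : ℕ, p.Prime →
        (χ₃ p = χ₁ p * χ₂ p ∨ (χ₁ p = 0 ∧ χ₂ p = 0)) := by
  have hd₁ := Nat.dvd_mul_right N₁ N₂
  have hd₂ := Nat.dvd_mul_left N₂ N₁
  have : NeZero (N₁ * N₂) := ⟨mul_ne_zero (NeZero.ne _) (NeZero.ne _)⟩
  set ψ₁ := changeLevel hd₁ χ₁ with hψ₁
  set ψ₂ := changeLevel hd₂ χ₂ with hψ₂
  have hs₁ : ψ₁ ^ 2 = 1 := by rw [hψ₁, ← map_pow, hq₁.sq_eq_one, map_one]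
  have hs₂ : ψ₂ ^ 2 = 1 := by rw [hψ₂, ← map_pow, hq₂.sq_eq_one, map_one]
  have hc₁ : ψ₁.conductor = N₁ := (conductor_changeLevel χ₁ hd₁).trans hp₁
  have hc₂ : ψ₂.conductor = N₂ := (conductor_changeLevel χ₂ hd₂).trans hp₂
  have hs : (ψ₁ * ψ₂) ^ 2 = 1 := by rw [mul_pow, hs₁, hs₂, one_mul]
  have hψ : ψ₁ * ψ₂ ≠ 1 := by
    intro h
    have : ψ₁ = ψ₂ := by
      have h' := congrArg (· * ψ₂) h
      simpa [mul_assoc, ← sq, hs₂] using h'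
    exact hne (by rw [← hc₁, this, hc₂])
  have hlvl := changeLevel_primitiveCharacter (ψ₁ * ψ₂)
  have hMd := (ψ₁ * ψ₂).conductor_dvd_level
  have hM0 := conductor_ne_zero (ψ₁ * ψ₂)
  have hM1 : (ψ₁ * ψ₂).conductor ≠ 1 := fun h => hψ (eq_one_iff_conductor_eq_one.2 h)
  have happ {a : ℤ} (h₁ : IsCoprime a (N₁ : ℤ)) (h₂ : IsCoprime a (N₂ : ℤ)) :
      (ψ₁ * ψ₂).primitiveCharacter a = χ₁ a * χ₂ a := by
    have h : IsCoprime a ((N₁ * N₂ : ℕ) : ℤ) := by push_cast; exact h₁.mul_right h₂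
    rw [primitiveCharacter_apply_of_isCoprime _ h, MulChar.mul_apply, hψ₁, hψ₂,
      changeLevel_eq_cast_of_dvd' _ _ h, changeLevel_eq_cast_of_dvd' _ _ h]
  refine ⟨_, (ψ₁ * ψ₂).primitiveCharacter, by omega,
    Nat.le_of_dvd (Nat.pos_of_ne_zero (NeZero.ne _)) hMd, ?_, ?_, primitiveCharacter_isPrimitive _,
    ?_, ?_⟩
  · refine MulChar.isQuadratic_iff_sq_eq_one.2 (changeLevel_injective hMd ?_)
    rw [map_pow, hlvl, hs, map_one]
  · have := happ (a := -1) isCoprime_one_left.neg_left isCoprime_one_left.neg_left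
    rw [DirichletCharacter.Even]
    rw [DirichletCharacter.Odd] at ho₁ ho₂
    push_cast at this
    rw [this, ho₁, ho₂]; norm_num
  · intro h
    rw [h, map_one] at hlvl
    exact hψ hlvl.symm
  · intro p hp
    have hpi := Nat.prime_iff_prime_int.1 hp
    have hz {N : ℕ} (χ : DirichletCharacter ℂ N) : χ p = 0 ↔ p ∣ N := by
      have := χ.apply_eq_zero_iff p
      rw [hpi.coprime_iff_not_dvd, not_not, Int.natCast_dvd_natCast] at this
      exact_mod_cast this
    have hl₁ : N₁ ∣ (ψ₁ * ψ₂).conductor.lcm N₂ := by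
      have := conductor_mul_dvd_lcm_conductor (ψ₁ * ψ₂) ψ₂
      rwa [mul_assoc, ← sq, hs₂, mul_one, hc₁, hc₂] at this
    have hl₂ : N₂ ∣ (ψ₁ * ψ₂).conductor.lcm N₁ := by
      have := conductor_mul_dvd_lcm_conductor (ψ₁ * ψ₂) ψ₁
      rwa [mul_right_comm, ← sq, hs₁, one_mul, hc₁, hc₂] at this
    have hlcm {a b : ℕ} (h : p ∣ a.lcm b) : p ∣ a ∨ p ∣ b :=
      hp.dvd_mul.1 (h.trans (Nat.lcm_dvd_mul a b))
    by_cases h₁ : p ∣ N₁ <;> by_cases h₂ : p ∣ N₂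
    · exact .inr ⟨(hz _).2 h₁, (hz _).2 h₂⟩
    · refine .inl ?_
      rw [(hz χ₁).2 h₁, zero_mul, hz]
      exact (hlcm (h₁.trans hl₁)).resolve_right h₂
    · refine .inl ?_
      rw [(hz χ₂).2 h₂, mul_zero, hz]
      exact (hlcm (h₂.trans hl₂)).resolve_right h₁
    · refine .inl ?_
      have hcop {N : ℕ} (h : ¬ p ∣ N) : IsCoprime (p : ℤ) (N : ℤ) := by
        rwa [hpi.coprime_iff_not_dvd, Int.natCast_dvd_natCast]
      exact_mod_cast happ (hcop h₁) (hcop h₂)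

lemma coef_trichotomy {N : ℕ} {χ : DirichletCharacter ℂ N} (hq : χ.IsQuadratic) (n : ℕ) :
    coef χ n = 0 ∨ coef χ n = 1 ∨ coef χ n = -1 := by
  by_cases hn : n = 0
  · simp [hn]
  · rcases hq n with h | h | h <;> simp [coef, hn, h]

lemma zeta_mul_coef_one {N : ℕ} {χ : DirichletCharacter ℂ N} (hq : χ.IsQuadratic) :
    (one' * coef χ) 1 = 1 :=
  (isMultiplicative_zeta_mul_coef χ hq).1

lemma exists_quadTheta_of_discr {D : ℤ} (hD : IsFundamentalDiscriminant D) (hneg : D < 0)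
    {K : Type} [Field K] [NumberField K] (h2 : Module.finrank ℚ K = 2) (hK : discr K = D) :
    ∃ χ : DirichletCharacter ℂ D.natAbs, χ.IsQuadratic ∧ χ.Odd ∧ χ.IsPrimitive ∧
      ∃ f W, QuadTheta (coef χ) (Real.log D.natAbs / 2) 1 f W ∧ lap f 1 ≤ classNumber K := by
  have : NeZero D.natAbs := ⟨by omega⟩
  obtain ⟨χ, hq, ho, hp, hk⟩ := exists_kronecker_char hD hneg
  have hχ1 : χ ≠ 1 := by
    rintro rfl
    rw [DirichletCharacter.Odd, MulChar.one_apply (isUnit_one.neg)] at ho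
    norm_num at ho
  have hN : 1 < D.natAbs := by
    by_contra h
    exact hχ1 (DirichletCharacter.level_one' χ (by omega))
  obtain ⟨f, W, h⟩ := exists_quadTheta hN hp hq hχ1 (.inr ⟨rfl, ho⟩)
  refine ⟨χ, hq, ho, hp, f, W, h, ?_⟩
  refine (h.lap_one_le_residue K (zeta_mul_coef_nonneg hq) fun n =>
    zeta_mul_coef_le_idealCount h2 χ hq (hK ▸ hk) n).trans ?_
  refine le_trans (le_of_eq ?_) (residue_le_classNumber K h2 (hK ▸ hneg))
  congr 2
  have hpos : 0 < |(D : ℝ)| := abs_pos.2 (by exact_mod_cast hneg.ne)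
  rw [hK, Real.sqrt_eq_rpow, Nat.cast_natAbs, Int.cast_abs, Real.rpow_def_of_pos hpos]
  ring_nf

lemma rpow_eq_exp {D : ℤ} (hneg : D < 0) {A : ℝ} :
    0.655 / (Real.pi * Real.log A) * |(D : ℝ)| ^ ((1 : ℝ) / 2 - 1 / Real.log A) =
      0.655 * (1 / Real.log A) / Real.pi * Real.exp (Real.log D.natAbs / 2 -
        2 * (Real.log D.natAbs / 2) * (1 / Real.log A)) := by
  have hpos : 0 < |(D : ℝ)| := abs_pos.2 (by exact_mod_cast hneg.ne)
  rw [Real.rpow_def_of_pos hpos, Nat.cast_natAbs, Int.cast_abs]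
  congr 1
  · rw [div_mul_eq_div_div, mul_one_div, div_right_comm]
  · congr 1; ring

end SiegelTatuzawa

open SiegelTatuzawa

/-- Let `A ≥ e^{11.2}`. For all fundamental discriminants `D < 0` with `|D| ≥ A`, with at most
one exception, the class number satisfies
`h(D) > (0.655/(π log A))·|D|^{1/2 − 1/log A}`. -/
theorem classNumber_gt_with_one_exception (A : ℝ) (hA : Real.exp 11.2 ≤ A) :
    {D : ℤ | IsFundamentalDiscriminant D ∧ D < 0 ∧ A ≤ |(D : ℝ)| ∧
      ¬ ∀ (K : Type) [Field K] [NumberField K], Module.finrank ℚ K = 2 →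
          NumberField.discr K = D →
            0.655 / (Real.pi * Real.log A) * |(D : ℝ)| ^ ((1 : ℝ) / 2 - 1 / Real.log A)
              < (NumberField.classNumber K : ℝ)}.Subsingleton := by
  rintro D₁ ⟨hf₁, hn₁, hA₁, hs₁⟩ D₂ ⟨hf₂, hn₂, hA₂, hs₂⟩
  by_contra hne
  push Not at hs₁ hs₂
  obtain ⟨K₁, _, _, h2₁, hK₁, hs₁⟩ := hs₁
  obtain ⟨K₂, _, _, h2₂, hK₂, hs₂⟩ := hs₂
  obtain ⟨χ₁, hq₁, ho₁, hp₁, f₁, W₁, hT₁, hl₁⟩ := exists_quadTheta_of_discr hf₁ hn₁ h2₁ hK₁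
  obtain ⟨χ₂, hq₂, ho₂, hp₂, f₂, W₂, hT₂, hl₂⟩ := exists_quadTheta_of_discr hf₂ hn₂ h2₂ hK₂
  have : NeZero D₁.natAbs := ⟨by omega⟩
  have : NeZero D₂.natAbs := ⟨by omega⟩
  obtain ⟨M, χ₃, hM1, hM, hq₃, he₃, hp₃, hχ₃, hloc⟩ :=
    exists_product_char hq₁ hq₂ ho₁ ho₂ hp₁ hp₂ (by omega)
  have : NeZero M := ⟨by omega⟩
  obtain ⟨f₃, W₃, hT₃⟩ := exists_quadTheta hM1 hp₃ hq₃ hχ₃ (.inl ⟨rfl, he₃⟩)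
  have hA0 : 0 < A := (Real.exp_pos _).trans_le hA
  have hlog : 11.2 ≤ Real.log A := (Real.le_log_iff_exp_le hA0).2 hA
  have hlog0 : 0 < Real.log A := by norm_num at hlog ⊢; linarith
  have hsize {D : ℤ} (h : A ≤ |(D : ℝ)|) :
      1 ≤ 2 * (Real.log D.natAbs / 2) * (1 / Real.log A) := by
    rw [mul_one_div, one_le_div hlog0, mul_div_cancel₀ _ two_ne_zero, Nat.cast_natAbs,
      Int.cast_abs]
    exact Real.log_le_log hA0 h
  refine false_of_two_small hT₁ hT₂ hT₃ (by positivity) ?_ (zeta_mul_coef_nonneg hq₁)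
    (zeta_mul_coef_one hq₁).ge (one_le_zeta_mul_coef_four χ₁ hq₁) (zeta_mul_coef_nonneg hq₂)
    (zeta_mul_coef_one hq₂).ge (one_le_zeta_mul_coef_four χ₂ hq₂) ?_ ?_
    (ε := 1 / Real.log A) (by positivity) ?_ (hsize hA₁) (hsize hA₂) ?_ ?_
  · rw [← add_div, ← Real.log_mul (NeZero.ne _) (NeZero.ne _)]
    gcongr
    exact_mod_cast hM
  · refine biquad_coeff_nonneg (compMul_coef hq₁) (compMul_coef hq₂) (compMul_coef hq₃)
      (coef_trichotomy hq₁) (coef_trichotomy hq₂) (coef_trichotomy hq₃) fun p hp => ?_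
    rw [coef_prime χ₁ hp, coef_prime χ₂ hp, coef_prime χ₃ hp]
    rcases hloc p hp with h | ⟨h, h'⟩
    · left
      rw [h]
      rcases hq₂ p with h | h | h <;> simp [h]
    · simp [h, h']
  · exact (compMul_one'.isMultiplicative.mul ((compMul_coef hq₁).isMultiplicative.mul
      ((compMul_coef hq₂).isMultiplicative.mul (compMul_coef hq₃).isMultiplicative))).1.ge
  · rw [mul_one_div, div_le_one hlog0]; exact hlog
  · rw [← rpow_eq_exp hn₁]; exact hl₁.trans hs₁
  · rw [← rpow_eq_exp hn₂]; exact hl₂.trans hs₂
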